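/- For every integer a, the set of solutions (x, y) ∈ ℤ² of the family of Thue equations x(x − y)(x − ay)(x − (a+1)y) − y⁴ = ±1 (that is, x(x − y)(x − ay)(x − (a+1)y) − y⁴ ∈ {1, −1}) is exactly the set of trivial solutions {(1, 0), (−1, 0), (0, 1), (0, −1), (1, 1), (−1, −1), (a, 1), (−a, −1), (a+1, 1), (−(a+1), −1)}. -/

import Mathlib

open Finset in
theorem abs_det_le_of_entries {ι : Type*} [Fintype ι] [DecidableEq ι] (A : Matrix ι ι ℝ)
    (B : ι → ℝ) (h : ∀ i j, |A i j| ≤ B i) :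
    |A.det| ≤ (Fintype.card ι).factorial * ∏ i, B i := by
  rw [Matrix.det_apply]
  refine (abs_sum_le_sum_abs _ _).trans ?_
  calc ∑ σ : Equiv.Perm ι, |Equiv.Perm.sign σ • ∏ i, A (σ i) i|
      ≤ ∑ _σ : Equiv.Perm ι, ∏ i, B i := by
        refine sum_le_sum fun σ _ => ?_
        rw [← Equiv.prod_comp σ B, Units.smul_def, zsmul_eq_mul, abs_mul, abs_prod]
        have : |((Equiv.Perm.sign σ : ℤ) : ℝ)| = 1 := by
          rcases Int.units_eq_one_or (Equiv.Perm.sign σ) with h | h <;> simp [h]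
        rw [this, one_mul]
        exact prod_le_prod (fun i _ => abs_nonneg _) fun i _ => h _ _
    _ = _ := by simp [Fintype.card_perm]

open Finset in
theorem card_mul_pred_div_two_le_sum_of_injective {ι : Type*} [Fintype ι] (g : ι → ℕ)
    (hg : Function.Injective g) :
    Fintype.card ι * (Fintype.card ι - 1) / 2 ≤ ∑ i, g i := by
  classical
  have h := Finset.sum_range_le_sum (s :=
      univ.map ⟨fun i => (g i : ℤ), fun a b hab => hg (by simpa using hab)⟩)
    (c := 0) (fun z hz => by
      obtain ⟨i, -, rfl⟩ := mem_map.1 hz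
      exact Int.natCast_nonneg (g i))
  rw [sum_map, card_map, card_univ] at h
  simp only [zero_add] at h
  change _ ≤ ∑ i, (g i : ℤ) at h
  rw [← sum_range_id]
  zify; exact h

open Finset in
theorem abs_det_sum_pow_mul_le {ι : Type*} [Fintype ι] [DecidableEq ι] (a : ι → ℕ → ℝ)
    (x : ι → ℝ) {X ρ : ℝ} (hX : 0 ≤ X) (hρ : 1 ≤ ρ) (hx : ∀ j, |x j| ≤ X) (M : ℕ) :
    |(Matrix.of fun i j => ∑ k ∈ range M, a i k * x j ^ k).det| *
        ρ ^ (Fintype.card ι * (Fintype.card ι - 1) / 2) ≤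
      (Fintype.card ι).factorial * ∏ i, ∑ k ∈ range M, |a i k| * (ρ * X) ^ k := by
  have hρ0 : 0 ≤ ρ := by linarith
  have key : (Matrix.of fun i j => ∑ k ∈ range M, a i k * x j ^ k).det =
      ∑ g ∈ Fintype.piFinset fun _ : ι => range M,
        (∏ i, a i (g i)) * (Matrix.of fun i j => x j ^ g i).det := by
    have := (Matrix.detRowAlternating (R := ℝ) (n := ι)).toMultilinearMap.map_sum_finset
      (fun i (k : ℕ) => a i k • fun j => x j ^ k) (fun _ => range M)
    have h2 : (fun i => ∑ k ∈ range M, a i k • fun j => x j ^ k) =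
        Matrix.of fun i j => ∑ k ∈ range M, a i k * x j ^ k := by
      ext i j; simp [Finset.sum_apply]
    rw [h2] at this
    refine Eq.trans this (sum_congr rfl fun g _ => ?_)
    exact (Matrix.detRowAlternating (R := ℝ) (n := ι)).toMultilinearMap.map_smul_univ
      (fun i => a i (g i)) (fun i j => x j ^ g i)
  rw [key, prod_univ_sum, mul_sum]
  refine (mul_le_mul_of_nonneg_right (abs_sum_le_sum_abs _ _) (by positivity)).trans ?_
  rw [sum_mul]
  refine sum_le_sum fun g _ => ?_
  rw [prod_mul_distrib, abs_mul, abs_prod, mul_left_comm, mul_assoc]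
  refine mul_le_mul_of_nonneg_left ?_ (prod_nonneg fun i _ => abs_nonneg _)
  by_cases hg : Function.Injective g
  · have h1 := abs_det_le_of_entries (Matrix.of fun i j => x j ^ g i) (fun i => X ^ g i)
      (fun i j => by simpa [abs_pow] using pow_le_pow_left₀ (abs_nonneg _) (hx j) _)
    have h2 := card_mul_pred_div_two_le_sum_of_injective g hg
    have h3 : ρ ^ (Fintype.card ι * (Fintype.card ι - 1) / 2) ≤ ρ ^ ∑ i, g i :=
      pow_le_pow_right₀ hρ h2
    calc _ ≤ ((Fintype.card ι).factorial * ∏ i, X ^ g i) * ρ ^ ∑ i, g i := by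
          gcongr
      _ = _ := by
          rw [← prod_pow_eq_pow_sum]
          simp_rw [mul_pow, prod_mul_distrib]; ring
  · have : (Matrix.of fun i j => x j ^ g i).det = 0 := by
      simp only [Function.Injective, not_forall] at hg
      obtain ⟨p, q, h1, h2⟩ := hg
      exact Matrix.det_zero_of_row_eq h2 (by ext j; simp [h1])
    rw [this]; simp only [abs_zero, zero_mul]
    exact mul_nonneg (by positivity) (prod_nonneg fun i _ => by positivity)

open Finset Filter Topology in
theorem abs_det_powerSeries_mul_le {ι : Type*} [Fintype ι] [DecidableEq ι] (a : ι → ℕ → ℝ)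
    (x : ι → ℝ) {X ρ : ℝ} (hX : 0 ≤ X) (hρ : 1 ≤ ρ) (hx : ∀ j, |x j| ≤ X)
    (f : ι → ι → ℝ) (S : ι → ℝ) (hf : ∀ i j, HasSum (fun k => a i k * x j ^ k) (f i j))
    (hS : ∀ i, HasSum (fun k => |a i k| * (ρ * X) ^ k) (S i)) :
    |(Matrix.of f).det| * ρ ^ (Fintype.card ι * (Fintype.card ι - 1) / 2) ≤
      (Fintype.card ι).factorial * ∏ i, S i := by
  have h1 : Tendsto (fun M => Matrix.of fun i j => ∑ k ∈ range M, a i k * x j ^ k) atTop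
      (𝓝 (Matrix.of f)) := by
    refine tendsto_pi_nhds.2 fun i => tendsto_pi_nhds.2 fun j => ?_
    exact (hf i j).tendsto_sum_nat
  have h2 : Tendsto (fun M => |(Matrix.of fun i j => ∑ k ∈ range M, a i k * x j ^ k).det| *
      ρ ^ (Fintype.card ι * (Fintype.card ι - 1) / 2)) atTop
      (𝓝 (|(Matrix.of f).det| * ρ ^ (Fintype.card ι * (Fintype.card ι - 1) / 2))) := by
    have hc : Continuous fun A : Matrix ι ι ℝ => A.det := Continuous.matrix_det continuous_id
    exact ((continuous_abs.comp hc).tendsto _ |>.comp h1).mul_const _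
  have h3 : Tendsto (fun M => ((Fintype.card ι).factorial : ℝ) *
      ∏ i, ∑ k ∈ range M, |a i k| * (ρ * X) ^ k) atTop
      (𝓝 ((Fintype.card ι).factorial * ∏ i, S i)) :=
    (tendsto_finsetProd _ fun i _ => (hS i).tendsto_sum_nat).const_mul _
  exact le_of_tendsto_of_tendsto' h2 h3 fun M => abs_det_sum_pow_mul_le a x hX hρ hx M

/-- The determinant of a matrix with entries `f i j * (1 + u i j)`, `u` small, is close to the
determinant of `f`. -/
theorem abs_det_mul_sub_le {ι : Type*} [Fintype ι] [DecidableEq ι] (f u : ι → ι → ℝ)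
    (B : ι → ℝ) {η : ℝ} (hη : 0 ≤ η) (hf : ∀ i j, |f i j| ≤ B i) (hu : ∀ i j, |u i j| ≤ η)
    (hsmall : Fintype.card ι * η ≤ 1) :
    |(Matrix.of fun i j => f i j * (1 + u i j)).det - (Matrix.of f).det| ≤
      (Fintype.card ι).factorial * (∏ i, B i) * (2 * (Fintype.card ι * η)) := by
  have hprod : ∀ (s : Finset ι) (v : ι → ℝ), (∀ i, |v i| ≤ η) →
      |∏ i ∈ s, (1 + v i) - 1| ≤ (1 + η) ^ s.card - 1 := by
    intro s v hv
    induction s using Finset.induction_on with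
    | empty => simp
    | insert a s ha ih =>
      rw [Finset.prod_insert ha, Finset.card_insert_of_notMem ha, pow_succ]
      have e : (1 + v a) * ∏ i ∈ s, (1 + v i) - 1 =
        (1 + v a) * (∏ i ∈ s, (1 + v i) - 1) + v a := by ring
      rw [e]
      have h1 : |1 + v a| ≤ 1 + η := by
        have := abs_add_le 1 (v a); rw [abs_one] at this; linarith [hv a]
      have h2 := abs_add_le ((1 + v a) * (∏ i ∈ s, (1 + v i) - 1)) (v a)
      rw [abs_mul] at h2
      have h3 := mul_le_mul h1 ih (abs_nonneg _) (by linarith)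
      nlinarith [hv a]
  have hpow : (1 + η) ^ Fintype.card ι - 1 ≤ 2 * (Fintype.card ι * η) := by
    have h1 : (1 + η) ^ Fintype.card ι ≤ Real.exp (Fintype.card ι * η) := by
      rw [Real.exp_nat_mul]
      exact pow_le_pow_left₀ (by linarith) (by linarith [Real.add_one_le_exp η]) _
    have h2 := Real.abs_exp_sub_one_le (x := Fintype.card ι * η)
      (by rw [abs_of_nonneg (by positivity)]; exact hsmall)
    rw [abs_of_nonneg (a := (Fintype.card ι : ℝ) * η) (by positivity)] at h2
    linarith [le_abs_self (Real.exp (Fintype.card ι * η) - 1)]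
  rw [Matrix.det_apply, Matrix.det_apply, ← Finset.sum_sub_distrib]
  refine (Finset.abs_sum_le_sum_abs _ _).trans ?_
  calc _ ≤ ∑ _σ : Equiv.Perm ι, (∏ i, B i) * (2 * (Fintype.card ι * η)) := by
        refine Finset.sum_le_sum fun σ _ => ?_
        rw [← smul_sub, Units.smul_def, zsmul_eq_mul, abs_mul]
        have : |((Equiv.Perm.sign σ : ℤ) : ℝ)| = 1 := by
          rcases Int.units_eq_one_or (Equiv.Perm.sign σ) with h | h <;> simp [h]
        rw [this, one_mul]
        simp only [Matrix.of_apply, Finset.prod_mul_distrib]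
        have e : (∏ i, f (σ i) i) * ∏ i, (1 + u (σ i) i) - ∏ i, f (σ i) i =
          (∏ i, f (σ i) i) * (∏ i, (1 + u (σ i) i) - 1) := by ring
        rw [e, abs_mul, Finset.abs_prod, ← Equiv.prod_comp σ B]
        refine mul_le_mul (Finset.prod_le_prod (fun i _ => abs_nonneg _) fun i _ => hf _ _)
          ((hprod _ _ fun i => hu _ _).trans hpow) (abs_nonneg _)
          (Finset.prod_nonneg fun i _ => (abs_nonneg _).trans (hf (σ i) i))
    _ = _ := by simp [Fintype.card_perm, mul_assoc]

open Polynomial in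
/-- A determinant of shifted polynomials twisted by powers has a nonzero leading coefficient. -/
theorem coeff_det_shift_ne_zero {n K : ℕ} (p : Fin n → ℝ[X]) (hp : ∀ j, p j ≠ 0)
    (hdeg : ∀ j, (p j).natDegree ≤ K) (c : ℝ) {v : Fin n → ℝ} (hv : Function.Injective v) :
    (Matrix.det (Matrix.of fun i j : Fin n => X ^ (K - (p j).natDegree) *
        (C (v j ^ (i : ℕ)) * (p j).comp (X + C ((i : ℕ) * c))))).coeff (n * K) ≠ 0 ∧
    (Matrix.det (Matrix.of fun i j : Fin n => X ^ (K - (p j).natDegree) *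
        (C (v j ^ (i : ℕ)) * (p j).comp (X + C ((i : ℕ) * c))))).natDegree ≤ n * K := by
  set M : Matrix (Fin n) (Fin n) ℝ[X] := Matrix.of fun i j : Fin n => X ^ (K - (p j).natDegree) *
        (C (v j ^ (i : ℕ)) * (p j).comp (X + C ((i : ℕ) * c))) with hM
  have hc : ∀ i j, ((p j).comp (X + C ((i : Fin n) * c : ℝ))).natDegree = (p j).natDegree := by
    intro i j; rw [natDegree_comp, natDegree_X_add_C, mul_one]
  have hMdeg : ∀ i j, (M i j).natDegree ≤ K := by
    intro i j
    rw [hM, Matrix.of_apply]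
    refine natDegree_mul_le.trans ?_
    rw [natDegree_X_pow]
    have h1 := natDegree_C_mul_le (v j ^ (i : ℕ)) ((p j).comp (X + C ((i : ℕ) * c : ℝ)))
    rw [hc] at h1
    have := hdeg j
    omega
  have hMco : ∀ i j, (M i j).coeff K = v j ^ (i : ℕ) * (p j).leadingCoeff := by
    intro i j
    rw [hM, Matrix.of_apply]
    have hk : K = (p j).natDegree + (K - (p j).natDegree) := by have := hdeg j; omega
    conv_lhs => rw [hk]
    rw [show (p j).natDegree + (K - (p j).natDegree) - (p j).natDegree =
        K - (p j).natDegree by omega,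
      mul_comm, coeff_mul_X_pow, coeff_C_mul]
    congr 1
    have h1 := leadingCoeff_comp (p := p j) (q := X + C ((i : ℕ) * c : ℝ))
      (by rw [natDegree_X_add_C]; exact one_ne_zero)
    rw [leadingCoeff, hc, leadingCoeff_X_add_C, one_pow, mul_one] at h1
    exact h1
  have hprod : ∀ σ : Equiv.Perm (Fin n), (∏ i, M (σ i) i).coeff (n * K) =
      ∏ i, (M (σ i) i).coeff K := by
    intro σ
    have := coeff_prod_of_natDegree_le (s := Finset.univ) (fun i => M (σ i) i) K
      (fun i _ => hMdeg _ _)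
    simpa using this
  constructor
  · have : M.det.coeff (n * K) = ((Matrix.vandermonde v).det) * ∏ j, (p j).leadingCoeff := by
      rw [← Matrix.det_transpose (Matrix.vandermonde v),
        mul_comm (Matrix.det _), ← Matrix.det_mul_row,
        Matrix.det_apply, Matrix.det_apply, finsetSum_coeff]
      refine Finset.sum_congr rfl fun σ _ => ?_
      rw [Units.smul_def, Units.smul_def, coeff_smul, hprod]
      congr 1
      refine Finset.prod_congr rfl fun i _ => ?_
      rw [hMco]; simp [Matrix.vandermonde_apply, mul_comm]
    rw [this]
    exact mul_ne_zero (Matrix.det_vandermonde_ne_zero_iff.2 hv)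
      (Finset.prod_ne_zero_iff.2 fun j _ => leadingCoeff_ne_zero.2 (hp j))
  · rw [Matrix.det_apply]
    refine natDegree_sum_le_of_forall_le _ _ fun σ _ => ?_
    rw [Units.smul_def]
    refine (natDegree_smul_le _ _).trans ((natDegree_prod_le _ _).trans ?_)
    refine (Finset.sum_le_sum fun i _ => hMdeg (σ i) i).trans ?_
    simp

open Polynomial in
/-- Zero estimate for exponential polynomials in `x = t e₁ - r e₂`, `y = α ^ r * β ^ t`. -/
theorem exponential_polynomial_zero_estimate {K L R T : ℕ} (e₁ e₂ : ℤ) {α β : ℝ} (hα : 0 < α)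
    (hβ : 0 < β) (hβ1 : β ≠ 1) (hLT : L ≤ T) (hcard : L * K < R * (T - L))
    (hinj : ∀ r < R, ∀ t < T, ∀ r' < R, ∀ t' < T,
      (t : ℤ) * e₁ - r * e₂ = t' * e₁ - r' * e₂ → r = r' ∧ t = t')
    (p : Fin L → ℝ[X]) (hdeg : ∀ l, (p l).natDegree ≤ K)
    (hzero : ∀ r < R, ∀ t < T, ∑ l, (p l).eval ((t * e₁ - r * e₂ : ℤ) : ℝ) *
      (α ^ r * β ^ t) ^ (l : ℕ) = 0) :
    ∀ l, p l = 0 := by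
  classical
  by_contra! hne
  set I : Finset (Fin L) := Finset.univ.filter fun l => p l ≠ 0 with hI
  obtain ⟨n, hn⟩ : ∃ n, I.card = n := ⟨_, rfl⟩
  have hnL : n ≤ L := by rw [← hn]; simpa using Finset.card_le_univ I
  have hnpos : 0 < n := by
    obtain ⟨l, hl⟩ := hne
    rw [← hn]; exact Finset.card_pos.2 ⟨l, by simp [hI, hl]⟩
  set φ := I.orderEmbOfFin hn with hφ
  have hv : Function.Injective fun j : Fin n => β ^ ((φ j : Fin L) : ℕ) := by
    intro i j hij
    have := pow_right_injective₀ hβ hβ1 hij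
    exact φ.injective (Fin.ext this)
  have hpφ : ∀ j, p (φ j) ≠ 0 := fun j =>
    (Finset.mem_filter.1 (Finset.orderEmbOfFin_mem I hn j)).2
  obtain ⟨h1, h2⟩ := coeff_det_shift_ne_zero (K := K) (fun j => p (φ j)) hpφ (fun j => hdeg _)
    (e₁ : ℝ) hv
  set D := Matrix.det (Matrix.of fun i j : Fin n => X ^ (K - (p (φ j)).natDegree) *
        (C ((β ^ ((φ j : Fin L) : ℕ)) ^ (i : ℕ)) * (p (φ j)).comp (X + C ((i : ℕ) * (e₁ : ℝ)))))
    with hD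
  have hD0 : D ≠ 0 := fun h => h1 (by rw [h]; simp)
  have hroot : ∀ r < R, ∀ t < T - L, D.eval ((t * e₁ - r * e₂ : ℤ) : ℝ) = 0 := by
    intro r hr t ht
    set x : ℝ := ((t * e₁ - r * e₂ : ℤ) : ℝ) with hx
    have e : D.eval x = Matrix.det (Matrix.of fun i j : Fin n =>
        x ^ (K - (p (φ j)).natDegree) *
        (Matrix.of fun i j : Fin n => (β ^ ((φ j : Fin L) : ℕ)) ^ (i : ℕ) *
          (p (φ j)).eval (x + (i : ℕ) * e₁)) i j) := by
      rw [hD, ← coe_evalRingHom, RingHom.map_det]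
      congr 1
      ext i j
      simp [eval_comp]
    rw [e, Matrix.det_mul_row]
    refine mul_eq_zero_of_right _ (Matrix.exists_mulVec_eq_zero_iff.1
      ⟨fun j => (α ^ r * β ^ t) ^ ((φ j : Fin L) : ℕ), ?_, ?_⟩)
    · intro h
      have := congrFun h ⟨0, hnpos⟩
      have hpos : 0 < (α ^ r * β ^ t) ^ ((φ ⟨0, hnpos⟩ : Fin L) : ℕ) := by positivity
      exact hpos.ne' this
    · ext i
      have hz := hzero r hr (t + i) (by omega)
      have hs : ∑ l, (p l).eval (((t + i : ℕ) * e₁ - r * e₂ : ℤ) : ℝ) *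
          (α ^ r * β ^ (t + (i : ℕ))) ^ (l : ℕ) = ∑ l ∈ I,
          (p l).eval (((t + i : ℕ) * e₁ - r * e₂ : ℤ) : ℝ) *
          (α ^ r * β ^ (t + (i : ℕ))) ^ (l : ℕ) := by
        symm
        refine Finset.sum_subset (Finset.subset_univ _) fun l _ hl => ?_
        have : p l = 0 := by simpa [hI] using hl
        simp [this]
      rw [hs, ← Finset.map_orderEmbOfFin_univ I hn, Finset.sum_map] at hz
      simp only [Matrix.mulVec, dotProduct, Matrix.of_apply, Pi.zero_apply]
      rw [← hz]
      refine Finset.sum_congr rfl fun j _ => ?_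
      have : (((t + i : ℕ) * e₁ - r * e₂ : ℤ) : ℝ) = x + (i : ℕ) * e₁ := by
        rw [hx]; push_cast; ring
      rw [this]
      change _ = (p (φ j)).eval _ * (α ^ r * β ^ (t + (i : ℕ))) ^ ((φ j : Fin L) : ℕ)
      ring
  set f : Fin R × Fin (T - L) → ℝ :=
      fun q => ((((q.2 : ℕ) : ℤ) * e₁ - ((q.1 : ℕ) : ℤ) * e₂ : ℤ) : ℝ) with hf
  have hfinj : Function.Injective f := by
    rintro ⟨r, t⟩ ⟨r', t'⟩ h
    have h' : ((t : ℕ) : ℤ) * e₁ - (r : ℕ) * e₂ = (t' : ℕ) * e₁ - (r' : ℕ) * e₂ :=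
      Int.cast_injective h
    obtain ⟨h3, h4⟩ := hinj r r.2 t (by omega) r' r'.2 t' (by omega) h'
    exact Prod.ext (Fin.ext h3) (Fin.ext h4)
  refine hD0 (eq_zero_of_natDegree_lt_card_of_eval_eq_zero D hfinj
    (fun q => hroot q.1 q.1.2 q.2 q.2.2) ?_)
  rw [Fintype.card_prod, Fintype.card_fin, Fintype.card_fin]
  exact (h2.trans (Nat.mul_le_mul_right _ hnL)).trans_lt hcard

/-- Linearly independent functions have a nonvanishing interpolation determinant. -/
theorem exists_det_ne_zero_of_linearIndependent {ι γ : Type*} [Fintype ι] [DecidableEq ι]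
    [Finite γ] (f : ι → γ → ℝ) (hf : LinearIndependent ℝ f) :
    ∃ q : ι → γ, (Matrix.of fun i j => f i (q j)).det ≠ 0 := by
  classical
  set c : γ → ι → ℝ := fun g i => f i g with hc
  have hspan : Submodule.span ℝ (Set.range c) = ⊤ := by
    by_contra hne
    obtain ⟨φ, hφ0, hφ⟩ := Submodule.exists_le_ker_of_lt_top _ (lt_top_iff_ne_top.2 hne)
    rw [Fintype.linearIndependent_iff] at hf
    refine hφ0 (LinearMap.pi_ext' fun i => LinearMap.ext_ring ?_)
    have h0 : ∑ i, φ (Pi.single i 1) • f i = 0 := by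
      ext g
      have h1 : φ (c g) = 0 := hφ (Submodule.subset_span ⟨g, rfl⟩)
      rw [LinearMap.pi_apply_eq_sum_univ φ (c g)] at h1
      rw [Finset.sum_apply, Pi.zero_apply, ← h1]
      refine Finset.sum_congr rfl fun i _ => ?_
      simp only [Pi.smul_apply, smul_eq_mul, hc, mul_comm]
      congr 2
      ext j; simp [Pi.single_apply, eq_comm]
    simpa using hf _ h0 i
  obtain ⟨b, hbs, hb, hli⟩ := exists_linearIndependent ℝ (Set.range c)
  rw [hspan] at hb
  let B : Module.Basis b ℝ (ι → ℝ) := Module.Basis.mk hli (by simp [hb])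
  let B' := B.reindex (B.indexEquiv (Pi.basisFun ℝ ι))
  have hB' : ∀ i, ∃ g, c g = B' i := by
    intro i
    have : B' i ∈ b := by simp [B', B, Module.Basis.reindex_apply]
    exact hbs this
  choose q hq using hB'
  refine ⟨q, ?_⟩
  have hl : LinearIndependent ℝ (Matrix.of fun i j => f i (q j)).col := by
    have : (Matrix.of fun i j => f i (q j)).col = B' := by
      ext j i
      rw [← hq]; rfl
    rw [this]; exact B'.linearIndependent
  have := Matrix.linearIndependent_cols_iff_isUnit.1 hl
  exact ((Matrix.isUnit_iff_isUnit_det _).1 this).ne_zero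

/-- The interpolation determinant built from the functions `x ^ k * exp (l * (r a + t c))`,
`x = t e₁ - r e₂`, evaluated at the pairs `(r, t)`. -/
noncomputable def interpDet (K L : ℕ) (e₁ e₂ : ℤ) (q : Fin (K + 1) × Fin L → ℕ × ℕ) (a c : ℝ) : ℝ :=
  (Matrix.of fun i j : Fin (K + 1) × Fin L =>
    (((q j).2 * e₁ - (q j).1 * e₂ : ℤ) : ℝ) ^ (i.1 : ℕ) *
      Real.exp ((i.2 : ℕ) * ((q j).1 * a + (q j).2 * c))).det

open Polynomial in
theorem exists_interpDet_ne_zero {K L R T : ℕ} (e₁ e₂ : ℤ) {a c : ℝ} (hc : c ≠ 0) (hLT : L ≤ T)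
    (hcard : L * K < R * (T - L))
    (hinj : ∀ r < R, ∀ t < T, ∀ r' < R, ∀ t' < T,
      (t : ℤ) * e₁ - r * e₂ = t' * e₁ - r' * e₂ → r = r' ∧ t = t') :
    ∃ q : Fin (K + 1) × Fin L → ℕ × ℕ, (∀ j, (q j).1 < R ∧ (q j).2 < T) ∧
      interpDet K L e₁ e₂ q a c ≠ 0 := by
  have hli : LinearIndependent ℝ fun (i : Fin (K + 1) × Fin L) (g : Fin R × Fin T) =>
      ((((g.2 : ℕ) : ℤ) * e₁ - ((g.1 : ℕ) : ℤ) * e₂ : ℤ) : ℝ) ^ (i.1 : ℕ) *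
      Real.exp ((i.2 : ℕ) * (((g.1 : ℕ) : ℝ) * a + ((g.2 : ℕ) : ℝ) * c)) := by
    rw [Fintype.linearIndependent_iff]
    intro v hv
    set p : Fin L → ℝ[X] := fun l => ∑ k : Fin (K + 1), C (v (k, l)) * X ^ (k : ℕ) with hp
    have hdeg : ∀ l, (p l).natDegree ≤ K := by
      intro l
      refine natDegree_sum_le_of_forall_le _ _ fun k _ => ?_
      exact (natDegree_C_mul_X_pow_le _ _).trans (by omega)
    have h := exponential_polynomial_zero_estimate e₁ e₂ (Real.exp_pos a) (Real.exp_pos c)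
      (by simpa using hc) hLT hcard hinj p hdeg (fun r hr t ht => by
        have h1 := congrFun hv (⟨r, hr⟩, ⟨t, ht⟩)
        rw [Finset.sum_apply, Fintype.sum_prod_type_right, Pi.zero_apply] at h1
        rw [← h1]
        refine Finset.sum_congr rfl fun l _ => ?_
        rw [hp, eval_finsetSum, Finset.sum_mul]
        refine Finset.sum_congr rfl fun k _ => ?_
        simp only [eval_mul, eval_C, eval_pow, eval_X, Pi.smul_apply, smul_eq_mul]
        rw [← Real.exp_nat_mul a, ← Real.exp_nat_mul c, ← Real.exp_add, ← Real.exp_nat_mul,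
          mul_assoc])
    rintro ⟨k, l⟩
    have h2 := congrArg (fun f => f.coeff (k : ℕ)) (h l)
    simp only [hp, finsetSum_coeff, coeff_C_mul_X_pow, coeff_zero] at h2
    rw [Finset.sum_eq_single k (fun m _ hm => if_neg fun h => hm (Fin.ext h.symm))
      (by simp), if_pos rfl] at h2
    exact h2
  obtain ⟨q, hq⟩ := exists_det_ne_zero_of_linearIndependent _ hli
  exact ⟨fun j => ((q j).1, (q j).2), fun j => ⟨(q j).1.2, (q j).2.2⟩, hq⟩

/-- The exponent `∑ (ξ k + B l)` over the index set of the interpolation determinant. -/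
theorem prod_exp_grid (K L : ℕ) (ξ B : ℝ) :
    ∏ i : Fin (K + 1) × Fin L, Real.exp (ξ * (i.1 : ℕ) + B * (i.2 : ℕ)) =
      Real.exp (((K + 1 : ℕ) * L : ℝ) * (ξ * K + B * (L - 1)) / 2) := by
  have hs : ∀ n : ℕ, ∑ k : Fin n, ((k : ℕ) : ℝ) = n * (n - 1) / 2 := by
    intro n
    rw [Fin.sum_univ_eq_sum_range (fun k => (k : ℝ))]
    induction n with
    | zero => simp
    | succ n ih => rw [Finset.sum_range_succ, ih]; push_cast; ring
  rw [← Real.exp_sum, Fintype.sum_prod_type]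
  simp only [Finset.sum_add_distrib, ← Finset.mul_sum, Finset.sum_const, Finset.card_univ,
    Fintype.card_fin, nsmul_eq_mul, hs]
  congr 1
  push_cast; ring

theorem abs_interpDet_le {K L R : ℕ} (e₁ e₂ : ℤ) (q : Fin (K + 1) × Fin L → ℕ × ℕ)
    (hq : ∀ j, (q j).1 ≤ R ∧ (q j).2 ≤ R) {a c A ξ : ℝ} (ha : |a| ≤ A) (hc : |c| ≤ A)
    (hξ : R * (|(e₁ : ℝ)| + |(e₂ : ℝ)|) ≤ Real.exp ξ) :
    |interpDet K L e₁ e₂ q a c| ≤ ((K + 1) * L).factorial *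
      Real.exp (((K + 1 : ℕ) * L : ℝ) * (ξ * K + 2 * A * R * (L - 1)) / 2) := by
  have h := abs_det_le_of_entries (Matrix.of fun i j : Fin (K + 1) × Fin L =>
    (((q j).2 * e₁ - (q j).1 * e₂ : ℤ) : ℝ) ^ (i.1 : ℕ) *
      Real.exp ((i.2 : ℕ) * ((q j).1 * a + (q j).2 * c)))
    (fun i => Real.exp (ξ * (i.1 : ℕ) + 2 * A * R * (i.2 : ℕ))) (fun i j => by
      rw [Matrix.of_apply, abs_mul, abs_pow, Real.abs_exp, Real.exp_add, mul_comm ξ,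
        Real.exp_nat_mul ξ]
      have h1 : |(((q j).2 * e₁ - (q j).1 * e₂ : ℤ) : ℝ)| ≤ Real.exp ξ := by
        refine le_trans ?_ hξ
        push_cast
        refine (abs_sub _ _).trans ?_
        rw [abs_mul, abs_mul, Nat.abs_cast, Nat.abs_cast, mul_add]
        have := (hq j).1; have := (hq j).2
        gcongr
      have hA : 0 ≤ A := (abs_nonneg _).trans ha
      have h2 : ((q j).1 : ℝ) * a + (q j).2 * c ≤ 2 * A * R := by
        have r1 : ((q j).1 : ℝ) ≤ R := by exact_mod_cast (hq j).1
        have r2 : ((q j).2 : ℝ) ≤ R := by exact_mod_cast (hq j).2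
        have h3 : ((q j).1 : ℝ) * a ≤ R * A :=
          mul_le_mul_of_nonneg_left ((le_abs_self _).trans ha) (Nat.cast_nonneg _) |>.trans
            (mul_le_mul_of_nonneg_right r1 hA)
        have h4 : ((q j).2 : ℝ) * c ≤ R * A :=
          mul_le_mul_of_nonneg_left ((le_abs_self _).trans hc) (Nat.cast_nonneg _) |>.trans
            (mul_le_mul_of_nonneg_right r2 hA)
        linarith
      refine mul_le_mul (pow_le_pow_left₀ (abs_nonneg _) h1 _) (Real.exp_le_exp.2 ?_)
        (Real.exp_pos _).le (by positivity)
      rw [mul_comm (2 * A * R)]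
      exact mul_le_mul_of_nonneg_left h2 (Nat.cast_nonneg _))
  rw [prod_exp_grid, Fintype.card_prod, Fintype.card_fin, Fintype.card_fin] at h
  exact h

theorem hasSum_pow_mul_exp (k : ℕ) (s x : ℝ) :
    HasSum (fun n => (if n < k then 0 else s ^ (n - k) / (n - k).factorial) * x ^ n)
      (x ^ k * Real.exp (s * x)) := by
  have h1 : HasSum (fun n => x ^ k * ((s * x) ^ n / n.factorial)) (x ^ k * Real.exp (s * x)) := by
    have := NormedSpace.expSeries_div_hasSum_exp (s * x)
    rw [← Real.exp_eq_exp_ℝ] at this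
    exact this.mul_left _
  rw [← (add_left_injective k).hasSum_iff]
  · convert h1 using 2 with n
    simp [pow_add, mul_pow]; ring
  · intro n hn
    have : n < k := by
      by_contra h
      exact hn ⟨n - k, by simp; omega⟩
    simp [this]

theorem abs_interpDet_main_le {K L R : ℕ} (e₁ e₂ : ℤ) (q : Fin (K + 1) × Fin L → ℕ × ℕ)
    (hq : ∀ j, (q j).1 ≤ R ∧ (q j).2 ≤ R) {a c A ξ σ : ℝ} (ha : |a| ≤ A) (hc : |c| ≤ A)
    (he : 0 < e₁ ^ 2 + e₂ ^ 2) (hξ : R * (|(e₁ : ℝ)| + |(e₂ : ℝ)|) ≤ Real.exp ξ)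
    (hσ : |a * e₁ + c * e₂| ≤ σ)
    (hsmall : ((K + 1) * L : ℕ) * (4 * L * R * σ) ≤ 1) (hsm' : 4 * L * R * σ ≤ 1) :
    |interpDet K L e₁ e₂ q a c| ≤ ((K + 1) * L).factorial *
      Real.exp (((K + 1 : ℕ) * L : ℝ) * ((2 + ξ) * K + (15 * A * R) * (L - 1)) / 2
        - ((K + 1) * L : ℕ) * (((K + 1) * L : ℕ) - 1)) +
      ((K + 1) * L).factorial *
        Real.exp (((K + 1 : ℕ) * L : ℝ) * (ξ * K + 2 * A * R * (L - 1)) / 2) *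
        (2 * (((K + 1) * L : ℕ) * (4 * L * R * σ))) := by
  set E : ℝ := (e₁ : ℝ) ^ 2 + (e₂ : ℝ) ^ 2 with hE
  have hEpos : 0 < E := by rw [hE]; exact_mod_cast he
  have hA : 0 ≤ A := (abs_nonneg _).trans ha
  set N : ℕ := (K + 1) * L with hN
  set κ : ℝ := (e₁ * c - e₂ * a) / E with hκ
  set x : Fin (K + 1) × Fin L → ℝ := fun j => (((q j).2 * e₁ - (q j).1 * e₂ : ℤ) : ℝ) with hx
  set τ : Fin (K + 1) × Fin L → ℝ := fun j =>
    ((q j).1 * e₁ + (q j).2 * e₂) / E * (a * e₁ + c * e₂) with hτ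
  have hdec : ∀ j, ((q j).1 : ℝ) * a + (q j).2 * c = κ * x j + τ j := by
    intro j
    simp only [hκ, hx, hτ]
    field_simp
    push_cast
    rw [hE]; ring
  set X : ℝ := R * (|(e₁ : ℝ)| + |(e₂ : ℝ)|) with hX
  have hX0 : 0 ≤ X := by positivity
  have hR1 : ∀ j, ((q j).1 : ℝ) ≤ R := fun j => by exact_mod_cast (hq j).1
  have hR2 : ∀ j, ((q j).2 : ℝ) ≤ R := fun j => by exact_mod_cast (hq j).2
  have hxX : ∀ j, |x j| ≤ X := by
    intro j
    simp only [hx]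
    push_cast
    refine (abs_sub _ _).trans ?_
    rw [abs_mul, abs_mul, Nat.abs_cast, Nat.abs_cast, hX, mul_add]
    have := hR1 j; have := hR2 j
    gcongr
  have hσ0 : 0 ≤ σ := (abs_nonneg _).trans hσ
  have habs : ∀ e : ℤ, |(e : ℝ)| ≤ (e : ℝ) ^ 2 := by
    intro e
    rw [← sq_abs]
    have : (|e| : ℤ) ≤ |e| ^ 2 := by
      rcases (abs_nonneg e).eq_or_lt with h | h
      · rw [← h]; simp
      · nlinarith
    exact_mod_cast this
  have hτb : ∀ j, |τ j| ≤ R * σ := by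
    intro j
    simp only [hτ]
    rw [abs_mul, abs_div, abs_of_pos hEpos]
    refine mul_le_mul ?_ hσ (abs_nonneg _) (Nat.cast_nonneg _)
    rw [div_le_iff₀ hEpos]
    refine (abs_add_le _ _).trans ?_
    rw [abs_mul, abs_mul, Nat.abs_cast, Nat.abs_cast, hE, mul_add]
    have := hR1 j; have := hR2 j; have := habs e₁; have := habs e₂
    gcongr
  have hκX : |κ| * X ≤ 2 * A * R := by
    rw [hκ, abs_div, abs_of_pos hEpos, div_mul_eq_mul_div, div_le_iff₀ hEpos, hX]
    have h1 : |(e₁ : ℝ) * c - e₂ * a| ≤ A * (|(e₁ : ℝ)| + |(e₂ : ℝ)|) := by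
      refine (abs_sub _ _).trans ?_
      rw [abs_mul, abs_mul]
      nlinarith [abs_nonneg (e₁ : ℝ), abs_nonneg (e₂ : ℝ)]
    have h2 : (|(e₁ : ℝ)| + |(e₂ : ℝ)|) ^ 2 ≤ 2 * E := by
      rw [hE, ← sq_abs (e₁ : ℝ), ← sq_abs (e₂ : ℝ)]
      nlinarith [sq_nonneg (|(e₁ : ℝ)| - |(e₂ : ℝ)|)]
    calc _ ≤ A * (|(e₁ : ℝ)| + |(e₂ : ℝ)|) * (R * (|(e₁ : ℝ)| + |(e₂ : ℝ)|)) := by gcongr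
      _ = A * R * (|(e₁ : ℝ)| + |(e₂ : ℝ)|) ^ 2 := by ring
      _ ≤ A * R * (2 * E) := by gcongr
      _ = _ := by ring
  set f : Fin (K + 1) × Fin L → Fin (K + 1) × Fin L → ℝ := fun i j =>
    x j ^ (i.1 : ℕ) * Real.exp (((i.2 : ℕ) * κ) * x j) with hf
  set u : Fin (K + 1) × Fin L → Fin (K + 1) × Fin L → ℝ := fun i j =>
    Real.exp ((i.2 : ℕ) * τ j) - 1 with hu
  have hL : ∀ i : Fin (K + 1) × Fin L, ((i.2 : ℕ) : ℝ) ≤ L := fun i => by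
    exact_mod_cast i.2.2.le
  have hD : interpDet K L e₁ e₂ q a c = (Matrix.of fun i j => f i j * (1 + u i j)).det := by
    unfold interpDet
    congr 1
    ext i j
    simp only [Matrix.of_apply, hf, hu, hdec]
    rw [add_sub_cancel, mul_assoc, ← Real.exp_add]
    simp only [hx]
    congr 2
    ring
  have hub : ∀ i j, |u i j| ≤ 4 * L * R * σ := by
    intro i j
    have h1 : |((i.2 : ℕ) : ℝ) * τ j| ≤ L * (R * σ) := by
      rw [abs_mul, Nat.abs_cast]
      exact mul_le_mul (hL i) (hτb j) (abs_nonneg _) (Nat.cast_nonneg _)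
    have hnn : 0 ≤ L * (R * σ) := by positivity
    have h2 := Real.abs_exp_sub_one_le (x := (i.2 : ℕ) * τ j) (by linarith)
    simp only [hu]
    linarith
  have hXξ : ∀ k : ℕ, X ^ k ≤ Real.exp (ξ * k) := fun k => by
    rw [mul_comm, Real.exp_nat_mul]
    exact pow_le_pow_left₀ hX0 hξ _
  have hfb : ∀ i j, |f i j| ≤ Real.exp (ξ * (i.1 : ℕ) + 2 * A * R * (i.2 : ℕ)) := by
    intro i j
    simp only [hf]
    rw [abs_mul, abs_pow, Real.abs_exp, Real.exp_add]
    refine mul_le_mul ((pow_le_pow_left₀ (abs_nonneg _) (hxX j) _).trans (hXξ _))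
      (Real.exp_le_exp.2 ?_) (Real.exp_pos _).le (Real.exp_pos _).le
    rw [mul_assoc, mul_comm]
    refine mul_le_mul_of_nonneg_right ?_ (Nat.cast_nonneg _)
    refine (le_abs_self _).trans ?_
    rw [abs_mul]
    exact (mul_le_mul_of_nonneg_left (hxX j) (abs_nonneg _)).trans hκX
  have hpert := abs_det_mul_sub_le f u _ (η := 4 * L * R * σ) (by positivity) hfb hub
    (by rw [Fintype.card_prod, Fintype.card_fin, Fintype.card_fin]; exact hsmall)
  have hcd : Fintype.card (Fin (K + 1) × Fin L) = N := by
    rw [Fintype.card_prod, Fintype.card_fin, Fintype.card_fin]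
  rw [prod_exp_grid, hcd, ← hD] at hpert
  have hmain := abs_det_powerSeries_mul_le (ρ := Real.exp 2)
    (fun (i : Fin (K + 1) × Fin L) n => if n < (i.1 : ℕ) then 0 else
      ((i.2 : ℕ) * κ) ^ (n - (i.1 : ℕ)) / (n - (i.1 : ℕ)).factorial) x hX0
    (Real.one_le_exp (by norm_num)) hxX f
    (fun i => (Real.exp 2 * X) ^ (i.1 : ℕ) * Real.exp (((i.2 : ℕ) * |κ|) * (Real.exp 2 * X)))
    (fun i j => hasSum_pow_mul_exp _ _ _) (fun i => by
      convert hasSum_pow_mul_exp (i.1 : ℕ) ((i.2 : ℕ) * |κ|) (Real.exp 2 * X) using 3 with n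
      split_ifs
      · simp
      · rw [abs_div, abs_pow, abs_mul, Nat.abs_cast, Nat.abs_cast])
  have hprod : ∏ i : Fin (K + 1) × Fin L,
      (Real.exp 2 * X) ^ (i.1 : ℕ) * Real.exp (((i.2 : ℕ) * |κ|) * (Real.exp 2 * X)) ≤
      Real.exp (((K + 1 : ℕ) * L : ℝ) * ((2 + ξ) * K + (15 * A * R) * (L - 1)) / 2) := by
    rw [← prod_exp_grid]
    refine Finset.prod_le_prod (fun i _ => by positivity) fun i _ => ?_
    rw [Real.exp_add]
    refine mul_le_mul ?_ (Real.exp_le_exp.2 ?_) (Real.exp_pos _).le (Real.exp_pos _).le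
    · rw [mul_comm (2 + ξ), Real.exp_nat_mul, Real.exp_add]
      gcongr
    · have he2 : Real.exp 2 ≤ 7.5 := by
        have h1 := Real.exp_one_lt_d9
        have : Real.exp 2 = Real.exp 1 ^ 2 := by rw [← Real.exp_nat_mul]; norm_num
        rw [this]; nlinarith [Real.exp_pos 1]
      calc ((i.2 : ℕ) * |κ|) * (Real.exp 2 * X) = Real.exp 2 * (|κ| * X) * (i.2 : ℕ) := by ring
        _ ≤ 7.5 * (2 * A * R) * (i.2 : ℕ) := by gcongr
        _ = _ := by ring
  rw [hcd] at hmain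
  have hpow : Real.exp 2 ^ (N * (N - 1) / 2) = Real.exp (N * (N - 1)) := by
    rw [← Real.exp_nat_mul]
    congr 1
    have h2 : 2 ∣ N * (N - 1) := (Nat.even_mul_pred_self N).two_dvd
    rw [Nat.cast_div h2 (by norm_num)]
    rcases N with _ | n
    · simp
    · push_cast [Nat.succ_sub_one]; ring
  rw [hpow] at hmain
  have hm2 : |(Matrix.of f).det| ≤ (N.factorial : ℝ) * Real.exp (((K + 1 : ℕ) * L : ℝ) *
      ((2 + ξ) * K + (15 * A * R) * (L - 1)) / 2 - N * (N - 1)) := by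
    rw [Real.exp_sub, ← mul_div_assoc, le_div_iff₀ (Real.exp_pos _)]
    exact hmain.trans (by gcongr)
  have := abs_sub_abs_le_abs_sub (interpDet K L e₁ e₂ q a c) (Matrix.of f).det
  linarith

theorem factorial_le_exp_of_le_exp {n : ℕ} {y : ℝ} (h : (n : ℝ) ≤ Real.exp y) :
    (n.factorial : ℝ) ≤ Real.exp (n * y) := by
  rw [Real.exp_nat_mul]
  calc (n.factorial : ℝ) ≤ (n : ℝ) ^ n := by exact_mod_cast Nat.factorial_le_pow n
    _ ≤ _ := by gcongr

theorem grid_injective_of_isCoprime {R : ℕ} {e₁ e₂ : ℤ} (hcop : IsCoprime e₁ e₂)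
    (hbig : (R : ℤ) ≤ |e₁| ∨ (R : ℤ) ≤ |e₂|) :
    ∀ r < R, ∀ t < R, ∀ r' < R, ∀ t' < R,
      (t : ℤ) * e₁ - r * e₂ = t' * e₁ - r' * e₂ → r = r' ∧ t = t' := by
  intro r hr t ht r' hr' t' ht' h
  have h1 : ((t : ℤ) - t') * e₁ = (r - r') * e₂ := by linear_combination h
  have d1 : e₂ ∣ (t : ℤ) - t' :=
    hcop.symm.dvd_of_dvd_mul_right ⟨(r : ℤ) - r', by rw [h1]; ring⟩
  have d2 : e₁ ∣ (r : ℤ) - r' :=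
    hcop.dvd_of_dvd_mul_right ⟨(t : ℤ) - t', by rw [← h1]; ring⟩
  rcases hbig with hb | hb
  · have h2 : (r : ℤ) - r' = 0 := Int.eq_zero_of_abs_lt_dvd ((abs_dvd _ _).2 d2)
      (lt_of_lt_of_le (abs_lt.2 ⟨by omega, by omega⟩ : |(r : ℤ) - r'| < R) hb)
    have he : e₁ ≠ 0 := by rintro rfl; simp at hb; omega
    rw [h2, zero_mul, mul_eq_zero, or_iff_left he] at h1
    omega
  · have h2 : (t : ℤ) - t' = 0 := Int.eq_zero_of_abs_lt_dvd ((abs_dvd _ _).2 d1)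
      (lt_of_lt_of_le (abs_lt.2 ⟨by omega, by omega⟩ : |(t : ℤ) - t'| < R) hb)
    have he : e₂ ≠ 0 := by rintro rfl; simp at hb; omega
    rw [h2, zero_mul, eq_comm, mul_eq_zero, or_iff_left he] at h1
    omega

set_option maxHeartbeats 1000000 in
theorem exists_interpDet_ne_zero_and_prod_lt_one {L : ℕ} (hL : 200 ≤ L) {e₁ e₂ : ℤ}
    (hcop : IsCoprime e₁ e₂) (hbig : ((225 * L : ℕ) : ℤ) ≤ |e₁| ∨ ((225 * L : ℕ) : ℤ) ≤ |e₂|)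
    {a c : ℝ} (hc0 : c ≠ 0) (ha : |a| ≤ 10.4) (hc : |c| ≤ 10.4)
    (hξ : (225 * L : ℕ) * (|(e₁ : ℝ)| + |(e₂ : ℝ)|) ≤ Real.exp (L / 4))
    (hσ : |a * e₁ + c * e₂| ≤ Real.exp (-(1760000000 * (L : ℝ) ^ 4))) :
    ∃ (K : ℕ) (q : Fin (K + 1) × Fin L → ℕ × ℕ),
      interpDet K L e₁ e₂ q a c ≠ 0 ∧
      |interpDet K L e₁ e₂ q a c| * |interpDet K L e₁ e₂ q c (-a)| *
        |interpDet K L e₁ e₂ q (-a) (-c)| * |interpDet K L e₁ e₂ q (-c) a| < 1 := by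
  obtain ⟨K, hK⟩ : ∃ K, K + 1 = 50400 * L := ⟨50400 * L - 1, by omega⟩
  obtain ⟨q, hq, hD⟩ := exists_interpDet_ne_zero (K := K) (L := L) (R := 225 * L) (T := 225 * L)
    e₁ e₂ (a := a) hc0 (by omega) (by
      have : 225 * L - L = 224 * L := by omega
      rw [this]; nlinarith) (grid_injective_of_isCoprime hcop hbig)
  refine ⟨K, q, hD, ?_⟩
  have hq' : ∀ j, (q j).1 ≤ 225 * L ∧ (q j).2 ≤ 225 * L := fun j => ⟨(hq j).1.le, (hq j).2.le⟩
  have ha' : |(-a)| ≤ 10.4 := by rwa [abs_neg]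
  have hc' : |(-c)| ≤ 10.4 := by rwa [abs_neg]
  have hLr : (200 : ℝ) ≤ L := by exact_mod_cast hL
  set x : ℝ := (L : ℝ) with hx
  have hx0 : 0 < x := by linarith
  set N : ℕ := (K + 1) * L with hN
  have hNx : (N : ℝ) = 50400 * x ^ 2 := by rw [hN, hK]; push_cast; ring
  have hKx : (K : ℝ) = 50400 * x - 1 := by
    have : ((K + 1 : ℕ) : ℝ) = 50400 * x := by rw [hK]; push_cast; ring
    push_cast at this; linarith
  have hNexp : (N : ℝ) ≤ Real.exp x := by
    have h5 := Real.pow_div_factorial_le_exp x hx0.le 5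
    refine le_trans ?_ h5
    rw [hNx, le_div_iff₀ (by norm_num [Nat.factorial])]
    have h3 : (200:ℝ) ^ 3 ≤ x ^ 3 := by gcongr
    norm_num [Nat.factorial]
    nlinarith [sq_nonneg x, pow_pos hx0 2]
  have hfac := factorial_le_exp_of_le_exp hNexp
  have he : 0 < e₁ ^ 2 + e₂ ^ 2 := by
    have : e₁ ≠ 0 ∨ e₂ ≠ 0 := by
      rcases hbig with h | h
      · left; rintro rfl; simp at h; omega
      · right; rintro rfl; simp at h; omega
    rcases this with h | h
    · have := sq_nonneg e₂; positivity
    · have := sq_nonneg e₁; positivity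
  set σ := Real.exp (-(1760000000 * x ^ 4)) with hσd
  have hσ0 : 0 < σ := Real.exp_pos _
  have hP : (N : ℝ) * (4 * L * (225 * L : ℕ) * σ) ≤ Real.exp (2 * x - 1760000000 * x ^ 4) := by
    have h1 : (4 * L * (225 * L : ℕ) : ℝ) ≤ Real.exp x := by
      refine le_trans ?_ hNexp
      rw [hNx]; push_cast; linarith [sq_nonneg x]
    have : (2 * x - 1760000000 * x ^ 4) = x + (x + -(1760000000 * x ^ 4)) := by ring
    rw [this, Real.exp_add, Real.exp_add]
    gcongr
  have hx4 : x ^ 3 * 200 ≤ x ^ 4 := by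
    have : x ^ 4 = x ^ 3 * x := by ring
    rw [this]; gcongr
  have hx3 : x ^ 2 * 200 ≤ x ^ 3 := by
    have : x ^ 3 = x ^ 2 * x := by ring
    rw [this]; gcongr
  have hx2 : x * 200 ≤ x ^ 2 := by nlinarith
  have hP1 : (N : ℝ) * (4 * L * (225 * L : ℕ) * σ) ≤ 1 := by
    refine hP.trans (Real.exp_le_one_iff.2 ?_)
    linarith
  have hN1 : (1 : ℝ) ≤ N := by rw [hNx]; linarith
  have hP2 : (4 * L * (225 * L : ℕ) * σ : ℝ) ≤ 1 := by
    refine le_trans ?_ hP1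
    exact le_mul_of_one_le_left (by positivity) hN1
  have m := abs_interpDet_main_le (K := K) e₁ e₂ q hq' ha hc he hξ hσ hP1 hP2
  have t1 := abs_interpDet_le (K := K) e₁ e₂ q hq' hc ha' hξ
  have t2 := abs_interpDet_le (K := K) e₁ e₂ q hq' ha' hc' hξ
  have t3 := abs_interpDet_le (K := K) e₁ e₂ q hq' hc' ha hξ
  rw [← hN] at m t1 t2 t3
  set X : ℝ := ((K + 1 : ℕ) * L : ℝ) * (x / 4 * K + 2 * 10.4 * (225 * L : ℕ) * (L - 1)) / 2 with hX
  have hXle : X ≤ 25200 * x ^ 2 * (17280 * x ^ 2) := by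
    rw [hX, hK, hKx]; push_cast
    linarith [pow_pos hx0 3]
  have hT : (N.factorial : ℝ) * Real.exp X ≤ Real.exp (N * x + X) := by
    rw [Real.exp_add]; gcongr
  have hmain : |interpDet K L e₁ e₂ q a c| ≤
      Real.exp (N * x + (((K + 1 : ℕ) * L : ℝ)
          * ((2 + x / 4) * K + (15 * 10.4 * (225 * L : ℕ)) * (L - 1)) / 2
        - (N : ℕ) * ((N : ℕ) - 1))) + Real.exp
        (N * x + X + (1 + (2 * x - 1760000000 * x ^ 4))) := by
    refine m.trans (add_le_add ?_ ?_)
    · rw [Real.exp_add]; gcongr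
    · rw [Real.exp_add (N * x + X), Real.exp_add 1]
      have h2 : (2 : ℝ) ≤ Real.exp 1 := by linarith [Real.exp_one_gt_d9]
      gcongr
  have hprod : |interpDet K L e₁ e₂ q a c| * |interpDet K L e₁ e₂ q c (-a)| *
        |interpDet K L e₁ e₂ q (-a) (-c)| * |interpDet K L e₁ e₂ q (-c) a| ≤
      (Real.exp (N * x + (((K + 1 : ℕ) * L : ℝ)
          * ((2 + x / 4) * K + (15 * 10.4 * (225 * L : ℕ)) * (L - 1)) / 2
        - (N : ℕ) * ((N : ℕ) - 1))) + Real.exp (N * x + X + (1 + (2 * x - 1760000000 * x ^ 4)))) *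
        Real.exp (N * x + X) * Real.exp (N * x + X) * Real.exp (N * x + X) := by
    have t1' := t1.trans hT
    have t2' := t2.trans hT
    have t3' := t3.trans hT
    exact mul_le_mul (mul_le_mul (mul_le_mul hmain t1' (abs_nonneg _) (by positivity)) t2'
      (abs_nonneg _) (by positivity)) t3' (abs_nonneg _) (by positivity)
  refine lt_of_le_of_lt hprod ?_
  rw [add_mul, add_mul, add_mul, ← Real.exp_add, ← Real.exp_add, ← Real.exp_add, ← Real.exp_add,
    ← Real.exp_add, ← Real.exp_add]
  have hhalf : Real.exp (-1) < 1 / 2 := by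
    have := Real.exp_neg_one_lt_d9; linarith
  have e1 : N * x + (((K + 1 : ℕ) * L : ℝ)
      * ((2 + x / 4) * K + (15 * 10.4 * (225 * L : ℕ)) * (L - 1)) / 2
        - (N : ℕ) * ((N : ℕ) - 1)) + (N * x + X) + (N * x + X) + (N * x + X) ≤ -1 := by
    have hY : 4 * x + ((2 + x / 4) * (50400 * x - 1) + (15 * 10.4 * (225 * x)) * (x - 1)) / 2
        - (50400 * x ^ 2 - 1) + 3 * ((x / 4 * (50400 * x - 1) + 2 * 10.4 * (225 * x) * (x - 1))
        / 2) ≤ -1 := by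
      linarith
    have : N * x + (((K + 1 : ℕ) * L : ℝ)
        * ((2 + x / 4) * K + (15 * 10.4 * (225 * L : ℕ)) * (L - 1)) / 2
        - (N : ℕ) * ((N : ℕ) - 1)) + (N * x + X) + (N * x + X) + (N * x + X) =
        50400 * x ^ 2 * (4 * x + ((2 + x / 4) * (50400 * x - 1)
            + (15 * 10.4 * (225 * x)) * (x - 1)) / 2
        - (50400 * x ^ 2 - 1) + 3 * ((x / 4 * (50400 * x - 1) + 2 * 10.4 * (225 * x) * (x - 1))
        / 2)) := by
      rw [hX, hK, hKx, hNx]; push_cast; ring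
    rw [this]
    have h1 : (1:ℝ) ≤ 50400 * x ^ 2 := by linarith
    linarith [mul_le_mul_of_nonneg_left hY (zero_le_one.trans h1)]
  have e2 : N * x + X + (1 + (2 * x - 1760000000 * x ^ 4)) + (N * x + X) + (N * x + X)
      + (N * x + X) ≤ -1 := by
    rw [hNx]
    linarith
  have := Real.exp_le_exp.2 e1
  have := Real.exp_le_exp.2 e2
  linarith

/-- The conjugates of the unit `b + √(b² + 1)`, each repeated twice. -/
noncomputable def quarticEps (b : ℕ) : Fin 4 → ℝ :=
  ![b + √(b ^ 2 + 1), b - √(b ^ 2 + 1), b + √(b ^ 2 + 1), b - √(b ^ 2 + 1)]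

/-- The conjugates of `√(ε² + 1)`, where `ε = b + √(b² + 1)`. -/
noncomputable def quarticOm (b : ℕ) : Fin 4 → ℝ :=
  ![√((b + √(b ^ 2 + 1)) ^ 2 + 1), √((b + √(b ^ 2 + 1)) ^ 2 + 1) * (√(b ^ 2 + 1) - b),
    -√((b + √(b ^ 2 + 1)) ^ 2 + 1), -(√((b + √(b ^ 2 + 1)) ^ 2 + 1) * (√(b ^ 2 + 1) - b))]

theorem sqrt_sq_add_one_sq (b : ℕ) : √((b : ℝ) ^ 2 + 1) ^ 2 = b ^ 2 + 1 :=
  Real.sq_sqrt (by positivity)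

theorem quarticEps_sq (b : ℕ) (j : Fin 4) :
    quarticEps b j ^ 2 = 2 * b * quarticEps b j + 1 := by
  have h := sqrt_sq_add_one_sq b
  fin_cases j <;> simp [quarticEps] <;> linear_combination h

theorem quarticOm_sq (b : ℕ) (j : Fin 4) :
    quarticOm b j ^ 2 = 2 * b * quarticEps b j + 2 := by
  have h := sqrt_sq_add_one_sq b
  have h2 : √(((b : ℝ) + √(b ^ 2 + 1)) ^ 2 + 1) ^ 2 = (b + √(b ^ 2 + 1)) ^ 2 + 1 :=
    Real.sq_sqrt (by positivity)
  set s := √((b : ℝ) ^ 2 + 1)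
  set t := √(((b : ℝ) + s) ^ 2 + 1)
  fin_cases j <;> simp [quarticEps, quarticOm] <;>
  first
  | linear_combination h2 + h
  | linear_combination (s - b) ^ 2 * h2 + (s ^ 2 - b ^ 2 + 2) * h

theorem quarticEps_add_one (b : ℕ) (j : Fin 4) :
    quarticEps b (j + 1) = 2 * b - quarticEps b j := by
  fin_cases j <;> simp [quarticEps] <;> ring

theorem quarticOm_add_one (b : ℕ) (j : Fin 4) :
    quarticOm b (j + 1) = quarticOm b j * (quarticEps b j - 2 * b) := by
  have h := sqrt_sq_add_one_sq b
  set s := √((b : ℝ) ^ 2 + 1) with hs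
  fin_cases j <;> simp [quarticEps, quarticOm, ← hs]
  · left; ring
  · linear_combination √(((b : ℝ) + s) ^ 2 + 1) * h
  · left; ring
  · linear_combination -√(((b : ℝ) + s) ^ 2 + 1) * h

/-- The ring `ℤ[ε, √(ε² + 1)]`, embedded in `ℝ⁴` by its four real places. -/
noncomputable def quarticRing (b : ℕ) : Subring (Fin 4 → ℝ) where
  carrier := {x | ∃ p q r s : ℤ, ∀ j, x j = p + q * quarticEps b j + r * quarticOm b j +
    s * (quarticEps b j * quarticOm b j)}
  mul_mem' := by
    rintro x y ⟨p, q, r, s, hx⟩ ⟨p', q', r', s', hy⟩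
    refine ⟨p * p' + q * q' + 2 * (r * r') + 2 * b * (r * s' + s * r') + s * s' * (4 * b ^ 2 + 2),
      p * q' + q * p' + 2 * b * (q * q') + 2 * b * (r * r') + (4 * b ^ 2 + 2) * (r * s' + s * r') +
        s * s' * (8 * b ^ 3 + 6 * b),
      p * r' + r * p' + q * s' + s * q',
      p * s' + s * p' + q * r' + r * q' + 2 * b * (q * s' + s * q'), fun j => ?_⟩
    have h1 := quarticEps_sq b j
    have h2 := quarticOm_sq b j
    rw [Pi.mul_apply, hx, hy]
    set e := quarticEps b j
    set o := quarticOm b j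
    push_cast
    linear_combination (q * q' + (q * s' + s * q') * o + 2 * b * (r * s' + s * r') +
      s * s' * (2 * b * e + 4 * b ^ 2 + 2)) * h1 +
      (r * r' + (r * s' + s * r') * e + s * s' * e ^ 2) * h2
  one_mem' := ⟨1, 0, 0, 0, fun j => by simp⟩
  add_mem' := by
    rintro x y ⟨p, q, r, s, hx⟩ ⟨p', q', r', s', hy⟩
    refine ⟨p + p', q + q', r + r', s + s', fun j => ?_⟩
    rw [Pi.add_apply, hx, hy]; push_cast; ring
  zero_mem' := ⟨0, 0, 0, 0, fun j => by simp⟩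
  neg_mem' := by
    rintro x ⟨p, q, r, s, hx⟩
    refine ⟨-p, -q, -r, -s, fun j => ?_⟩
    rw [Pi.neg_apply, hx]; push_cast; ring

theorem quarticEps_mem (b : ℕ) : quarticEps b ∈ quarticRing b :=
  ⟨0, 1, 0, 0, fun j => by simp⟩

theorem quarticOm_mem (b : ℕ) : quarticOm b ∈ quarticRing b :=
  ⟨0, 0, 1, 0, fun j => by simp⟩

theorem shift_mem_quarticRing {b : ℕ} {x : Fin 4 → ℝ} (hx : x ∈ quarticRing b) :
    (fun j => x (j + 1)) ∈ quarticRing b := by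
  obtain ⟨p, q, r, s, hx⟩ := hx
  refine ⟨p + 2 * b * q, -q, -2 * b * r - s * (4 * b ^ 2 + 1), r + 2 * b * s, fun j => ?_⟩
  have h1 := quarticEps_sq b j
  beta_reduce
  rw [hx, quarticEps_add_one, quarticOm_add_one]
  push_cast
  linear_combination -s * quarticOm b j * h1

theorem prod_quarticRing_aux (b : ℕ) {x : Fin 4 → ℝ} {p q r s : ℤ}
    (hx : ∀ j, x j = p + q * quarticEps b j + r * quarticOm b j +
      s * (quarticEps b j * quarticOm b j)) :
    ∃ A B : ℤ, (∀ j, x j * x (j + 2) = A + B * quarticEps b j) ∧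
      x 0 * x 1 * x 2 * x 3 = ((A + b * B) ^ 2 - (b ^ 2 + 1) * B ^ 2 : ℤ) ∧
      A = p ^ 2 + q ^ 2 - 2 * r ^ 2 - 4 * b * (r * s) - s ^ 2 * (4 * b ^ 2 + 2) ∧
      B = 2 * p * q + 2 * b * q ^ 2 - 2 * b * r ^ 2 - 2 * r * s * (4 * b ^ 2 + 2) -
        s ^ 2 * (8 * b ^ 3 + 6 * b) := by
  have key : ∀ j, x j * x (j + 2) =
      ((p ^ 2 + q ^ 2 - 2 * r ^ 2 - 4 * b * (r * s) - s ^ 2 * (4 * b ^ 2 + 2) : ℤ) : ℝ) +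
      ((2 * p * q + 2 * b * q ^ 2 - 2 * b * r ^ 2 - 2 * r * s * (4 * b ^ 2 + 2) -
        s ^ 2 * (8 * b ^ 3 + 6 * b) : ℤ) : ℝ) * quarticEps b j := by
    intro j
    have hj : j + 2 = j + 1 + 1 := by rw [add_assoc]; rfl
    have h1 := quarticEps_sq b j
    have h2 := quarticOm_sq b j
    have e1 : quarticEps b (j + 2) = quarticEps b j := by
      rw [hj, quarticEps_add_one, quarticEps_add_one]; ring
    have e2 : quarticOm b (j + 2) = -quarticOm b j := by
      rw [hj, quarticOm_add_one, quarticOm_add_one, quarticEps_add_one]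
      linear_combination -quarticOm b j * h1
    rw [hx, hx (j + 2), e1, e2]
    push_cast
    linear_combination (q ^ 2 - 4 * b * (r * s)
        - s ^ 2 * (2 * b * quarticEps b j + 4 * b ^ 2 + 2)) * h1 -
      (r + s * quarticEps b j) ^ 2 * h2
  refine ⟨_, _, key, ?_, rfl, rfl⟩
  have k0 := key 0
  have k1 := key 1
  simp only [zero_add, show (1 + 2 : Fin 4) = 3 from rfl] at k0 k1
  have e1 : quarticEps b 1 = 2 * b - quarticEps b 0 := by simpa using quarticEps_add_one b 0
  have h1 := quarticEps_sq b 0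
  calc x 0 * x 1 * x 2 * x 3 = (x 0 * x 2) * (x 1 * x 3) := by ring
    _ = _ := by
      rw [k0, k1, e1]
      push_cast
      generalize ((p : ℝ) ^ 2 + q ^ 2 - 2 * r ^ 2 - 4 * b * (r * s) - s ^ 2 * (4 * b ^ 2 + 2)) = A
      generalize ((2 : ℝ) * p * q + 2 * b * q ^ 2 - 2 * b * r ^ 2 - 2 * r * s * (4 * b ^ 2 + 2) -
        s ^ 2 * (8 * b ^ 3 + 6 * b)) = B
      linear_combination -B ^ 2 * h1

theorem exists_int_prod_eq {b : ℕ} {x : Fin 4 → ℝ} (hx : x ∈ quarticRing b) :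
    ∃ n : ℤ, x 0 * x 1 * x 2 * x 3 = n := by
  obtain ⟨p, q, r, s, hx⟩ := hx
  obtain ⟨A, B, -, h, -⟩ := prod_quarticRing_aux b hx
  exact ⟨_, h⟩

theorem exists_int_sum_eq {b : ℕ} {x : Fin 4 → ℝ} (hx : x ∈ quarticRing b) :
    ∃ n : ℤ, x 0 + x 1 + x 2 + x 3 = n := by
  obtain ⟨p, q, r, s, hx⟩ := hx
  have hs := sqrt_sq_add_one_sq b
  refine ⟨4 * p + 4 * b * q, ?_⟩
  simp only [hx, quarticEps, quarticOm, Matrix.cons_val]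
  push_cast
  ring

theorem sq_ne_mul_sq_of_not_isSquare {d : ℤ} (hd : ¬ IsSquare d) {m n : ℤ}
    (h : m ^ 2 = d * n ^ 2) : m = 0 ∧ n = 0 := by
  have hn : n = 0 := by
    by_contra hn
    have hdvd : n ∣ m := (Int.pow_dvd_pow_iff two_ne_zero).1 ⟨d, by rw [h]; ring⟩
    obtain ⟨k, rfl⟩ := hdvd
    refine hd ⟨k, ?_⟩
    have : n ^ 2 ≠ 0 := pow_ne_zero 2 hn
    apply mul_right_cancel₀ this
    linear_combination -h
  subst hn
  exact ⟨by simpa using h, rfl⟩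

theorem not_isSquare_sq_add_one {b : ℕ} (hb : 1 ≤ b) : ¬ IsSquare ((b : ℤ) ^ 2 + 1) := by
  rintro ⟨k, hk⟩
  have h1 : (b : ℤ) < |k| := lt_of_pow_lt_pow_left₀ 2 (abs_nonneg _) (by rw [sq_abs]; nlinarith)
  have h2 : ((b : ℤ) + 1) ^ 2 ≤ |k| ^ 2 := pow_le_pow_left₀ (by positivity) h1 2
  rw [sq_abs] at h2
  have : (1 : ℤ) ≤ b := by exact_mod_cast hb
  nlinarith

theorem eq_zero_of_apply_zero_eq_zero {b : ℕ} (hb : 1 ≤ b) {x : Fin 4 → ℝ}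
    (hx : x ∈ quarticRing b) (h0 : x 0 = 0) : x = 0 := by
  have hd := not_isSquare_sq_add_one hb
  obtain ⟨p, q, r, s, hx⟩ := hx
  obtain ⟨A, B, hAB, hN, hA, hB⟩ := prod_quarticRing_aux b hx
  rw [h0, zero_mul, zero_mul, zero_mul] at hN
  have hN' : (A + b * B) ^ 2 = ((b : ℤ) ^ 2 + 1) * B ^ 2 := by
    have : (A + b * B) ^ 2 - ((b : ℤ) ^ 2 + 1) * B ^ 2 = 0 := by exact_mod_cast hN.symm
    linarith
  obtain ⟨h1, rfl⟩ := sq_ne_mul_sq_of_not_isSquare hd hN'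
  have hA0 : A = 0 := by linarith
  -- `P ^ 2 = Q ^ 2 * (2 * b * ε + 2)` in `ℤ[ε]`; take norms
  set P : ℤ := (p + b * q) ^ 2 - (b ^ 2 + 1) * q ^ 2 with hP
  set Q : ℤ := (r + b * s) ^ 2 - (b ^ 2 + 1) * s ^ 2 with hQ
  have hPQ : P ^ 2 = ((b : ℤ) ^ 2 + 1) * (2 * Q) ^ 2 := by
    have e1 : p ^ 2 + q ^ 2 = 2 * r ^ 2 + 4 * b * (r * s) + s ^ 2 * (4 * b ^ 2 + 2) := by
      linarith
    have e2 : 2 * p * q + 2 * b * q ^ 2 = 2 * b * r ^ 2 + 2 * r * s * (4 * b ^ 2 + 2) +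
        s ^ 2 * (8 * b ^ 3 + 6 * b) := by linarith
    have e3 : P ^ 2 = (p ^ 2 + q ^ 2) ^ 2 + 2 * b * (p ^ 2 + q ^ 2) * (2 * p * q + 2 * b * q ^ 2) -
        (2 * p * q + 2 * b * q ^ 2) ^ 2 := by rw [hP]; ring
    rw [e3, e1, e2, hQ]; ring
  obtain ⟨hP0, hQ0⟩ := sq_ne_mul_sq_of_not_isSquare hd hPQ
  have hp := sq_ne_mul_sq_of_not_isSquare hd (m := p + b * q) (n := q) (by linarith)
  have hr := sq_ne_mul_sq_of_not_isSquare hd (m := r + b * s) (n := s) (by linarith)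
  obtain ⟨hp1, rfl⟩ := hp
  obtain ⟨hr1, rfl⟩ := hr
  have hp2 : p = 0 := by linarith
  have hr2 : r = 0 := by linarith
  subst hp2 hr2
  funext j
  rw [hx]; simp

theorem apply_ne_zero {b : ℕ} (hb : 1 ≤ b) {x : Fin 4 → ℝ}
    (hx : x ∈ quarticRing b) (h0 : x ≠ 0) (j : Fin 4) : x j ≠ 0 := by
  have key : ∀ (y : Fin 4 → ℝ), y ∈ quarticRing b → y 1 = 0 → y = 0 := by
    intro y hy h1
    have h2 := eq_zero_of_apply_zero_eq_zero hb (shift_mem_quarticRing hy) (by simpa using h1)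
    funext i
    have := congrFun h2 (i - 1)
    simpa using this
  intro hj
  have h1 := shift_mem_quarticRing hx
  have h2 := shift_mem_quarticRing h1
  have h3 := shift_mem_quarticRing h2
  fin_cases j
  · exact h0 (eq_zero_of_apply_zero_eq_zero hb hx hj)
  · exact h0 (key x hx hj)
  · have := key _ h1 hj
    exact h0 (by funext i; simpa using congrFun this (i - 1))
  · have := key _ h2 hj
    exact h0 (by funext i; have := congrFun this (i - 1 - 1); simpa using this)

theorem one_le_abs_prod {b : ℕ} (hb : 1 ≤ b) {x : Fin 4 → ℝ}
    (hx : x ∈ quarticRing b) (h0 : x ≠ 0) : 1 ≤ |x 0 * x 1 * x 2 * x 3| := by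
  obtain ⟨n, hn⟩ := exists_int_prod_eq hx
  have hne := apply_ne_zero hb hx h0
  have : x 0 * x 1 * x 2 * x 3 ≠ 0 :=
    mul_ne_zero (mul_ne_zero (mul_ne_zero (hne 0) (hne 1)) (hne 2)) (hne 3)
  rw [hn] at this ⊢
  rw [← Int.cast_abs]
  have h3 : n ≠ 0 := by exact_mod_cast this
  exact_mod_cast Int.one_le_abs h3

theorem cosh_add_cosh_lt {a c A C : ℝ} (h : a ^ 2 + c ^ 2 ≤ (A ^ 2 + C ^ 2) / 2)
    (h0 : 0 < A ^ 2 + C ^ 2) : Real.cosh a + Real.cosh c < Real.cosh A + Real.cosh C := by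
  have key : ∀ n : ℕ, a ^ (2 * n) + c ^ (2 * n) ≤ A ^ (2 * n) + C ^ (2 * n) := by
    intro n
    rcases Nat.eq_zero_or_pos n with rfl | hn
    · simp
    simp only [pow_mul]
    obtain ⟨k, rfl⟩ : ∃ k, n = k + 1 := ⟨n - 1, by omega⟩
    calc (a ^ 2) ^ (k + 1) + (c ^ 2) ^ (k + 1) ≤ (a ^ 2 + c ^ 2) ^ (k + 1) :=
          pow_add_pow_le (sq_nonneg a) (sq_nonneg c) k.succ_ne_zero
      _ ≤ ((A ^ 2 + C ^ 2) / 2) ^ (k + 1) := by gcongr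
      _ ≤ (A ^ 2) ^ (k + 1) + (C ^ 2) ^ (k + 1) := by
        rw [div_pow, div_le_iff₀ (by positivity)]
        have := add_pow_le (sq_nonneg A) (sq_nonneg C) (k + 1)
        refine this.trans ?_
        simp only [Nat.add_sub_cancel]
        have h3 : (2 : ℝ) ^ k ≤ 2 ^ (k + 1) := by gcongr <;> norm_num
        rw [mul_comm]
        gcongr
  have s1 := (Real.hasSum_cosh a).add (Real.hasSum_cosh c)
  have s2 := (Real.hasSum_cosh A).add (Real.hasSum_cosh C)
  refine hasSum_lt (i := 1) (fun n => ?_) ?_ s1 s2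
  · rw [← add_div, ← add_div]
    exact div_le_div_of_nonneg_right (key n) (by positivity)
  · rw [← add_div, ← add_div]
    refine div_lt_div_of_pos_right ?_ (by positivity)
    norm_num
    linarith

def IsQuarticUnit (b : ℕ) (x : Fin 4 → ℝ) : Prop :=
  x ∈ quarticRing b ∧ ((∀ j, x j * x (j + 2) = 1) ∨ ∀ j, x j * x (j + 2) = -1)

namespace IsQuarticUnit

variable {b : ℕ} {x y : Fin 4 → ℝ}

theorem one (b : ℕ) : IsQuarticUnit b 1 := ⟨one_mem _, Or.inl fun j => by simp⟩

theorem mul (hx : IsQuarticUnit b x) (hy : IsQuarticUnit b y) : IsQuarticUnit b (x * y) := by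
  refine ⟨mul_mem hx.1 hy.1, ?_⟩
  have h : ∀ j, (x * y) j * (x * y) (j + 2) = (x j * x (j + 2)) * (y j * y (j + 2)) := fun j => by
    simp only [Pi.mul_apply]; ring
  rcases hx.2 with h1 | h1 <;> rcases hy.2 with h2 | h2 <;> [left; right; right; left] <;>
    intro j <;> rw [h, h1, h2] <;> norm_num

theorem shift (hx : IsQuarticUnit b x) : IsQuarticUnit b fun j => x (j + 1) :=
  ⟨shift_mem_quarticRing hx.1, hx.2.imp
    (fun h j => by beta_reduce; rw [add_right_comm]; exact h (j + 1))
    (fun h j => by beta_reduce; rw [add_right_comm]; exact h (j + 1))⟩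

theorem apply_ne_zero (hx : IsQuarticUnit b x) (j : Fin 4) : x j ≠ 0 := by
  intro h
  rcases hx.2 with h1 | h1 <;> have := h1 j <;> simp [h] at this

theorem inv (hx : IsQuarticUnit b x) : IsQuarticUnit b x⁻¹ := by
  have h2 : (fun j => x (j + 2)) ∈ quarticRing b := by
    have := shift_mem_quarticRing (shift_mem_quarticRing hx.1)
    simpa only [add_assoc, show (1 + 1 : Fin 4) = 2 from rfl] using this
  have h0 := hx.apply_ne_zero
  rcases hx.2 with h | h
  · refine ⟨?_, Or.inl fun j => ?_⟩
    · have : x⁻¹ = fun j => x (j + 2) := by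
        funext j
        rw [Pi.inv_apply, inv_eq_of_mul_eq_one_right (h j)]
      rwa [this]
    · rw [Pi.inv_apply, Pi.inv_apply, ← mul_inv, h j, inv_one]
  · refine ⟨?_, Or.inr fun j => ?_⟩
    · have : x⁻¹ = -fun j => x (j + 2) := by
        funext j
        rw [Pi.inv_apply, Pi.neg_apply]
        exact inv_eq_of_mul_eq_one_right (by rw [mul_neg, h j, neg_neg])
      rw [this]
      exact neg_mem h2
    · rw [Pi.inv_apply, Pi.inv_apply, ← mul_inv, h j, inv_neg, inv_one]

theorem pow (hx : IsQuarticUnit b x) (n : ℕ) : IsQuarticUnit b (x ^ n) := by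
  induction n with
  | zero => simpa using one b
  | succ n ih => rw [pow_succ]; exact ih.mul hx

theorem zpow (hx : IsQuarticUnit b x) (n : ℤ) : IsQuarticUnit b (x ^ n) := by
  cases n with
  | ofNat n => simpa using hx.pow n
  | negSucc n => rw [zpow_negSucc]; exact (hx.pow _).inv

theorem log_add_two (hx : IsQuarticUnit b x) (j : Fin 4) :
    Real.log (x (j + 2)) = -Real.log (x j) := by
  have h0 := hx.apply_ne_zero
  have : Real.log (x j * x (j + 2)) = 0 := by
    rcases hx.2 with h | h <;> rw [h j] <;> simp
  rw [Real.log_mul (h0 _) (h0 _)] at this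
  linarith

theorem sq_eq (hx : IsQuarticUnit b x) (j : Fin 4) : x j ^ 2 = Real.exp (2 * Real.log (x j)) := by
  rw [mul_comm, Real.exp_mul, ← Real.log_abs, Real.exp_log (abs_pos.2 (hx.apply_ne_zero j))]
  norm_num

theorem sum_sq (hx : IsQuarticUnit b x) : x 0 ^ 2 + x 1 ^ 2 + x 2 ^ 2 + x 3 ^ 2 =
    2 * (Real.cosh (2 * Real.log (x 0)) + Real.cosh (2 * Real.log (x 1))) := by
  have h2 := hx.log_add_two 0
  have h3 := hx.log_add_two 1
  rw [zero_add] at h2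
  rw [show (1 + 2 : Fin 4) = 3 from rfl] at h3
  rw [hx.sq_eq, hx.sq_eq, hx.sq_eq, hx.sq_eq, h2, h3, Real.cosh_eq, Real.cosh_eq]
  ring_nf

theorem exists_nat_sum_sq (hx : IsQuarticUnit b x) :
    ∃ n : ℕ, x 0 ^ 2 + x 1 ^ 2 + x 2 ^ 2 + x 3 ^ 2 = n := by
  obtain ⟨n, hn⟩ := exists_int_sum_eq (pow_mem hx.1 2)
  simp only [Pi.pow_apply] at hn
  have h0 : 0 ≤ n := by
    have : (0 : ℝ) ≤ n := by rw [← hn]; positivity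
    exact_mod_cast this
  exact ⟨n.toNat, by rw [hn]; exact_mod_cast (Int.toNat_of_nonneg h0).symm⟩

theorem one_le_mul (hb : 1 ≤ b) (hx : IsQuarticUnit b x)
    (h : Real.log (x 0) ≠ 0 ∨ Real.log (x 1) ≠ 0) :
    1 ≤ (2 * Real.cosh (2 * Real.log (x 0)) - 2) * (2 * Real.cosh (2 * Real.log (x 1)) - 2) := by
  have hmem : x ^ 2 - 1 ∈ quarticRing b := sub_mem (pow_mem hx.1 2) (one_mem _)
  have hne : x ^ 2 - 1 ≠ 0 := by
    intro h0
    have h1 : ∀ j, x j ^ 2 = 1 := fun j => by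
      have := congrFun h0 j
      simp only [Pi.sub_apply, Pi.pow_apply, Pi.one_apply, Pi.zero_apply] at this
      linarith
    have h2 : ∀ j, Real.log (x j) = 0 := fun j => by
      have := h1 j
      rw [hx.sq_eq, Real.exp_eq_one_iff] at this
      linarith
    simp [h2] at h
  have h1 := one_le_abs_prod hb hmem hne
  have h2 := hx.log_add_two 0
  have h3 := hx.log_add_two 1
  rw [zero_add] at h2
  rw [show (1 + 2 : Fin 4) = 3 from rfl] at h3
  simp only [Pi.sub_apply, Pi.pow_apply, Pi.one_apply] at h1
  rw [hx.sq_eq, hx.sq_eq, hx.sq_eq, hx.sq_eq, h2, h3] at h1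
  have key : ∀ t : ℝ, (Real.exp (2 * t) - 1) * (Real.exp (2 * -t) - 1) =
      -(2 * Real.cosh (2 * t) - 2) := by
    intro t
    have : Real.exp (2 * t) * Real.exp (2 * -t) = 1 := by
      rw [← Real.exp_add]; ring_nf; exact Real.exp_zero
    rw [Real.cosh_eq, show -(2 * t) = 2 * -t by ring]
    linear_combination this
  have e : ∀ p q r s : ℝ, p * q * r * s = (p * r) * (q * s) := fun p q r s => by ring
  rw [e, key, key, neg_mul_neg, abs_of_nonneg] at h1
  · exact h1
  · have := Real.one_le_cosh (2 * Real.log (x 0))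
    have := Real.one_le_cosh (2 * Real.log (x 1))
    apply mul_nonneg <;> linarith

end IsQuarticUnit

/-- The conjugates of a root of `x ^ 4 - 4 * b * x ^ 3 - 6 * x ^ 2 + 4 * b * x + 1`. -/
noncomputable def quarticRoot (b : ℕ) : Fin 4 → ℝ := quarticEps b + quarticOm b

theorem quarticRoot_mem (b : ℕ) : quarticRoot b ∈ quarticRing b :=
  add_mem (quarticEps_mem b) (quarticOm_mem b)

theorem quarticRoot_mul_add_two (b : ℕ) (j : Fin 4) :
    quarticRoot b j * quarticRoot b (j + 2) = -1 := by
  have hj : j + 2 = j + 1 + 1 := by rw [add_assoc]; rfl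
  have h1 := quarticEps_sq b j
  have h2 := quarticOm_sq b j
  simp only [quarticRoot, Pi.add_apply]
  rw [hj, quarticOm_add_one, quarticOm_add_one, quarticEps_add_one, quarticEps_add_one]
  linear_combination (1 - quarticOm b j * (quarticEps b j + quarticOm b j)) * h1 - h2

theorem quarticRoot_isQuarticUnit (b : ℕ) : IsQuarticUnit b (quarticRoot b) :=
  ⟨quarticRoot_mem b, Or.inr (quarticRoot_mul_add_two b)⟩

theorem quarticRoot_sum_sq (b : ℕ) : quarticRoot b 0 ^ 2 + quarticRoot b 1 ^ 2 +
    quarticRoot b 2 ^ 2 + quarticRoot b 3 ^ 2 = 16 * b ^ 2 + 12 := by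
  have h := sqrt_sq_add_one_sq b
  have h2 : √(((b : ℝ) + √(b ^ 2 + 1)) ^ 2 + 1) ^ 2 = (b + √(b ^ 2 + 1)) ^ 2 + 1 :=
    Real.sq_sqrt (by positivity)
  simp only [quarticRoot, Pi.add_apply, quarticEps, quarticOm, Matrix.cons_val]
  set s := √((b : ℝ) ^ 2 + 1)
  set t := √(((b : ℝ) + s) ^ 2 + 1)
  linear_combination (2 + 2 * (s - b) ^ 2) * h2 + (8 + 2 * (s ^ 2 - b ^ 2 + 1)) * h

/-- A generator, up to sign, of the group of quartic units modulo torsion as a module over the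
Gaussian integers. -/
theorem exists_quarticUnit_generator (b : ℕ) :
    ∃ η, IsQuarticUnit b η ∧ 2 * Real.cosh (2 * Real.log (η 0)) +
      2 * Real.cosh (2 * Real.log (η 1)) ≤ 16 * b ^ 2 + 12 ∧
      (Real.log (η 0) ≠ 0 ∨ Real.log (η 1) ≠ 0) ∧
      ∀ x, IsQuarticUnit b x → ∃ m n : ℤ,
        Real.log (x 0) = m * Real.log (η 0) + n * Real.log (η 1) ∧
        Real.log (x 1) = m * Real.log (η 1) - n * Real.log (η 0) := by
  classical
  set P : ℕ → Prop := fun n => ∃ x, IsQuarticUnit b x ∧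
    (Real.log (x 0) ≠ 0 ∨ Real.log (x 1) ≠ 0) ∧
    x 0 ^ 2 + x 1 ^ 2 + x 2 ^ 2 + x 3 ^ 2 = n with hP
  have hroot : P (16 * b ^ 2 + 12) := by
    refine ⟨quarticRoot b, quarticRoot_isQuarticUnit b, ?_, by
      rw [quarticRoot_sum_sq]; push_cast; ring⟩
    by_contra! h
    have h1 := (quarticRoot_isQuarticUnit b).sum_sq
    rw [quarticRoot_sum_sq, h.1, h.2] at h1
    simp at h1
    have : (0 : ℝ) ≤ b := Nat.cast_nonneg b
    nlinarith
  obtain ⟨η, hη, hne, hsum⟩ := Nat.find_spec ⟨_, hroot⟩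
  have hmin := fun m => Nat.find_min' (⟨_, hroot⟩ : ∃ n, P n) (m := m)
  refine ⟨η, hη, ?_, hne, ?_⟩
  · have h1 := hη.sum_sq
    have h2 : ((Nat.find ⟨_, hroot⟩ : ℕ) : ℝ) ≤ ((16 * b ^ 2 + 12 : ℕ) : ℝ) := by
      exact_mod_cast hmin _ hroot
    rw [← hsum] at h2
    push_cast at h2
    linarith
  intro x hx
  set A := Real.log (η 0) with hA
  set C := Real.log (η 1) with hC
  have hD : 0 < A ^ 2 + C ^ 2 := by
    rcases hne with h | h
    · have := sq_nonneg C; positivity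
    · have := sq_nonneg A; positivity
  set s := (A * Real.log (x 0) + C * Real.log (x 1)) / (A ^ 2 + C ^ 2) with hs
  set t := (C * Real.log (x 0) - A * Real.log (x 1)) / (A ^ 2 + C ^ 2) with ht
  set m := round s
  set n := round t
  have e0 : Real.log (x 0) = s * A + t * C := by rw [hs, ht]; field_simp; ring
  have e1 : Real.log (x 1) = s * C - t * A := by rw [hs, ht]; field_simp; ring
  set y : Fin 4 → ℝ := x * η ^ (-m) * (fun j => η (j + 1)) ^ (-n) with hy
  have hyU : IsQuarticUnit b y := (hx.mul (hη.zpow _)).mul (hη.shift.zpow _)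
  have hx0 := hx.apply_ne_zero
  have hη0 := hη.apply_ne_zero
  have hl2 : Real.log (η 2) = -A := by simpa using hη.log_add_two 0
  have hlog : ∀ j, Real.log (y j) =
      Real.log (x j) - m * Real.log (η j) - n * Real.log (η (j + 1)) := by
    intro j
    simp only [hy, Pi.mul_apply, Pi.pow_apply]
    rw [Real.log_mul (mul_ne_zero (hx0 _) (zpow_ne_zero _ (hη0 _))) (zpow_ne_zero _ (hη0 _)),
      Real.log_mul (hx0 _) (zpow_ne_zero _ (hη0 _)), Real.log_zpow, Real.log_zpow]
    push_cast; ring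
  have l0 : Real.log (y 0) = (s - m) * A + (t - n) * C := by
    rw [hlog 0, zero_add, e0]; ring
  have l1 : Real.log (y 1) = (s - m) * C - (t - n) * A := by
    rw [hlog 1, show (1 + 1 : Fin 4) = 2 from rfl, hl2, e1]; ring
  by_cases hz : Real.log (y 0) ≠ 0 ∨ Real.log (y 1) ≠ 0
  · exfalso
    obtain ⟨k, hk⟩ := hyU.exists_nat_sum_sq
    have h1 := hmin k ⟨y, hyU, hz, hk⟩
    have h2 : ((Nat.find ⟨_, hroot⟩ : ℕ) : ℝ) ≤ k := by exact_mod_cast h1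
    rw [← hsum, ← hk, hη.sum_sq, hyU.sum_sq] at h2
    have hsm : (s - m) ^ 2 ≤ 1 / 4 := by
      have := abs_sub_round s
      rw [← sq_abs]; nlinarith [abs_nonneg (s - m)]
    have htn : (t - n) ^ 2 ≤ 1 / 4 := by
      have := abs_sub_round t
      rw [← sq_abs]; nlinarith [abs_nonneg (t - n)]
    have h3 := cosh_add_cosh_lt (a := 2 * Real.log (y 0)) (c := 2 * Real.log (y 1)) (A := 2 * A)
      (C := 2 * C) (by
        rw [l0, l1]
        have : ((s - m) ^ 2 + (t - n) ^ 2) * (A ^ 2 + C ^ 2) ≤ 1 / 2 * (A ^ 2 + C ^ 2) := by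
          gcongr; linarith
        linarith) (by linarith)
    linarith
  · push Not at hz
    refine ⟨m, n, ?_, ?_⟩
    · have := hlog 0
      rw [hz.1, zero_add] at this
      linarith
    · have := hlog 1
      rw [hz.2, show (1 + 1 : Fin 4) = 2 from rfl, hl2] at this
      linarith

theorem Subring.det_mem {R ι : Type*} [CommRing R] [Fintype ι] [DecidableEq ι] (S : Subring R)
    {M : Matrix ι ι R} (h : ∀ i j, M i j ∈ S) : M.det ∈ S := by
  rw [Matrix.det_apply]
  refine sum_mem fun σ _ => ?_
  rw [Units.smul_def]
  exact zsmul_mem (prod_mem fun i _ => h _ _) _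

theorem IsQuarticUnit.exists_interpDet_eq {b : ℕ} {η : Fin 4 → ℝ} (hη : IsQuarticUnit b η)
    (K L : ℕ) (e₁ e₂ : ℤ) (q : Fin (K + 1) × Fin L → ℕ × ℕ) :
    ∃ x ∈ quarticRing b, ∀ k, x k = interpDet K L e₁ e₂ q (2 * Real.log (η k))
      (2 * Real.log (η (k + 1))) := by
  set M : Matrix (Fin (K + 1) × Fin L) (Fin (K + 1) × Fin L) (Fin 4 → ℝ) := Matrix.of fun i j =>
    (((q j).2 * e₁ - (q j).1 * e₂ : ℤ) : Fin 4 → ℝ) ^ (i.1 : ℕ) *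
      (η ^ (2 * (q j).1) * (fun k => η (k + 1)) ^ (2 * (q j).2)) ^ (i.2 : ℕ) with hM
  refine ⟨M.det, Subring.det_mem _ fun i j => ?_, fun k => ?_⟩
  · exact mul_mem (pow_mem (intCast_mem _ _) _) (pow_mem (mul_mem (pow_mem hη.1 _)
      (pow_mem hη.shift.1 _)) _)
  · have h := RingHom.map_det (Pi.evalRingHom (fun _ : Fin 4 => ℝ) k) M
    rw [Pi.evalRingHom_apply] at h
    rw [h, interpDet]
    congr 1
    ext i j
    simp only [hM, RingHom.mapMatrix_apply, Matrix.map_apply, Matrix.of_apply, map_mul, map_pow,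
      map_intCast, Pi.evalRingHom_apply]
    rw [Real.exp_nat_mul, Real.exp_add, Real.exp_nat_mul, Real.exp_nat_mul, ← hη.sq_eq,
      ← hη.sq_eq, pow_mul, pow_mul]

theorem two_mul_cosh_sub_two_le {x : ℝ} (h : |x| ≤ 1) : 2 * Real.cosh x - 2 ≤ 2 * x ^ 2 := by
  have h1 : x ^ 2 ≤ 1 := by rw [← sq_abs]; nlinarith [abs_nonneg x]
  have h2 := Real.cosh_le_exp_half_sq x
  have h3 := Real.abs_exp_sub_one_le (x := x ^ 2 / 2)
      (by rw [abs_of_nonneg (by positivity)]; linarith)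
  rw [abs_of_nonneg (by positivity : 0 ≤ x ^ 2 / 2)] at h3
  have := (abs_le.1 h3).2
  linarith

theorem abs_le_of_two_mul_cosh_le {x : ℝ} (h : 2 * Real.cosh x ≤ 29594) : |x| ≤ 10.4 := by
  by_contra! hx
  have h1 : Real.exp |x| ≤ 2 * Real.cosh x := by
    rw [← Real.cosh_abs, Real.cosh_eq]
    have := Real.exp_pos (-|x|)
    linarith
  have h2 : Real.exp 10.4 < Real.exp |x| := Real.exp_lt_exp.2 hx
  have h3 : (2.718 : ℝ) ^ 10 ≤ Real.exp 10 := by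
    rw [show (10 : ℝ) = (10 : ℕ) * 1 by norm_num, Real.exp_nat_mul]
    have := Real.exp_one_gt_d9
    gcongr; linarith
  have h4 : 1 + 0.4 + (0.4 : ℝ) ^ 2 / 2 ≤ Real.exp 0.4 :=
    Real.quadratic_le_exp_of_nonneg (by norm_num)
  have h5 : Real.exp 10.4 = Real.exp 10 * Real.exp 0.4 := by rw [← Real.exp_add]; norm_num
  have h6 : (2.718 : ℝ) ^ 10 * (1 + 0.4 + (0.4 : ℝ) ^ 2 / 2) ≤ Real.exp 10 * Real.exp 0.4 := by
    gcongr
  norm_num at h6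
  linarith

theorem exists_interpolation_degree {h : ℝ} (hh : 10 ^ 20 ≤ h) :
    ∃ L : ℕ, 200 ≤ L ∧ 1760000000 * (L : ℝ) ^ 4 + 3 ≤ h ∧ 2250 * L * h ≤ Real.exp (L / 4) ∧
      2340 * L ≤ h := by
  have h0 : 0 < h := by linarith [pow_pos (show (0 : ℝ) < 10 by norm_num) 20]
  set u := Real.log h with hu
  have hexp : Real.exp u = h := Real.exp_log h0
  have hu46 : 46 ≤ u := by
    rw [hu, Real.le_log_iff_exp_le h0]
    refine le_trans ?_ hh
    rw [show (46 : ℝ) = (46 : ℕ) * 1 by norm_num, Real.exp_nat_mul]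
    have := Real.exp_one_lt_d9
    calc Real.exp 1 ^ 46 ≤ (2.7183 : ℝ) ^ 46 := by
          have := Real.exp_pos 1
          gcongr; linarith
      _ ≤ _ := by norm_num
  set L := ⌈6 * u⌉₊ with hL
  have l1 : 6 * u ≤ L := Nat.le_ceil _
  have l2 : (L : ℝ) < 6 * u + 1 := Nat.ceil_lt_add_one (by linarith)
  have hE : 350 * (L : ℝ) ≤ Real.exp (u / 4) := by
    have h1 : (2.718 : ℝ) ^ 11 ≤ Real.exp 11 := by
      rw [show (11 : ℝ) = (11 : ℕ) * 1 by norm_num, Real.exp_nat_mul]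
      have := Real.exp_one_gt_d9
      gcongr; linarith
    have h2 : 1 + 0.5 + (0.5 : ℝ) ^ 2 / 2 ≤ Real.exp 0.5 :=
      Real.quadratic_le_exp_of_nonneg (by norm_num)
    have h3 := Real.add_one_le_exp (u / 4 - 11.5)
    have h4 : Real.exp (u / 4) = Real.exp 11 * Real.exp 0.5 * Real.exp (u / 4 - 11.5) := by
      rw [← Real.exp_add, ← Real.exp_add]; ring_nf
    have h5 : (2.718 : ℝ) ^ 11 * (1 + 0.5 + (0.5 : ℝ) ^ 2 / 2) * (u / 4 - 11.5 + 1) ≤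
        Real.exp 11 * Real.exp 0.5 * Real.exp (u / 4 - 11.5) := by
      gcongr
      linarith
    rw [h4]
    refine le_trans ?_ h5
    norm_num
    linarith
  have hL0 : (276 : ℝ) ≤ L := by linarith
  have hh4 : h = Real.exp (u / 4) ^ 4 := by
    rw [← Real.exp_nat_mul, ← hexp]; congr 1; push_cast; ring
  have hpow : (350 * (L : ℝ)) ^ 4 ≤ h := by rw [hh4]; gcongr
  have hL4 : (276 : ℝ) ^ 3 * L ≤ (L : ℝ) ^ 4 := by
    rw [show (L : ℝ) ^ 4 = L ^ 3 * L by ring]; gcongr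
  refine ⟨L, ?_, ?_, ?_, ?_⟩
  · have : (200 : ℝ) ≤ L := by linarith
    exact_mod_cast this
  · rw [mul_pow] at hpow; norm_num at hpow hL4; linarith
  · have h1 : Real.exp (u / 4) ^ 6 ≤ Real.exp (L / 4) := by
      rw [← Real.exp_nat_mul]
      apply Real.exp_le_exp.2
      push_cast; linarith
    refine le_trans ?_ h1
    have h2 : Real.exp (u / 4) ^ 6 = Real.exp (u / 4) ^ 2 * h := by rw [hh4]; ring
    rw [h2]
    have h3 : (350 * (L : ℝ)) ^ 2 ≤ Real.exp (u / 4) ^ 2 := by gcongr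
    gcongr
    nlinarith
  · rw [mul_pow] at hpow; norm_num at hpow hL4; linarith

set_option maxHeartbeats 1000000 in
/-- A quartic unit with one conjugate extremely close to `±1` compared to the next one has bounded
height. -/
theorem IsQuarticUnit.abs_log_lt {b : ℕ} (hb : 1 ≤ b) (hb' : b ≤ 43) {V : Fin 4 → ℝ}
    (hV : IsQuarticUnit b V) (hs : |Real.log (V 0)| ≤ 4 * Real.exp (-|Real.log (V 1)|)) :
    |Real.log (V 1)| < 10 ^ 20 := by
  by_contra! hh
  set h := |Real.log (V 1)| with hdef
  have hh1 : (1000 : ℝ) ≤ h := le_trans (by norm_num) hh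
  have hexpsmall : 64 * Real.exp (-h) < 1 := by
    have h1 := Real.add_one_le_exp h
    have h2 : Real.exp (-h) * Real.exp h = 1 := by rw [← Real.exp_add]; simp
    have := Real.exp_pos (-h)
    nlinarith
  obtain ⟨η, hη, hcosh, hne, hgen⟩ := exists_quarticUnit_generator b
  obtain ⟨m, n, e0, e1⟩ := hgen V hV
  have hPQ := hη.one_le_mul hb hne
  have hl2 : Real.log (η 2) = -Real.log (η 0) := by simpa using hη.log_add_two 0
  have hl3 : Real.log (η 3) = -Real.log (η 1) := by simpa using hη.log_add_two 1
  have hcop : IsCoprime m n := by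
    rw [Int.isCoprime_iff_gcd_eq_one]
    by_contra hg
    obtain ⟨m', hm'⟩ := Int.gcd_dvd_left m n
    obtain ⟨n', hn'⟩ := Int.gcd_dvd_right m n
    set g := Int.gcd m n
    have hg0 : g ≠ 0 := by
      intro h0
      rw [h0] at hm' hn'
      simp only [Nat.cast_zero, zero_mul] at hm' hn'
      rw [hm', hn'] at e1
      simp only [Int.cast_zero, zero_mul, sub_zero] at e1
      rw [hdef, e1] at hh1
      norm_num at hh1
    have hg2 : (2 : ℝ) ≤ g := by
      have : 2 ≤ g := by omega
      exact_mod_cast this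
    set W : Fin 4 → ℝ := η ^ m' * (fun j => η (j + 1)) ^ n' with hW
    have hWU : IsQuarticUnit b W := (hη.zpow _).mul (hη.shift.zpow _)
    have hη0 := hη.apply_ne_zero
    have hlog : ∀ j, Real.log (W j) = m' * Real.log (η j) + n' * Real.log (η (j + 1)) := by
      intro j
      simp only [hW, Pi.mul_apply, Pi.pow_apply]
      rw [Real.log_mul (zpow_ne_zero _ (hη0 _)) (zpow_ne_zero _ (hη0 _)), Real.log_zpow,
        Real.log_zpow]
    have w0 : g * Real.log (W 0) = Real.log (V 0) := by
      rw [hlog 0, e0, zero_add, hm', hn']; push_cast; ring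
    have w1 : g * Real.log (W 1) = Real.log (V 1) := by
      rw [hlog 1, e1, show (1 + 1 : Fin 4) = 2 from rfl, hl2, hm', hn']; push_cast; ring
    have a0 : |2 * Real.log (W 0)| ≤ 4 * Real.exp (-h) := by
      refine le_trans ?_ hs
      rw [← w0, abs_mul, abs_mul]
      gcongr
    have a1 : |2 * Real.log (W 1)| ≤ h := by
      rw [hdef, ← w1, abs_mul, abs_mul]
      gcongr
    have hlow := hWU.one_le_mul hb (Or.inr (by
      intro h0
      rw [h0, mul_zero] at w1
      rw [hdef, ← w1] at hh1
      norm_num at hh1))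
    have b0 := two_mul_cosh_sub_two_le (x := 2 * Real.log (W 0)) (by linarith [Real.exp_pos (-h)])
    have b1 : 2 * Real.cosh (2 * Real.log (W 1)) - 2 ≤ 2 * Real.exp h := by
      have h1 : Real.cosh (2 * Real.log (W 1)) ≤ Real.cosh h := by
        rw [Real.cosh_le_cosh]; exact a1.trans (le_abs_self h)
      have h2 : Real.cosh h ≤ Real.exp h := by
        rw [Real.cosh_eq]
        have : Real.exp (-h) ≤ Real.exp h := Real.exp_le_exp.2 (by linarith)
        linarith
      linarith
    have b2 : (2 * Real.log (W 0)) ^ 2 ≤ (4 * Real.exp (-h)) ^ 2 := by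
      rw [← sq_abs]; gcongr
    have p0 : 0 ≤ 2 * Real.cosh (2 * Real.log (W 0)) - 2 := by
      linarith [Real.one_le_cosh (2 * Real.log (W 0))]
    have p1 : 0 ≤ 2 * Real.cosh (2 * Real.log (W 1)) - 2 := by
      linarith [Real.one_le_cosh (2 * Real.log (W 1))]
    have hup : (2 * Real.cosh (2 * Real.log (W 0)) - 2) * (2 * Real.cosh (2 * Real.log (W 1)) - 2) ≤
        (2 * (4 * Real.exp (-h)) ^ 2) * (2 * Real.exp h) := by
      gcongr
      linarith
    have hee : Real.exp (-h) * Real.exp h = 1 := by rw [← Real.exp_add]; simp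
    have : (2 * (4 * Real.exp (-h)) ^ 2) * (2 * Real.exp h) = 64 * Real.exp (-h) := by
      linear_combination 64 * Real.exp (-h) * hee
    linarith
  set A := Real.log (η 0) with hA
  set C := Real.log (η 1) with hC
  have hbr : (b : ℝ) ^ 2 ≤ 43 ^ 2 := by
    have : (b : ℝ) ≤ 43 := by exact_mod_cast hb'
    gcongr
  have hA5 : |2 * A| ≤ 10.4 := abs_le_of_two_mul_cosh_le (by
    linarith [Real.one_le_cosh (2 * C)])
  have hC5 : |2 * C| ≤ 10.4 := abs_le_of_two_mul_cosh_le (by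
    linarith [Real.one_le_cosh (2 * A)])
  have hC0 : 2 * C ≠ 0 := by
    intro h0
    rw [h0, Real.cosh_zero] at hPQ
    norm_num at hPQ
  have hAC : 1 / 16 ≤ A ^ 2 + C ^ 2 := by
    by_contra! hlt
    have hA1 : |2 * A| ≤ 1 := by rw [← sq_le_one_iff_abs_le_one]; nlinarith [sq_nonneg C]
    have hC1 : |2 * C| ≤ 1 := by rw [← sq_le_one_iff_abs_le_one]; nlinarith [sq_nonneg A]
    have h1 := two_mul_cosh_sub_two_le hA1
    have h2 := two_mul_cosh_sub_two_le hC1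
    have h3 := Real.one_le_cosh (2 * A)
    have h4 := Real.one_le_cosh (2 * C)
    have h5 : (2 * Real.cosh (2 * A) - 2) * (2 * Real.cosh (2 * C) - 2) ≤
        (2 * (2 * A) ^ 2) * (2 * (2 * C) ^ 2) :=
      mul_le_mul h1 h2 (by linarith) (by positivity)
    have h6 : (A ^ 2 + C ^ 2) ^ 2 < (1 / 16) ^ 2 := by gcongr
    nlinarith [sq_nonneg (A ^ 2 - C ^ 2)]
  have hV1 : Real.log (V 1) ^ 2 = h ^ 2 := (sq_abs _).symm
  have hV0 : Real.log (V 0) ^ 2 ≤ 1 := by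
    rw [sq_le_one_iff_abs_le_one]; linarith [Real.exp_pos (-h)]
  have hmn : (|(m : ℝ)| + |(n : ℝ)|) ≤ 10 * h := by
    have h1 : ((m : ℝ) ^ 2 + n ^ 2) * (A ^ 2 + C ^ 2) =
        Real.log (V 0) ^ 2 + Real.log (V 1) ^ 2 := by
      rw [e0, e1]; ring
    have h2 : ((m : ℝ) ^ 2 + n ^ 2) * (1 / 16) ≤ h ^ 2 + 1 := by
      have : ((m : ℝ) ^ 2 + n ^ 2) * (1 / 16) ≤ ((m : ℝ) ^ 2 + n ^ 2) * (A ^ 2 + C ^ 2) := by gcongr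
      linarith
    refine abs_le_of_sq_le_sq' ?_ (by linarith) |>.2
    have h3 := sq_nonneg (|(m : ℝ)| - |(n : ℝ)|)
    have h4 := sq_abs (m : ℝ)
    have h5 := sq_abs (n : ℝ)
    nlinarith
  have hmn' : h ≤ 5.2 * (|(m : ℝ)| + |(n : ℝ)|) := by
    rw [hdef, e1]
    refine (abs_sub _ _).trans ?_
    rw [abs_mul, abs_mul] at *
    norm_num at hA5 hC5 ⊢
    nlinarith [abs_nonneg (m : ℝ), abs_nonneg (n : ℝ)]
  obtain ⟨L, hL, hL1, hL2, hL3⟩ := exists_interpolation_degree hh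
  obtain ⟨K, q, hD, hprod⟩ := exists_interpDet_ne_zero_and_prod_lt_one hL hcop (by
    by_contra! hcon
    have c1 : |(m : ℝ)| < 225 * L := by
      rw [← Int.cast_abs]; exact_mod_cast hcon.1
    have c2 : |(n : ℝ)| < 225 * L := by
      rw [← Int.cast_abs]; exact_mod_cast hcon.2
    linarith) hC0 hA5 hC5 (by
      refine le_trans ?_ hL2
      push_cast
      have : (0 : ℝ) ≤ L := Nat.cast_nonneg L
      nlinarith) (by
      have h1 : |2 * A * m + 2 * C * n| = 2 * |Real.log (V 0)| := by
        rw [e0, ← abs_two (α := ℝ), ← abs_mul, abs_two]; congr 1; ring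
      rw [h1]
      have h8 : (8 : ℝ) ≤ Real.exp 3 := by
        rw [show (3 : ℝ) = (3 : ℕ) * 1 by norm_num, Real.exp_nat_mul]
        have := Real.exp_one_gt_d9
        calc (8 : ℝ) = 2 ^ 3 := by norm_num
          _ ≤ _ := by gcongr; linarith
      calc 2 * |Real.log (V 0)| ≤ 8 * Real.exp (-h) := by linarith
        _ ≤ Real.exp 3 * Real.exp (-h) := by gcongr
        _ = Real.exp (3 - h) := by rw [← Real.exp_add]; rfl
        _ ≤ _ := Real.exp_le_exp.2 (by linarith))
  obtain ⟨x, hx, hxk⟩ := hη.exists_interpDet_eq K L m n q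
  have h0 := hxk 0
  have h1 := hxk 1
  have h2 := hxk 2
  have h3 := hxk 3
  rw [zero_add] at h0
  rw [show (1 + 1 : Fin 4) = 2 from rfl, hl2, mul_neg] at h1
  rw [show (2 + 1 : Fin 4) = 3 from rfl, hl2, hl3, mul_neg, mul_neg] at h2
  rw [show (3 + 1 : Fin 4) = 0 from rfl, hl3, mul_neg] at h3
  have hx0 : x ≠ 0 := by
    rintro rfl
    exact hD (by rw [← h0]; rfl)
  have := one_le_abs_prod hb hx hx0
  rw [h0, h1, h2, h3, abs_mul, abs_mul, abs_mul] at this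
  linarith

theorem quarticEps_add_two (b : ℕ) (j : Fin 4) : quarticEps b (j + 2) = quarticEps b j := by
  have hj : j + 2 = j + 1 + 1 := by rw [add_assoc]; rfl
  rw [hj, quarticEps_add_one, quarticEps_add_one]; ring

theorem quarticOm_add_two (b : ℕ) (j : Fin 4) : quarticOm b (j + 2) = -quarticOm b j := by
  have hj : j + 2 = j + 1 + 1 := by rw [add_assoc]; rfl
  have h1 := quarticEps_sq b j
  rw [hj, quarticOm_add_one, quarticOm_add_one, quarticEps_add_one]
  linear_combination -quarticOm b j * h1

theorem quarticRoot_add_one (b : ℕ) (j : Fin 4) :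
    quarticRoot b (j + 1) * (quarticRoot b j + 1) = quarticRoot b j - 1 := by
  have h1 := quarticEps_sq b j
  have h2 := quarticOm_sq b j
  simp only [quarticRoot, Pi.add_apply, quarticEps_add_one, quarticOm_add_one]
  linear_combination (-1 + quarticOm b j + 2 * b) * h1 + (quarticEps b j - 2 * b) * h2

theorem quarticRoot_eval (b : ℕ) (j : Fin 4) : quarticRoot b j ^ 4 - 4 * b * quarticRoot b j ^ 3 -
    6 * quarticRoot b j ^ 2 + 4 * b * quarticRoot b j + 1 = 0 := by
  have h1 := quarticEps_sq b j
  have h2 := quarticOm_sq b j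
  have h3 : (quarticRoot b j - quarticEps b j) ^ 2 = 2 * b * quarticEps b j + 2 := by
    rw [← h2, quarticRoot, Pi.add_apply, add_sub_cancel_left]
  set ρ := quarticRoot b j
  set e := quarticEps b j
  have h4 : ρ ^ 2 - 1 = 2 * e * ρ := by linear_combination h3 - h1
  linear_combination (ρ ^ 2 - 1 + 2 * e * ρ - 4 * b * ρ) * h4 + 4 * ρ ^ 2 * h1

theorem abs_log_one_add_le {x : ℝ} (hx : |x| ≤ 1 / 2) : |Real.log (1 + x)| ≤ 2 * |x| := by
  have h1 := abs_le.1 hx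
  have hpos : 0 < 1 + x := by linarith
  rw [abs_le]
  constructor
  · refine le_trans ?_ (Real.one_sub_inv_le_log_of_pos hpos)
    rw [show 1 - (1 + x)⁻¹ = x / (1 + x) by field_simp; ring, le_div_iff₀ hpos]
    nlinarith [neg_abs_le x, abs_nonneg x]
  · have := Real.log_le_sub_one_of_pos hpos
    linarith [le_abs_self x, abs_nonneg x]

theorem abs_log_div_le {t : ℝ} (ht : |t| ≤ 1 / 2) : |Real.log ((t - 1) / (t + 1))| ≤ 4 * |t| := by
  have h1 := abs_log_one_add_le ht
  have h2 := abs_log_one_add_le (x := -t) (by rwa [abs_neg])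
  have h3 := abs_le.1 ht
  rw [abs_neg] at h2
  rw [Real.log_div (by linarith) (by linarith), ← Real.log_neg_eq_log (t - 1),
    show -(t - 1) = 1 + -t by ring, add_comm t]
  refine (abs_sub _ _).trans ?_
  linarith

theorem exists_abs_le_half {V : Fin 4 → ℝ} (hV2 : ∀ j, V j * V (j + 2) = -1)
    (hV1 : ∀ j, V (j + 1) * (1 - V j) = 1 + V j) : ∃ j, |V j| ≤ 1 / 2 := by
  obtain ⟨k, hk⟩ : ∃ k, |V k| ≤ 1 := by
    by_contra! hcon
    have h1 := hV2 0
    have h2 : |V 0| * |V (0 + 2)| = 1 := by rw [← abs_mul, h1]; simp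
    nlinarith [hcon 0, hcon (0 + 2)]
  by_contra! hcon
  have hk' := abs_le.1 hk
  rcases lt_abs.1 (hcon k) with h | h
  · have h1 := hV1 (k + 3)
    rw [show ∀ j : Fin 4, j + 3 + 1 = j by decide] at h1
    have h2 : |V (k + 3)| * (1 + V k) = 1 - V k := by
      rw [← abs_of_pos (by linarith : 0 < 1 + V k), ← abs_mul,
        show V (k + 3) * (1 + V k) = -(1 - V k) by linarith, abs_neg, abs_of_nonneg]
      linarith
    nlinarith [hcon (k + 3)]
  · have h1 := hV1 k
    have h2 : |V (k + 1)| * (1 - V k) = 1 + V k := by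
      rw [← abs_of_pos (by linarith : 0 < 1 - V k), ← abs_mul, h1, abs_of_nonneg]
      linarith
    nlinarith [hcon (k + 1)]

theorem abs_mul_sq_add_sq_sq_le_one {b v ρ r s : ℝ}
    (h2 : ρ ^ 4 - 4 * b * ρ ^ 3 - 6 * ρ ^ 2 + 4 * b * ρ + 1 = 0)
    (HR : r ^ 4 - 4 * b * r ^ 3 * s - 6 * r ^ 2 * s ^ 2 + 4 * b * r * s ^ 3 + s ^ 4 = 1)
    (h1 : v * (ρ * r + s) = r - ρ * s) (q0 : ρ * r + s ≠ 0) (hj : |v| ≤ 1 / 2) :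
    |v| * (r ^ 2 + s ^ 2) ^ 2 ≤ 1 := by
  have id1 : v * (1 - v ^ 2) * (ρ * r + s) ^ 4 = ρ * (ρ ^ 2 - 1) := by
    calc v * (1 - v ^ 2) * (ρ * r + s) ^ 4 = (v * (ρ * r + s)) * (ρ * r + s) *
          ((ρ * r + s) ^ 2 - (v * (ρ * r + s)) ^ 2) := by ring
      _ = _ := by
        rw [h1]
        linear_combination ρ * (ρ ^ 2 - 1) * HR - (r ^ 3 * s - r * s ^ 3) * h2
  have id2 : (1 + v ^ 2) * (ρ * r + s) ^ 2 = (1 + ρ ^ 2) * (r ^ 2 + s ^ 2) := by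
    linear_combination (v * (ρ * r + s) + (r - ρ * s)) * h1
  have hv : v ^ 2 ≤ 1 / 4 := by
    rw [← sq_abs]
    have := pow_le_pow_left₀ (abs_nonneg v) hj 2
    linarith
  have h3 : |ρ * (ρ ^ 2 - 1)| * 4 ≤ (1 + ρ ^ 2) ^ 2 := by
    have : |ρ * (ρ ^ 2 - 1)| ≤ (1 + ρ ^ 2) ^ 2 / 4 := by
      rw [abs_le]
      constructor
      · linarith [sq_nonneg (ρ ^ 2 + 2 * ρ - 1)]
      · linarith [sq_nonneg (ρ ^ 2 - 2 * ρ - 1)]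
    linarith
  have hQ4 : 0 < (ρ * r + s) ^ 4 := by positivity
  rw [← id1, abs_mul, abs_mul, abs_of_pos hQ4, abs_of_nonneg (by linarith : 0 ≤ 1 - v ^ 2)] at h3
  generalize hN : r ^ 2 + s ^ 2 = N at *
  have h4 : |v| * (1 - v ^ 2) * 4 * N ^ 2 * (ρ * r + s) ^ 4 ≤
      (1 + v ^ 2) ^ 2 * (ρ * r + s) ^ 4 := by
    calc |v| * (1 - v ^ 2) * 4 * N ^ 2 * (ρ * r + s) ^ 4 =
          (|v| * (1 - v ^ 2) * (ρ * r + s) ^ 4 * 4) * N ^ 2 := by ring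
      _ ≤ (1 + ρ ^ 2) ^ 2 * N ^ 2 := mul_le_mul_of_nonneg_right h3 (sq_nonneg _)
      _ = ((1 + v ^ 2) * (ρ * r + s) ^ 2) ^ 2 := by rw [id2]; ring
      _ = _ := by ring
  have h5 := le_of_mul_le_mul_right h4 hQ4
  have h6 : 0 ≤ |v| * N ^ 2 := by positivity
  have h7 : |v| * N ^ 2 * (3 / 4) ≤ |v| * N ^ 2 * (1 - v ^ 2) :=
    mul_le_mul_of_nonneg_left (by linarith) h6
  have h8 : (1 + v ^ 2) ^ 2 ≤ (5 / 4) ^ 2 := pow_le_pow_left₀ (by positivity) (by linarith) 2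
  linarith

set_option maxHeartbeats 1000000 in
theorem log_sq_add_sq_lt {b : ℕ} (hb : 1 ≤ b) (hb' : b ≤ 43) {r s : ℤ}
    (H : r ^ 4 - 4 * b * r ^ 3 * s - 6 * r ^ 2 * s ^ 2 + 4 * b * r * s ^ 3 + s ^ 4 = 1) :
    2 * Real.log ((r : ℝ) ^ 2 + (s : ℝ) ^ 2) < 10 ^ 20 := by
  have HR : (r : ℝ) ^ 4 - 4 * b * r ^ 3 * s - 6 * r ^ 2 * s ^ 2 + 4 * b * r * s ^ 3 + s ^ 4 =
      1 := by
    exact_mod_cast H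
  set ρ := quarticRoot b with hρ
  set β : Fin 4 → ℝ := fun j => r - ρ j * s with hβ
  have hβmem : β ∈ quarticRing b :=
    sub_mem (intCast_mem _ r) (mul_mem (quarticRoot_mem b) (intCast_mem _ s))
  have hρ2 := quarticRoot_mul_add_two b
  rw [← hρ] at hρ2
  have hprod : ∀ j, β j * β (j + 1) * β (j + 2) * β (j + 3) = 1 := by
    intro j
    have k : ∀ j, β j * β (j + 2) = r ^ 2 - 2 * quarticEps b j * (r * s) - s ^ 2 := by
      intro j
      have h1 := hρ2 j
      have h2 : ρ j + ρ (j + 2) = 2 * quarticEps b j := by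
        simp only [hρ, quarticRoot, Pi.add_apply, quarticEps_add_two, quarticOm_add_two]; ring
      simp only [hβ]
      linear_combination s ^ 2 * h1 - r * s * h2
    have e3 : j + 3 = j + 1 + 2 := by rw [add_assoc]; rfl
    calc β j * β (j + 1) * β (j + 2) * β (j + 3) = (β j * β (j + 2)) * (β (j + 1) * β (j + 3)) := by
          ring
      _ = 1 := by
        rw [e3, k, k, quarticEps_add_one, ← HR]
        linear_combination -4 * r ^ 2 * s ^ 2 * quarticEps_sq b j
  set V : Fin 4 → ℝ := fun j => -(β j ^ 2 * ρ (j + 2) * β (j + 1) * β (j + 3)) with hV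
  have e31 : ∀ j : Fin 4, j + 3 + 1 = j := by decide
  have e22 : ∀ j : Fin 4, j + 2 + 2 = j := by decide
  have e21 : ∀ j : Fin 4, j + 2 + 1 = j + 3 := by decide
  have e23 : ∀ j : Fin 4, j + 2 + 3 = j + 1 := by decide
  have hVunit : IsQuarticUnit b V := by
    have sh : ∀ {x : Fin 4 → ℝ}, x ∈ quarticRing b → (fun j => x (j + 1)) ∈ quarticRing b :=
      shift_mem_quarticRing
    have e11 : ∀ j : Fin 4, j + 1 + 1 = j + 2 := by decide
    have s2 : ∀ {x : Fin 4 → ℝ}, x ∈ quarticRing b → (fun j => x (j + 2)) ∈ quarticRing b := by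
      intro x hx; simpa only [e11] using sh (sh hx)
    have e111 : ∀ j : Fin 4, j + 1 + 2 = j + 3 := by decide
    have s3 : ∀ {x : Fin 4 → ℝ}, x ∈ quarticRing b → (fun j => x (j + 3)) ∈ quarticRing b := by
      intro x hx; simpa only [e111] using sh (s2 hx)
    refine ⟨neg_mem (mul_mem (mul_mem (mul_mem (pow_mem hβmem 2) (s2 (quarticRoot_mem b)))
      (sh hβmem)) (s3 hβmem)), Or.inr fun j => ?_⟩
    simp only [hV, e22, e21, e23]
    have h1 := hprod j
    have h2 := hρ2 j
    linear_combination (β j * β (j + 1) * β (j + 2) * β (j + 3)) ^ 2 * h2 -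
      (β j * β (j + 1) * β (j + 2) * β (j + 3) + 1) * h1
  have hVQ : ∀ j, V j * (ρ j * r + s) = r - ρ j * s := by
    intro j
    have h1 := hprod j
    have h2 := hρ2 j
    have h3 : ρ j * r + s = ρ j * β (j + 2) := by
      simp only [hβ]; linear_combination s * h2
    rw [h3]
    change _ = β j
    simp only [hV]
    linear_combination β j * h1 - (β j * (β j * β (j + 1) * β (j + 2) * β (j + 3))) * h2
  have hV2 : ∀ j, V j * V (j + 2) = -1 := by
    intro j
    simp only [hV, e22, e21, e23]
    have h1 := hprod j
    have h2 := hρ2 j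
    linear_combination (β j * β (j + 1) * β (j + 2) * β (j + 3)) ^ 2 * h2 -
      (β j * β (j + 1) * β (j + 2) * β (j + 3) + 1) * h1
  have hN1 : (1 : ℝ) ≤ (r : ℝ) ^ 2 + (s : ℝ) ^ 2 := by
    have : 0 < r ^ 2 + s ^ 2 := by
      by_contra! h0
      have hr : r = 0 := by nlinarith [sq_nonneg r, sq_nonneg s]
      have hs : s = 0 := by nlinarith [sq_nonneg r, sq_nonneg s]
      subst hr hs
      norm_num at H
    exact_mod_cast this
  set N : ℝ := (r : ℝ) ^ 2 + (s : ℝ) ^ 2 with hN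
  have hQ0 : ∀ j, ρ j * r + s ≠ 0 := by
    intro j h0
    have h1 := hVQ j
    rw [h0, mul_zero] at h1
    have : (ρ j ^ 2 + 1) * N = 0 := by
      rw [hN]; linear_combination (ρ j * r + s) * h0 - (r - ρ j * s) * h1
    have : 0 < (ρ j ^ 2 + 1) * N := by positivity
    linarith
  have hV1 : ∀ j, V (j + 1) * (1 - V j) = 1 + V j := by
    intro j
    have h1 := hVQ j
    have h2 := hVQ (j + 1)
    have h3 := quarticRoot_add_one b j
    rw [← hρ] at h3
    have q0 := hQ0 j
    have q1 := hQ0 (j + 1)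
    have ρ1 : ρ j + 1 ≠ 0 := by
      intro h0
      have : ρ j = -1 := by linarith
      rw [h0, this] at h3
      norm_num at h3
    apply mul_right_cancel₀ (mul_ne_zero q0 ρ1)
    have h4 : V (j + 1) * ((ρ j - 1) * r + (ρ j + 1) * s) = (ρ j + 1) * r - (ρ j - 1) * s := by
      linear_combination (ρ j + 1) * h2 - (V (j + 1) * r + s) * h3
    linear_combination (ρ j + 1) * (h4 - (V (j + 1) + 1) * h1)
  have hVsmall : ∀ j, |V j| ≤ 1 / 2 → |V j| * N ^ 2 ≤ 1 := fun j hj =>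
    abs_mul_sq_add_sq_sq_le_one (quarticRoot_eval b j) HR (hVQ j) (hQ0 j) hj
  obtain ⟨j, hj⟩ := exists_abs_le_half hV2 hV1
  have hshift : ∀ k : Fin 4, IsQuarticUnit b fun i => V (i + k) := by
    have h0 : IsQuarticUnit b fun i => V (i + 0) := by simpa only [add_zero] using hVunit
    have hs : ∀ k, (IsQuarticUnit b fun i => V (i + k)) →
        IsQuarticUnit b fun i => V (i + (k + 1)) := by
      intro k hk
      simpa only [add_assoc, add_comm (1 : Fin 4)] using hk.shift
    have h1 := hs 0 h0
    have h2 := hs 1 h1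
    have h3 := hs 2 h2
    intro k
    fin_cases k
    exacts [h0, h1, h2, h3]
  have hU := hshift (j + 3)
  have hv0 := hVunit.apply_ne_zero j
  have habs : |Real.log (V j)| = -Real.log |V j| := by
    rw [← Real.log_abs, abs_of_nonpos]
    exact Real.log_nonpos (abs_nonneg _) (by linarith)
  have e13 : (1 : Fin 4) + (j + 3) = j := by
    rw [add_comm]; exact e31 j
  have hfin := hU.abs_log_lt hb hb' (by
    simp only [zero_add, e13]
    rw [habs, neg_neg, Real.exp_log (abs_pos.2 hv0)]
    have h1 := hV1 (j + 3)
    rw [e31] at h1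
    have h2 := abs_le.1 hj
    have : V (j + 3) = (V j - 1) / (V j + 1) := by
      rw [eq_div_iff (by linarith)]; linarith
    rw [this]
    exact abs_log_div_le hj)
  simp only [e13] at hfin
  rw [habs] at hfin
  have h1 := Real.log_nonpos (by positivity) (hVsmall j hj)
  rw [Real.log_mul (abs_ne_zero.2 hv0) (by positivity), Real.log_pow] at h1
  push_cast at h1
  linarith

open Finset in
theorem norm_sum_exp_div_prod_sub_le {ι : Type*} [DecidableEq ι] {n : ℕ} {s : Finset ι} {v : ι → ℝ}
    (hv : Set.InjOn v s) (hs : #s = n + 1) {τ : ℝ} (hτ : 0 ≤ τ) :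
    ‖∑ i ∈ s, Complex.exp (-(τ * v i * Complex.I)) / ((∏ j ∈ s.erase i, (v i - v j) : ℝ) : ℂ)‖ ≤
      τ ^ n / n.factorial := by
  induction n generalizing s τ with
  | zero =>
    obtain ⟨i, rfl⟩ := card_eq_one.1 hs
    simp [Complex.norm_exp]
  | succ n ih =>
    obtain ⟨k, hk⟩ := card_pos.1 (by omega : 0 < #s)
    set f : ℝ → ℂ := fun t => ∑ i ∈ s,
      Complex.exp (-(t * (v i - v k) * Complex.I))
          / ((∏ j ∈ s.erase i, (v i - v j) : ℝ) : ℂ) with hf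
    have hshift : ∀ (t : ℝ) (u : Finset ι) (w : ι → ℂ),
        ‖∑ i ∈ u, Complex.exp (-(t * (v i - v k) * Complex.I)) / w i‖ =
          ‖∑ i ∈ u, Complex.exp (-(t * v i * Complex.I)) / w i‖ := by
      intro t u w
      have h1 : ∀ i, Complex.exp (-(t * (v i - v k) * Complex.I)) / w i =
          Complex.exp (t * v k * Complex.I) *
            (Complex.exp (-(t * v i * Complex.I)) / w i) := by
        intro i
        rw [← mul_div_assoc, ← Complex.exp_add]; ring_nf
      simp only [h1]
      rw [← mul_sum, norm_mul, ← Complex.ofReal_mul, Complex.norm_exp_ofReal_mul_I, one_mul]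
    set f' : ℝ → ℂ := fun t => -Complex.I * ∑ i ∈ s.erase k,
      Complex.exp (-(t * (v i - v k) * Complex.I)) /
        ((∏ j ∈ (s.erase k).erase i, (v i - v j) : ℝ) : ℂ) with hf'
    have hder : ∀ t, HasDerivAt f (f' t) t := by
      intro t
      have h1 : ∀ i ∈ s, HasDerivAt (fun t : ℝ => Complex.exp (-(t * (v i - v k) * Complex.I)) /
          ((∏ j ∈ s.erase i, (v i - v j) : ℝ) : ℂ))
          (Complex.exp (-(t * (v i - v k) * Complex.I)) * (-((1 : ℝ) * (v i - v k) * Complex.I)) /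
          ((∏ j ∈ s.erase i, (v i - v j) : ℝ) : ℂ)) t := by
        intro i _
        exact (((((hasDerivAt_id t).ofReal_comp).mul_const _).mul_const _).neg.cexp).div_const _
      refine (HasDerivAt.fun_sum h1).congr_deriv ?_
      rw [← add_sum_erase s _ hk]
      simp only [sub_self, mul_zero, zero_mul, neg_zero, zero_div, zero_add, hf', mul_sum]
      refine sum_congr rfl fun i hi => ?_
      have hik := (mem_erase.1 hi).1
      have his := (mem_erase.1 hi).2
      have hne : (v i - v k : ℂ) ≠ 0 := by
        rw [← Complex.ofReal_sub, Complex.ofReal_ne_zero, sub_ne_zero]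
        exact fun h => hik (hv his hk h)
      rw [erase_right_comm, ← mul_prod_erase (s.erase i) (fun j => v i - v j)
        (mem_erase.2 ⟨hik.symm, hk⟩)]
      push_cast
      field_simp
    have h0 : f 0 = 0 := by
      have h1 := Lagrange.coeff_eq_sum hv (P := (1 : Polynomial ℝ)) (by
        rw [hs, Polynomial.degree_one]; exact_mod_cast Nat.succ_pos _)
      rw [hs, Polynomial.coeff_one, if_neg (by omega)] at h1
      have h2 := congrArg (fun x : ℝ => (x : ℂ)) h1
      simp only [Polynomial.eval_one, Complex.ofReal_zero, Complex.ofReal_sum, Complex.ofReal_div,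
        Complex.ofReal_one] at h2
      simp only [hf, Complex.ofReal_zero, zero_mul, neg_zero, Complex.exp_zero]
      exact h2.symm
    have hB : ∀ t : ℝ, HasDerivAt (fun t : ℝ => t ^ (n + 1) / ((n + 1).factorial : ℝ))
        (t ^ n / (n.factorial : ℝ)) t := by
      intro t
      refine ((hasDerivAt_pow (n + 1) t).div_const _).congr_deriv ?_
      rw [Nat.factorial_succ]
      push_cast
      have := n.factorial_ne_zero
      field_simp
    have key := image_norm_le_of_norm_deriv_right_le_deriv_boundary (f := f) (f' := f')
      (a := 0) (b := τ) (fun t _ => (hder t).continuousAt.continuousWithinAt)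
      (fun t _ => (hder t).hasDerivWithinAt) (by simp [h0]) hB (fun t ht => by
        rw [hf', norm_mul, norm_neg, Complex.norm_I, one_mul, hshift]
        exact ih (hv.mono (by simp)) (by rw [card_erase_of_mem hk, hs]; rfl) ht.1)
      (Set.right_mem_Icc.2 hτ)
    rwa [hf, hshift] at key

section

open Finset

theorem ring_choose_mul_factorial (x : ℝ) (k : ℕ) :
    Ring.choose x k * k.factorial = ∏ i ∈ range k, (x - i) := by
  have h : ∀ k : ℕ, (descPochhammer ℤ k).smeval x = ∏ i ∈ range k, (x - i) := by
    intro k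
    induction k with
    | zero => simp
    | succ k ih =>
      rw [descPochhammer_succ_right, Polynomial.smeval_mul, ih, prod_range_succ,
        Polynomial.smeval_sub, Polynomial.smeval_X, Polynomial.smeval_natCast]
      simp
  rw [← h, Ring.descPochhammer_eq_factorial_smul_choose, nsmul_eq_mul, mul_comm]

theorem prod_range_sub_add (k : ℕ) (c : ℝ) :
    ∏ i ∈ range k, ((k : ℝ) - i + c) = ∏ i ∈ range k, ((i : ℝ) + 1 + c) := by
  rw [← prod_range_reflect]
  refine prod_congr rfl fun i hi => ?_
  have := mem_range.1 hi
  rw [Nat.cast_sub (by omega), Nat.cast_sub (by omega)]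
  push_cast
  ring

/-- The coefficients of the (diagonal) Padé approximants of `(1 - w) ^ ν`, in powers of `1 - w`. -/
noncomputable def padeCoeff (ν : ℝ) (m k : ℕ) : ℝ :=
  Ring.choose (m + ν) k * Ring.choose (m - ν) (m - k)

theorem padeCoeff_mul_prod (ν : ℝ) {m k : ℕ} (hk : k ≤ m) :
    padeCoeff ν m k * ((∏ j ∈ (range (m + 1)).erase k, ((k : ℝ) - j)) *
      ∏ j ∈ range (m + 1), ((k : ℝ) - (j + ν))) =
      -(ν * ((∏ i ∈ range m, ((i : ℝ) + 1 + ν)) * ∏ i ∈ range m, ((i : ℝ) + 1 + -ν))) := by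
  obtain ⟨n, rfl⟩ := Nat.exists_eq_add_of_le hk
  have h1 : ∏ j ∈ (range (k + n + 1)).erase k, ((k : ℝ) - j) =
      k.factorial * ((-1) ^ n * n.factorial) := by
    have e : (range (k + n + 1)).erase k = range k ∪ Ico (k + 1) (k + n + 1) := by
      ext j; simp only [mem_erase, mem_range, mem_union, mem_Ico]; omega
    rw [e, prod_union (by
      rw [disjoint_left]; intro j; simp only [mem_range, mem_Ico]; omega)]
    congr 1
    · have := prod_range_sub_add k 0
      simp only [add_zero] at this
      rw [this, ← prod_range_add_one_eq_factorial]
      push_cast; rfl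
    · rw [prod_Ico_eq_prod_range, show k + n + 1 - (k + 1) = n by omega,
        ← prod_range_add_one_eq_factorial]
      push_cast
      rw [← card_range n, ← prod_const, card_range, ← prod_mul_distrib]
      refine prod_congr rfl fun i _ => ?_
      ring
  have h2 : ∏ j ∈ range (k + n + 1), ((k : ℝ) - (j + ν)) =
      (∏ i ∈ range k, ((i : ℝ) + 1 + -ν))
          * (-ν * ((-1) ^ n * ∏ i ∈ range n, ((i : ℝ) + 1 + ν))) := by
    rw [add_assoc, prod_range_add, ← prod_range_sub_add]
    congr 1
    · exact prod_congr rfl fun i _ => by ring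
    · rw [prod_range_succ', mul_comm, ← card_range n, ← prod_const, card_range, ← prod_mul_distrib]
      congr 1
      · push_cast; ring
      · refine prod_congr rfl fun i _ => ?_
        push_cast; ring
  have h3 : (∏ i ∈ range (k + n), ((i : ℝ) + 1 + ν)) = (∏ i ∈ range n, ((i : ℝ) + 1 + ν)) *
      (Ring.choose (((k + n : ℕ) : ℝ) + ν) k * k.factorial) := by
    rw [ring_choose_mul_factorial, add_comm k n, prod_range_add]
    congr 1
    have := prod_range_sub_add k (n + ν)
    push_cast
    rw [show ∏ i ∈ range k, ((n : ℝ) + k + ν - i) = ∏ i ∈ range k, ((k : ℝ) - i + (n + ν)) from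
      prod_congr rfl fun i _ => by ring, this]
    exact prod_congr rfl fun i _ => by ring
  have h4 : (∏ i ∈ range (k + n), ((i : ℝ) + 1 + -ν)) = (∏ i ∈ range k, ((i : ℝ) + 1 + -ν)) *
      (Ring.choose (((k + n : ℕ) : ℝ) - ν) n * n.factorial) := by
    rw [ring_choose_mul_factorial, prod_range_add]
    congr 1
    have := prod_range_sub_add n (k - ν)
    push_cast
    rw [show ∏ i ∈ range n, ((k : ℝ) + n - ν - i) = ∏ i ∈ range n, ((n : ℝ) - i + (k - ν)) from
      prod_congr rfl fun i _ => by ring, this]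
    exact prod_congr rfl fun i _ => by ring
  rw [padeCoeff, h1, h2, h3, h4, show k + n - k = n by omega]
  have h5 : ((-1 : ℝ) ^ n) * (-1) ^ n = 1 := by rw [← mul_pow]; norm_num
  linear_combination -(Ring.choose (((k + n : ℕ) : ℝ) + ν) k * Ring.choose
      (((k + n : ℕ) : ℝ) - ν) n * k.factorial * n.factorial * (∏ i ∈ range k, ((i : ℝ) + 1 + -ν))
          * ν * (∏ i ∈ range n, ((i : ℝ) + 1 + ν))) * h5

theorem padeCoeff_nonneg {ν : ℝ} (hν : |ν| < 1) {m k : ℕ} (hk : k ≤ m) : 0 ≤ padeCoeff ν m k := by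
  have key : ∀ {x : ℝ} {l : ℕ}, (l : ℝ) ≤ x + 1 → 0 ≤ Ring.choose x l := by
    intro x l h
    have h1 := ring_choose_mul_factorial x l
    have h2 : 0 ≤ ∏ i ∈ range l, (x - i) := by
      refine prod_nonneg fun i hi => ?_
      have : (i : ℝ) + 1 ≤ l := by exact_mod_cast mem_range.1 hi
      linarith
    rw [← h1] at h2
    exact nonneg_of_mul_nonneg_left h2 (by exact_mod_cast l.factorial_pos)
  have hν' := abs_lt.1 hν
  have hkm : (k : ℝ) ≤ m := by exact_mod_cast hk
  refine mul_nonneg (key (by linarith)) (key ?_)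
  have : ((m - k : ℕ) : ℝ) ≤ m := by exact_mod_cast Nat.sub_le m k
  linarith

theorem sum_padeCoeff (ν : ℝ) (m : ℕ) :
    ∑ k ∈ range (m + 1), padeCoeff ν m k = (2 * m).choose m := by
  have h := Ring.add_choose_eq (r := (m : ℝ) + ν) (s := (m : ℝ) - ν) m (Commute.all _ _)
  rw [Nat.sum_antidiagonal_eq_sum_range_succ_mk] at h
  rw [← Ring.choose_natCast (R := ℝ)]
  push_cast
  rw [show (2 * m : ℝ) = m + ν + (m - ν) by ring, h]
  rfl

/-- The numerator of the diagonal Padé approximant to `z ^ ν` at `1`. -/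
noncomputable def padeSum (ν : ℝ) (m : ℕ) (z : ℂ) : ℂ :=
  ∑ k ∈ range (m + 1), (padeCoeff ν m k : ℂ) * z ^ k

theorem norm_padeSum_le {ν : ℝ} (hν : |ν| < 1) (m : ℕ) {z : ℂ} (hz : ‖z‖ = 1) :
    ‖padeSum ν m z‖ ≤ 4 ^ m := by
  calc ‖padeSum ν m z‖ ≤ ∑ k ∈ range (m + 1), padeCoeff ν m k := by
        refine (norm_sum_le _ _).trans (sum_le_sum fun k hk => ?_)
        rw [norm_mul, norm_pow, hz, one_pow, mul_one, Complex.norm_real, Real.norm_eq_abs,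
          abs_of_nonneg (padeCoeff_nonneg hν (by have := mem_range.1 hk; omega))]
    _ = ((2 * m).choose m : ℝ) := sum_padeCoeff ν m
    _ ≤ 4 ^ m := by
      have := Nat.choose_le_two_pow (2 * m) m
      rw [pow_mul] at this
      exact_mod_cast this

end

section

open Finset

theorem padeSum_sub_eq {ν : ℝ} (hν : 0 < ν) (hν' : ν < 1) (m : ℕ) {τ : ℝ} :
    padeSum ν m (Complex.exp (-(τ * Complex.I))) - Complex.exp (-(τ * ν * Complex.I)) *
        padeSum (-ν) m (Complex.exp (-(τ * Complex.I))) =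
      -((ν * ((∏ i ∈ range m, ((i : ℝ) + 1 + ν)) * ∏ i ∈ range m, ((i : ℝ) + 1 + -ν)) : ℝ) : ℂ) *
      ∑ i ∈ (range (m + 1)).disjSum (range (m + 1)),
        Complex.exp (-(τ * (Sum.elim (fun k : ℕ => (k : ℝ)) (fun k : ℕ => k + ν) i : ℝ)
            * Complex.I)) /
        ((∏ j ∈ ((range (m + 1)).disjSum (range (m + 1))).erase i,
          (Sum.elim (fun k : ℕ => (k : ℝ)) (fun k : ℕ => k + ν) i -
            Sum.elim (fun k : ℕ => (k : ℝ)) (fun k : ℕ => k + ν) j) : ℝ) : ℂ) := by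
  have hne : ν * ((∏ i ∈ range m, ((i : ℝ) + 1 + ν)) * ∏ i ∈ range m, ((i : ℝ) + 1 + -ν)) ≠ 0 := by
    refine (mul_pos hν (mul_pos (prod_pos fun i _ => by positivity)
      (prod_pos fun i _ => ?_))).ne'
    have : (0 : ℝ) ≤ i := Nat.cast_nonneg i
    linarith
  have e1 : ∀ k : ℕ, ((range (m + 1)).disjSum (range (m + 1))).erase (Sum.inl k) =
      ((range (m + 1)).erase k).disjSum (range (m + 1)) := by
    intro k; ext (x | x) <;> simp
  have e2 : ∀ k : ℕ, ((range (m + 1)).disjSum (range (m + 1))).erase (Sum.inr k) =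
      (range (m + 1)).disjSum ((range (m + 1)).erase k) := by
    intro k; ext (x | x) <;> simp
  rw [sum_disjSum, mul_add, padeSum, padeSum, mul_sum, mul_sum, mul_sum, sub_eq_add_neg,
    ← sum_neg_distrib]
  congr 1
  · refine sum_congr rfl fun k hk => ?_
    have h := padeCoeff_mul_prod ν (m := m) (k := k) (by have := mem_range.1 hk; omega)
    simp only [e1, prod_disjSum, Sum.elim_inl, Sum.elim_inr]
    have h0 : (∏ j ∈ (range (m + 1)).erase k, ((k : ℝ) - j)) *
      ∏ j ∈ range (m + 1), ((k : ℝ) - (j + ν)) ≠ 0 := by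
      intro h0
      rw [h0, mul_zero] at h
      exact hne (neg_eq_zero.1 h.symm)
    generalize (∏ j ∈ (range (m + 1)).erase k, ((k : ℝ) - j)) *
      ∏ j ∈ range (m + 1), ((k : ℝ) - (j + ν)) = P at h h0
    rw [← Complex.ofReal_neg, ← h, ← Complex.exp_nat_mul]
    have h0' : (P : ℂ) ≠ 0 := Complex.ofReal_ne_zero.2 h0
    push_cast
    field_simp
  · refine sum_congr rfl fun k hk => ?_
    have h := padeCoeff_mul_prod (-ν) (m := m) (k := k) (by have := mem_range.1 hk; omega)
    simp only [e2, prod_disjSum, Sum.elim_inl, Sum.elim_inr]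
    have h1 : (∏ j ∈ range (m + 1), ((k : ℝ) + ν - j)) *
        ∏ j ∈ (range (m + 1)).erase k, ((k : ℝ) + ν - (j + ν)) =
        (∏ j ∈ (range (m + 1)).erase k, ((k : ℝ) - j)) *
      ∏ j ∈ range (m + 1), ((k : ℝ) - (j + -ν)) := by
      rw [mul_comm]
      congr 1 <;> exact prod_congr rfl fun j _ => by ring
    rw [h1]
    rw [neg_neg, mul_comm (∏ i ∈ range m, ((i : ℝ) + 1 + -ν)), neg_mul, neg_neg] at h
    have h0 : (∏ j ∈ (range (m + 1)).erase k, ((k : ℝ) - j)) *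
      ∏ j ∈ range (m + 1), ((k : ℝ) - (j + -ν)) ≠ 0 := by
      intro h0
      rw [h0, mul_zero] at h
      exact hne h.symm
    generalize (∏ j ∈ (range (m + 1)).erase k, ((k : ℝ) - j)) *
      ∏ j ∈ range (m + 1), ((k : ℝ) - (j + -ν)) = P at h h0
    rw [← h, ← Complex.exp_nat_mul]
    have h0' : (P : ℂ) ≠ 0 := Complex.ofReal_ne_zero.2 h0
    have h2 : Complex.exp (-(τ * ((k + ν : ℝ) : ℂ) * Complex.I)) =
        Complex.exp (-(τ * ν * Complex.I)) * Complex.exp (k * -(τ * Complex.I)) := by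
      rw [← Complex.exp_add]; push_cast; ring_nf
    rw [h2]
    push_cast
    field_simp

theorem norm_padeSum_sub_le {ν : ℝ} (hν : 0 < ν) (hν' : ν < 1) (m : ℕ) {τ : ℝ} (hτ : 0 ≤ τ) :
    ‖padeSum ν m (Complex.exp (-(τ * Complex.I))) - Complex.exp (-(τ * ν * Complex.I)) *
        padeSum (-ν) m (Complex.exp (-(τ * Complex.I)))‖ ≤ ν * τ * (τ / 2) ^ (2 * m) := by
  rw [padeSum_sub_eq hν hν', norm_mul, norm_neg, Complex.norm_real, Real.norm_eq_abs]
  have hinj : Set.InjOn (Sum.elim (fun k : ℕ => (k : ℝ)) (fun k : ℕ => k + ν))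
      ((range (m + 1)).disjSum (range (m + 1)) : Finset (ℕ ⊕ ℕ)) := by
    refine Function.Injective.injOn ?_
    have key : ∀ i j : ℕ, (i : ℝ) ≠ j + ν := by
      intro i j h
      have h1 : (j : ℝ) < i := by linarith
      have h2 : (i : ℝ) < j + 1 := by linarith
      norm_cast at h1 h2
      omega
    rintro (i | i) (j | j) h
    · simpa using h
    · exact (key _ _ h).elim
    · exact (key _ _ h.symm).elim
    · simpa using h
  have h1 := norm_sum_exp_div_prod_sub_le (n := 2 * m + 1) hinj
    (by rw [card_disjSum, card_range]; ring) hτ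
  have h2 : |ν * ((∏ i ∈ range m, ((i : ℝ) + 1 + ν)) * ∏ i ∈ range m, ((i : ℝ) + 1 + -ν))| ≤
      ν * (m.factorial : ℝ) ^ 2 := by
    rw [abs_mul, abs_of_pos hν, ← prod_mul_distrib, abs_prod]
    gcongr
    rw [← prod_range_add_one_eq_factorial]
    push_cast
    rw [← prod_pow]
    refine prod_le_prod (fun _ _ => abs_nonneg _) fun i _ => ?_
    have : (0 : ℝ) ≤ i := Nat.cast_nonneg i
    rw [abs_of_nonneg (mul_nonneg (by positivity) (by linarith))]
    linarith [sq_nonneg ν]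
  have h3 : (m.factorial : ℝ) ^ 2 * 4 ^ m ≤ (2 * m + 1).factorial := by
    have h4 := Nat.four_pow_le_two_mul_add_one_mul_central_binom m
    have h5 := Nat.choose_mul_factorial_mul_factorial (show m ≤ 2 * m by omega)
    rw [show 2 * m - m = m by omega] at h5
    have : m.factorial ^ 2 * 4 ^ m ≤ (2 * m + 1).factorial := by
      rw [Nat.factorial_succ, ← h5]
      calc m.factorial ^ 2 * 4 ^ m ≤ m.factorial ^ 2 * ((2 * m + 1) * m.centralBinom) :=
            Nat.mul_le_mul_left _ h4
        _ = _ := by rw [Nat.centralBinom]; ring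
    exact_mod_cast this
  refine (mul_le_mul h2 h1 (norm_nonneg _) (by positivity)).trans ?_
  rw [← mul_div_assoc, div_le_iff₀ (by positivity)]
  calc ν * (m.factorial : ℝ) ^ 2 * τ ^ (2 * m + 1) =
        ν * τ * (τ / 2) ^ (2 * m) * ((m.factorial : ℝ) ^ 2 * 4 ^ m) := by
        rw [div_pow, pow_mul (2 : ℝ)]
        norm_num
        field_simp
        ring
    _ ≤ _ := by gcongr

end

section

open Finset

theorem sum_padeCoeff_mul_choose (ν : ℝ) {m l : ℕ} (hl : l ≤ m) :
    ∑ k ∈ range (m + 1), padeCoeff ν m k * (k.choose l : ℝ) =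
      Ring.choose (m + ν) l * ((2 * m - l).choose m : ℝ) := by
  obtain ⟨n, rfl⟩ := Nat.exists_eq_add_of_le hl
  rw [add_assoc l n 1, sum_range_add, sum_eq_zero fun k hk => by
    rw [Nat.choose_eq_zero_of_lt (mem_range.1 hk), Nat.cast_zero, mul_zero], zero_add]
  have h := Ring.add_choose_eq (r := ((l + n : ℕ) : ℝ) + ν - l) (s := ((l + n : ℕ) : ℝ) - ν) n
    (Commute.all _ _)
  rw [Nat.sum_antidiagonal_eq_sum_range_succ_mk] at h
  rw [show 2 * (l + n) - l = l + 2 * n by omega,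
    ← Nat.choose_symm_of_eq_add (show l + 2 * n = n + (l + n) by ring),
    ← Ring.choose_natCast (R := ℝ) (l + 2 * n) n,
    show ((l + 2 * n : ℕ) : ℝ) = ((l + n : ℕ) : ℝ) + ν - l + (((l + n : ℕ) : ℝ) - ν) by
      push_cast; ring, h, mul_sum]
  refine sum_congr rfl fun j hj => ?_
  have h1 := Ring.choose_smul_choose (((l + n : ℕ) : ℝ) + ν) (show l ≤ l + j by omega)
  rw [nsmul_eq_mul, show l + j - l = j by omega] at h1
  rw [padeCoeff, show l + n - (l + j) = n - j by omega]
  linear_combination Ring.choose (((l + n : ℕ) : ℝ) - ν) (n - j) * h1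

theorem padeSum_one_add (ν : ℝ) (m : ℕ) (u : ℂ) :
    padeSum ν m (1 + u) = ∑ l ∈ range (m + 1),
      ((Ring.choose (m + ν) l * ((2 * m - l).choose m : ℝ) : ℝ) : ℂ) * u ^ l := by
  have h1 : ∀ k ∈ range (m + 1), (1 + u) ^ k = ∑ l ∈ range (m + 1), (k.choose l : ℂ) * u ^ l := by
    intro k hk
    have hk' := mem_range.1 hk
    rw [add_comm, add_pow, ← sum_subset (range_mono (by omega : k + 1 ≤ m + 1))]
    · exact sum_congr rfl fun l _ => by rw [one_pow, mul_one, mul_comm]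
    · intro l _ hl
      rw [Nat.choose_eq_zero_of_lt (by simpa using hl)]
      simp
  rw [padeSum, sum_congr rfl fun k hk => by rw [h1 k hk, mul_sum], sum_comm]
  refine sum_congr rfl fun l hl => ?_
  rw [← sum_padeCoeff_mul_choose ν (by have := mem_range.1 hl; omega), Complex.ofReal_sum, sum_mul]
  refine sum_congr rfl fun k _ => ?_
  push_cast
  ring

theorem factorial_dvd_two_pow_mul_prod (a : ℤ) (l : ℕ) :
    (l.factorial : ℤ) ∣ 2 ^ l * ∏ i ∈ range l, (a - 4 * i) := by
  obtain ⟨e, o, ho, hl⟩ := Nat.exists_eq_two_pow_mul_odd l.factorial_ne_zero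
  have he : e ≤ l := by
    have h1 : 2 ^ e ∣ l.factorial := Dvd.intro _ hl.symm
    rcases Nat.eq_zero_or_pos l with rfl | hl0
    · have h2 := Nat.le_of_dvd one_pos h1
      by_contra! h3
      have := Nat.one_lt_two_pow h3.ne'
      omega
    · have h2 := Nat.emultiplicity_two_factorial_lt hl0.ne'
      have h3 := (le_emultiplicity_of_pow_dvd h1).trans_lt h2
      exact_mod_cast h3.le
  rw [hl]
  push_cast
  refine mul_dvd_mul (pow_dvd_pow 2 he) ?_
  have hco : IsCoprime (4 : ℤ) o := by
    have : Nat.Coprime 4 o := by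
      rw [show 4 = 2 ^ 2 by norm_num]
      exact Nat.Coprime.pow_left 2 (Nat.coprime_two_left.2 ho)
    exact_mod_cast Nat.isCoprime_iff_coprime.2 this
  obtain ⟨c, d, hcd⟩ := hco
  have h1 : (l.factorial : ℤ) ∣ ∏ i ∈ range l, (c * a - i) := by
    have h : ∀ k : ℕ, (descPochhammer ℤ k).smeval (c * a) = ∏ i ∈ range k, (c * a - i) := by
      intro k
      induction k with
      | zero => simp
      | succ k ih =>
        rw [descPochhammer_succ_right, Polynomial.smeval_mul, ih, prod_range_succ,
          Polynomial.smeval_sub, Polynomial.smeval_X, Polynomial.smeval_natCast]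
        simp
    rw [← h, Ring.descPochhammer_eq_factorial_smul_choose, nsmul_eq_mul]
    exact dvd_mul_right _ _
  have h2 : (o : ℤ) ∣ ∏ i ∈ range l, (c * a - i) :=
    (Int.natCast_dvd_natCast.2 (Dvd.intro_left _ hl.symm)).trans h1
  have h3 : c ^ l * ∏ i ∈ range l, (a - 4 * i) ≡ ∏ i ∈ range l, (c * a - i) [ZMOD o] := by
    rw [← card_range l, ← prod_const, card_range, ← prod_mul_distrib]
    refine Int.ModEq.prod fun i _ => ?_
    rw [Int.modEq_iff_dvd]
    refine ⟨-(i * d), ?_⟩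
    linear_combination (i : ℤ) * hcd
  have h4 : (o : ℤ) ∣ c ^ l * ∏ i ∈ range l, (a - 4 * i) := h3.dvd_iff.2 h2
  have h5 : IsCoprime (o : ℤ) (c ^ l) := by
    refine IsCoprime.pow_right ⟨d, 4, ?_⟩
    linear_combination hcd
  exact h5.dvd_of_dvd_mul_left h4

theorem exists_int_eq_eight_pow_mul_choose (a : ℤ) (l : ℕ) :
    ∃ z : ℤ, (8 : ℝ) ^ l * Ring.choose ((a : ℝ) / 4) l = z := by
  obtain ⟨z, hz⟩ := factorial_dvd_two_pow_mul_prod a l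
  refine ⟨z, ?_⟩
  have h1 := ring_choose_mul_factorial ((a : ℝ) / 4) l
  have h2 : (4 : ℝ) ^ l * ∏ i ∈ range l, ((a : ℝ) / 4 - i) = ∏ i ∈ range l, ((a : ℝ) - 4 * i) := by
    rw [← card_range l, ← prod_const, card_range, ← prod_mul_distrib]
    exact prod_congr rfl fun i _ => by ring
  have h3 : (2 : ℝ) ^ l * ∏ i ∈ range l, ((a : ℝ) - 4 * i) = l.factorial * z := by
    exact_mod_cast hz
  have h4 : (l.factorial : ℝ) ≠ 0 := by exact_mod_cast l.factorial_ne_zero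
  apply mul_left_cancel₀ h4
  rw [← h3, ← h2, ← h1, show (8 : ℝ) = 2 * 4 by norm_num, mul_pow]
  ring

theorem mul_padeSum_mem_gaussianInt {ν : ℝ} {c : ℤ} (hν : ν = c / 4) (b m : ℕ) :
    (4 : ℂ) ^ m * (b + Complex.I) ^ m * padeSum ν m ((b - Complex.I) / (b + Complex.I)) ∈
      GaussianInt.toComplex.range := by
  have hI : Complex.I ∈ GaussianInt.toComplex.range := ⟨⟨0, 1⟩, by simp [GaussianInt.toComplex_def]⟩
  have hne : (b : ℂ) + Complex.I ≠ 0 := by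
    intro h
    have := congrArg Complex.im h
    simp at this
  have h1 : ((b : ℂ) - Complex.I) / (b + Complex.I) = 1 + (-2 * Complex.I) / (b + Complex.I) := by
    field_simp; ring
  rw [h1, padeSum_one_add, mul_sum]
  refine sum_mem fun l hl => ?_
  obtain ⟨n, rfl⟩ := Nat.exists_eq_add_of_le (by have := mem_range.1 hl; omega : l ≤ m)
  obtain ⟨z, hz⟩ := exists_int_eq_eight_pow_mul_choose (4 * (l + n : ℕ) + c) l
  have hz' : (8 : ℂ) ^ l * ((Ring.choose (((l + n : ℕ) : ℝ) + ν) l : ℝ) : ℂ) = z := by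
    rw [hν, show (((l + n : ℕ) : ℝ) + c / 4) = ((4 * (l + n : ℕ) + c : ℤ) : ℝ) / 4 by
      push_cast; ring]
    exact_mod_cast congrArg (fun x : ℝ => (x : ℂ)) hz
  have h2 : (4 : ℂ) ^ (l + n) * (b + Complex.I) ^ (l + n) *
      (((Ring.choose (((l + n : ℕ) : ℝ) + ν) l * ((2 * (l + n) - l).choose (l + n) : ℝ) : ℝ) : ℂ) *
        (-2 * Complex.I / (b + Complex.I)) ^ l) =
      z * ((2 * (l + n) - l).choose (l + n) : ℕ) * (-Complex.I) ^ l
          * ((4 : ℕ) * (b + Complex.I)) ^ n := by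
    rw [← hz', div_pow, mul_pow ((4 : ℕ) : ℂ), pow_add, pow_add, Complex.ofReal_mul,
      show (-2 * Complex.I : ℂ) = 2 * -Complex.I by ring, mul_pow,
      show (8 : ℂ) = 2 * 4 by norm_num, mul_pow]
    field_simp
    push_cast
    ring
  rw [h2]
  exact mul_mem (mul_mem (mul_mem (intCast_mem _ _) (natCast_mem _ _)) (pow_mem (neg_mem hI) _))
    (pow_mem (mul_mem (natCast_mem _ _) (add_mem (natCast_mem _ _) hI)) _)

end

section

open Finset Polynomial Filter Topology

theorem X_sub_C_pow_dvd_of_norm_eval_le {α : Type*} {l : Filter α} [l.NeBot] {z : α → ℂ} {a : ℂ}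
    (hz : Tendsto z l (𝓝 a)) (hza : ∀ᶠ t in l, z t ≠ a) {P : ℂ[X]} {n : ℕ} {c : ℝ}
    (hP : ∀ᶠ t in l, ‖P.eval (z t)‖ ≤ c * ‖z t - a‖ ^ n) : (X - C a) ^ n ∣ P := by
  rcases eq_or_ne P 0 with rfl | hP0
  · exact dvd_zero _
  obtain ⟨q, hq, hqa⟩ := exists_eq_pow_rootMultiplicity_mul_and_not_dvd P hP0 a
  set k := P.rootMultiplicity a
  rcases le_or_gt n k with h | h
  · rw [hq]; exact (pow_dvd_pow _ h).mul_right _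
  exfalso
  rw [dvd_iff_isRoot, IsRoot.def] at hqa
  have h1 : Tendsto (fun t => ‖q.eval (z t)‖) l (𝓝 ‖q.eval a‖) :=
    ((q.continuous.tendsto a).comp hz).norm
  have h2 : Tendsto (fun t => c * ‖z t - a‖ ^ (n - k)) l (𝓝 (c * ‖a - a‖ ^ (n - k))) :=
    (((hz.sub_const a).norm).pow _).const_mul _
  rw [sub_self, norm_zero, zero_pow (by omega), mul_zero] at h2
  have h3 := le_of_tendsto_of_tendsto h1 h2 (by
    filter_upwards [hza, hP] with t ht1 ht2
    have h4 : 0 < ‖z t - a‖ ^ k := pow_pos (norm_pos_iff.2 (sub_ne_zero.2 ht1)) _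
    rw [hq, eval_mul, eval_pow, eval_sub, eval_X, eval_C, norm_mul, norm_pow,
      show n = k + (n - k) by omega, pow_add, mul_left_comm] at ht2
    simpa using le_of_mul_le_mul_left ht2 h4)
  exact hqa (norm_le_zero_iff.1 h3)

/-- `padeSum` as a polynomial. -/
noncomputable def padePoly (ν : ℝ) (m : ℕ) : ℂ[X] :=
  ∑ k ∈ range (m + 1), C (padeCoeff ν m k : ℂ) * X ^ k

theorem eval_padePoly (ν : ℝ) (m : ℕ) (z : ℂ) : (padePoly ν m).eval z = padeSum ν m z := by
  simp [padePoly, padeSum, eval_finsetSum]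

theorem natDegree_padePoly_le (ν : ℝ) (m : ℕ) : (padePoly ν m).natDegree ≤ m := by
  refine natDegree_sum_le_of_forall_le _ _ fun k hk => ?_
  exact (natDegree_C_mul_X_pow_le _ _).trans (by have := mem_range.1 hk; omega)

theorem coeff_padePoly_self (ν : ℝ) (m : ℕ) :
    (padePoly ν m).coeff m = (Ring.choose (m + ν) m : ℝ) := by
  rw [padePoly, finsetSum_coeff, sum_eq_single m]
  · simp [padeCoeff]
  · intro k _ hk
    rw [coeff_C_mul_X_pow, if_neg hk.symm]
  · simp

theorem ring_choose_add_one_mul (x : ℝ) (m : ℕ) :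
    Ring.choose (x + 1) (m + 1) * (m + 1) = Ring.choose x m * (x + 1) := by
  have h1 := ring_choose_mul_factorial (x + 1) (m + 1)
  have h2 := ring_choose_mul_factorial x m
  have h0 : (m.factorial : ℝ) ≠ 0 := by exact_mod_cast m.factorial_ne_zero
  rw [prod_range_succ', show ∏ i ∈ range m, (x + 1 - ((i + 1 : ℕ) : ℝ)) =
      ∏ i ∈ range m, (x - i) from
    prod_congr rfl fun i _ => by push_cast; ring, ← h2, Nat.factorial_succ] at h1
  push_cast at h1
  apply mul_right_cancel₀ h0
  linear_combination h1

theorem ring_choose_add_pos {ν : ℝ} (hν : |ν| < 1) (m : ℕ) : 0 < Ring.choose (m + ν) m := by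
  have h1 := ring_choose_mul_factorial (m + ν) m
  have h2 : 0 < ∏ i ∈ range m, ((m : ℝ) + ν - i) := by
    refine prod_pos fun i hi => ?_
    have : (i : ℝ) + 1 ≤ m := by exact_mod_cast mem_range.1 hi
    linarith [(abs_lt.1 hν).1]
  rw [← h1] at h2
  exact pos_of_mul_pos_left h2 (by positivity)

theorem half_le_norm_exp_sub_one {τ : ℝ} (hτ : 0 ≤ τ) (hτ' : τ ≤ 1) :
    τ / 2 ≤ ‖Complex.exp (-(τ * Complex.I)) - 1‖ := by
  have h1 := Complex.norm_exp_I_mul_ofReal_sub_one (x := -τ)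
  rw [show Complex.I * ((-τ : ℝ) : ℂ) = -(τ * Complex.I) by push_cast; ring] at h1
  have h3 := Real.mul_le_sin (x := τ / 2) (by linarith) (by linarith [Real.pi_gt_three])
  rw [h1, show -τ / 2 = -(τ / 2) by ring, Real.sin_neg, mul_neg, norm_neg, Real.norm_eq_abs]
  refine le_trans ?_ (le_abs_self _)
  have h4 : τ / 4 ≤ 2 / Real.pi * (τ / 2) := by
    rw [div_mul_div_comm, div_le_div_iff₀ (by norm_num) (by positivity)]
    have := mul_le_mul_of_nonneg_left Real.pi_lt_four.le hτ
    linarith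
  linarith

theorem padeSum_mul_padeSum_ne {ν : ℝ} (hν : 0 < ν) (hν' : ν < 1) (m : ℕ) {z : ℂ} (hz : z ≠ 1) :
    padeSum ν m z * padeSum (-ν) (m + 1) z - padeSum ν (m + 1) z * padeSum (-ν) m z ≠ 0 := by
  have ha : |ν| < 1 := by rwa [abs_of_pos hν]
  have ha' : |-ν| < 1 := by rwa [abs_neg]
  set D := padePoly ν m * padePoly (-ν) (m + 1) - padePoly ν (m + 1) * padePoly (-ν) m with hD
  have hDeval : ∀ z, D.eval z =
      padeSum ν m z * padeSum (-ν) (m + 1) z - padeSum ν (m + 1) z * padeSum (-ν) m z := by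
    intro z; simp only [hD, eval_sub, eval_mul, eval_padePoly]
  have hdeg : D.natDegree ≤ 2 * m + 1 := by
    refine (natDegree_sub_le _ _).trans (max_le ?_ ?_)
    · refine natDegree_mul_le.trans ?_
      have := natDegree_padePoly_le ν m
      have := natDegree_padePoly_le (-ν) (m + 1)
      omega
    · refine natDegree_mul_le.trans ?_
      have := natDegree_padePoly_le (-ν) m
      have := natDegree_padePoly_le ν (m + 1)
      omega
  have hcoeff : D.coeff (m + (m + 1)) ≠ 0 := by
    rw [hD, coeff_sub, coeff_mul_add_eq_of_natDegree_le (natDegree_padePoly_le _ _)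
      (natDegree_padePoly_le _ _), add_comm m (m + 1), coeff_mul_add_eq_of_natDegree_le
      (natDegree_padePoly_le _ _) (natDegree_padePoly_le _ _)]
    simp only [coeff_padePoly_self]
    rw [← Complex.ofReal_mul, ← Complex.ofReal_mul, ← Complex.ofReal_sub, Complex.ofReal_ne_zero]
    have h1 := ring_choose_add_one_mul (m + ν) m
    have h2 := ring_choose_add_one_mul (m + -ν) m
    have h3 := ring_choose_add_pos ha m
    have h4 := ring_choose_add_pos ha' m
    push_cast
    rw [add_right_comm (m : ℝ) 1 ν, add_right_comm (m : ℝ) 1 (-ν)]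
    intro h5
    have h6 : Ring.choose (m + ν) m * Ring.choose (m + -ν) m * (-2 * ν) = 0 := by
      linear_combination (m + 1) * h5 - Ring.choose ((m : ℝ) + ν) m * h2 +
        Ring.choose ((m : ℝ) + -ν) m * h1
    have h7 : 0 < Ring.choose (m + ν) m * Ring.choose (m + -ν) m * ν := by positivity
    linarith
  have hdvd : (X - C 1) ^ (2 * m + 1) ∣ D := by
    have hcont : Tendsto (fun τ : ℝ => Complex.exp (-(τ * Complex.I))) (𝓝[>] 0) (𝓝 1) := by
      have : Continuous fun τ : ℝ => Complex.exp (-(τ * Complex.I)) := by fun_prop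
      have h := this.tendsto 0
      simp only [Complex.ofReal_zero, zero_mul, neg_zero, Complex.exp_zero] at h
      exact h.mono_left nhdsWithin_le_nhds
    have hev : ∀ᶠ τ : ℝ in 𝓝[>] 0, τ ∈ Set.Ioo (0 : ℝ) 1 := Ioo_mem_nhdsGT one_pos
    refine X_sub_C_pow_dvd_of_norm_eval_le (c := 2 * 4 ^ (m + 1) * 2 ^ (2 * m + 1)) hcont ?_ ?_
    · filter_upwards [hev] with τ hτ h
      have := half_le_norm_exp_sub_one hτ.1.le hτ.2.le
      rw [h, sub_self, norm_zero] at this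
      linarith [hτ.1]
    · filter_upwards [hev] with τ hτ
      have hτ0 := hτ.1.le
      have hτ1 := hτ.2.le
      have e1 := half_le_norm_exp_sub_one hτ0 hτ1
      have r1 := norm_padeSum_sub_le hν hν' m hτ0
      have r2 := norm_padeSum_sub_le hν hν' (m + 1) hτ0
      have hunit : ‖Complex.exp (-(τ * Complex.I))‖ = 1 := by simp [Complex.norm_exp]
      have b1 := norm_padeSum_le ha' m hunit
      have b2 := norm_padeSum_le ha' (m + 1) hunit
      rw [hDeval]
      generalize Complex.exp (-(τ * ν * Complex.I)) = y at r1 r2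
      generalize Complex.exp (-(τ * Complex.I)) = z at e1 r1 r2 b1 b2
      have id1 : padeSum ν m z * padeSum (-ν) (m + 1) z - padeSum ν (m + 1) z * padeSum (-ν) m z =
        (padeSum ν m z - y * padeSum (-ν) m z) * padeSum (-ν) (m + 1) z -
          (padeSum ν (m + 1) z - y * padeSum (-ν) (m + 1) z) * padeSum (-ν) m z := by ring
      have r1' : ‖padeSum ν m z - y * padeSum (-ν) m z‖ ≤ τ ^ (2 * m + 1) := by
        refine r1.trans ?_
        calc ν * τ * (τ / 2) ^ (2 * m) ≤ 1 * τ * τ ^ (2 * m) := by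
              gcongr; linarith
          _ = _ := by ring
      have r2' : ‖padeSum ν (m + 1) z - y * padeSum (-ν) (m + 1) z‖ ≤ τ ^ (2 * m + 1) := by
        refine r2.trans ?_
        calc ν * τ * (τ / 2) ^ (2 * (m + 1)) ≤ 1 * τ * τ ^ (2 * (m + 1)) := by
              gcongr; linarith
          _ = τ ^ (2 * m + 1) * τ ^ 2 := by ring
          _ ≤ τ ^ (2 * m + 1) * 1 := by gcongr; exact pow_le_one₀ hτ0 hτ1
          _ = _ := mul_one _
      have b1' : ‖padeSum (-ν) m z‖ ≤ 4 ^ (m + 1) :=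
        b1.trans (pow_le_pow_right₀ (by norm_num) (by omega))
      rw [id1]
      calc _ ≤ τ ^ (2 * m + 1) * 4 ^ (m + 1) + τ ^ (2 * m + 1) * 4 ^ (m + 1) := by
            refine (norm_sub_le _ _).trans ?_
            rw [norm_mul, norm_mul]
            gcongr
        _ = 2 * 4 ^ (m + 1) * 2 ^ (2 * m + 1) * (τ / 2) ^ (2 * m + 1) := by
            rw [div_pow]; field_simp; ring
        _ ≤ _ := by gcongr
  obtain ⟨q, hq⟩ := hdvd
  have hD0 : D ≠ 0 := fun h => hcoeff (by rw [h, coeff_zero])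
  have hq0 : q ≠ 0 := fun h => hD0 (by rw [hq, h, mul_zero])
  have hqdeg : q.natDegree = 0 := by
    have h1 := congrArg natDegree hq
    rw [natDegree_mul (pow_ne_zero _ (X_sub_C_ne_zero 1)) hq0, natDegree_pow,
        natDegree_X_sub_C] at h1
    omega
  rw [← hDeval, hq, eq_C_of_natDegree_eq_zero hqdeg]
  simp only [eval_mul, eval_pow, eval_sub, eval_X, eval_C]
  refine mul_ne_zero (pow_ne_zero _ (sub_ne_zero.2 hz)) fun h => hq0 ?_
  rw [eq_C_of_natDegree_eq_zero hqdeg, h, C_0]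

end

theorem one_le_norm_of_mem_gaussianInt {z : ℂ} (hz : z ∈ GaussianInt.toComplex.range) (h0 : z ≠ 0) :
    1 ≤ ‖z‖ := by
  obtain ⟨w, rfl⟩ := hz
  have h1 : Complex.normSq (GaussianInt.toComplex w) = ((w.re ^ 2 + w.im ^ 2 : ℤ) : ℝ) := by
    rw [Complex.normSq_apply, ← GaussianInt.intCast_re, ← GaussianInt.intCast_im]
    push_cast; ring
  have h2 := Complex.normSq_pos.2 h0
  rw [h1] at h2
  have h3 : (1 : ℝ) ≤ ((w.re ^ 2 + w.im ^ 2 : ℤ) : ℝ) := by exact_mod_cast h2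
  rw [← h1, Complex.normSq_eq_norm_sq] at h3
  exact (one_le_sq_iff₀ (norm_nonneg _)).1 h3

theorem norm_mul_padeSum_sub_le {ν : ℝ} (hν : 0 < ν) (hν' : ν < 1) (m : ℕ) {τ : ℝ} (hτ : 0 ≤ τ)
    (g : ℂ) :
    ‖g * padeSum ν m (Complex.exp (-(τ * Complex.I))) - (starRingEnd ℂ) g *
        padeSum (-ν) m (Complex.exp (-(τ * Complex.I)))‖ ≤ ‖g‖ * (ν * τ * (τ / 2) ^ (2 * m)) +
      4 ^ m * (2 * |(g * Complex.exp (-((ν * τ / 2 : ℝ) * Complex.I))).im|) := by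
  have r1 := norm_padeSum_sub_le hν hν' m hτ
  have hunit : ‖Complex.exp (-(τ * Complex.I))‖ = 1 := by simp [Complex.norm_exp]
  have b1 := norm_padeSum_le (ν := -ν) (by rwa [abs_neg, abs_of_pos hν]) m hunit
  set w := Complex.exp (-((ν * τ / 2 : ℝ) * Complex.I)) with hw
  have hw2 : Complex.exp (-(τ * ν * Complex.I)) = w * w := by
    rw [hw, ← Complex.exp_add]; push_cast; ring_nf
  have hw1 : w * (starRingEnd ℂ) w = 1 := by
    rw [hw, ← Complex.exp_conj, ← Complex.exp_add, map_neg, map_mul, Complex.conj_ofReal,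
      Complex.conj_I, mul_neg, neg_neg, neg_add_cancel, Complex.exp_zero]
  have hwn : ‖w‖ = 1 := by simp [hw, Complex.norm_exp]
  have h1 : ‖g * (w * w) - (starRingEnd ℂ) g‖ = 2 * |(g * w).im| := by
    have : g * (w * w) - (starRingEnd ℂ) g = w * (g * w - (starRingEnd ℂ) (g * w)) := by
      rw [map_mul]; linear_combination (starRingEnd ℂ) g * hw1
    rw [this, norm_mul, hwn, one_mul, Complex.sub_conj, norm_mul, Complex.norm_I, mul_one,
      Complex.norm_real, Real.norm_eq_abs, abs_mul, abs_two]
  rw [hw2] at r1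
  generalize Complex.exp (-(τ * Complex.I)) = z at *
  calc _ = ‖g * (padeSum ν m z - w * w * padeSum (-ν) m z) +
        padeSum (-ν) m z * (g * (w * w) - (starRingEnd ℂ) g)‖ := by ring_nf
    _ ≤ _ := by
      refine (norm_add_le _ _).trans ?_
      rw [norm_mul, norm_mul, h1]
      gcongr

theorem sqrt_le_of_forty_four_le {b : ℝ} (hb : 44 ≤ b) : √(b ^ 2 + 1) ≤ 1.001 * b := by
  rw [Real.sqrt_le_left (by positivity)]
  nlinarith

theorem natCast_add_I_eq (b : ℕ) (hb : 0 < b) :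
    (b : ℂ) + Complex.I = √((b : ℝ) ^ 2 + 1) * Complex.exp
        ((Real.arctan (1 / b) : ℝ) * Complex.I) := by
  have hb' : (0 : ℝ) < b := by exact_mod_cast hb
  have h0 : (0 : ℝ) < √((b : ℝ) ^ 2 + 1) := by positivity
  have hs : √(1 + (1 / (b : ℝ)) ^ 2) = √((b : ℝ) ^ 2 + 1) / b := by
    rw [eq_div_iff hb'.ne', ← Real.sqrt_sq hb'.le, ← Real.sqrt_mul (by positivity),
        Real.sqrt_sq hb'.le]
    congr 1
    field_simp
  rw [Complex.exp_mul_I, ← Complex.ofReal_cos, ← Complex.ofReal_sin, Real.cos_arctan,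
    Real.sin_arctan, hs]
  have h1 : √((b : ℝ) ^ 2 + 1) * (1 / (√((b : ℝ) ^ 2 + 1) / b)) = b := by field_simp
  have h2 : √((b : ℝ) ^ 2 + 1) * (1 / b / (√((b : ℝ) ^ 2 + 1) / b)) = 1 := by field_simp
  rw [mul_add, ← mul_assoc, ← Complex.ofReal_mul, ← Complex.ofReal_mul, h1, h2,
    Complex.ofReal_natCast, Complex.ofReal_one, one_mul]

theorem natCast_sub_I_div (b : ℕ) (hb : 0 < b) :
    ((b : ℂ) - Complex.I) / (b + Complex.I) =
      Complex.exp (-(((2 * Real.arctan (1 / b) : ℝ) : ℂ) * Complex.I)) := by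
  have h1 := natCast_add_I_eq b hb
  have h2 := congrArg (starRingEnd ℂ) h1
  rw [map_add, map_mul, ← Complex.exp_conj, map_mul, Complex.conj_I, Complex.conj_ofReal,
    Complex.conj_ofReal, Complex.conj_natCast, ← sub_eq_add_neg] at h2
  have h0 : (√((b : ℝ) ^ 2 + 1) : ℂ) ≠ 0 := by
    rw [Complex.ofReal_ne_zero]; positivity
  rw [h1, h2, mul_div_mul_left _ _ h0, ← Complex.exp_sub]
  push_cast
  ring_nf

theorem arctan_inv_le {b : ℝ} (hb : 0 < b) : Real.arctan (1 / b) ≤ 1 / b := by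
  have h1 : 0 ≤ Real.arctan (1 / b) := Real.arctan_nonneg.2 (by positivity)
  have h2 := Real.le_tan h1 (Real.arctan_lt_pi_div_two _)
  rwa [Real.tan_arctan] at h2

theorem not_gaussianInt_near {b : ℕ} (hb : 44 ≤ b) {g : ℂ} (hg : g ∈ GaussianInt.toComplex.range)
    (hgb : b ≤ ‖g‖) (hnear : |(g * Complex.exp (-((Real.arctan (1 / b) / 4 : ℝ) * Complex.I))).im| *
      (√((b : ℝ) ^ 2 + 1) * ‖g‖ ^ 3) ≤ 8 / 5) : False := by
  have hbR : (44 : ℝ) ≤ b := by exact_mod_cast hb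
  have hb0 : (0 : ℝ) < b := by linarith
  have hφ := arctan_inv_le hb0
  have hφ0 : 0 ≤ Real.arctan (1 / b) := Real.arctan_nonneg.2 (by positivity)
  have hω := natCast_sub_I_div b (by omega)
  have hs0 : 0 < √((b : ℝ) ^ 2 + 1) := by positivity
  have hs := sqrt_le_of_forty_four_le hbR
  have hnorm : ‖(b : ℂ) + Complex.I‖ = √((b : ℝ) ^ 2 + 1) := by
    rw [natCast_add_I_eq b (by omega), norm_mul, Complex.norm_exp_ofReal_mul_I, mul_one,
      Complex.norm_real, Real.norm_of_nonneg hs0.le]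
  have hne : (b : ℂ) + Complex.I ≠ 0 := by
    rw [← norm_pos_iff, hnorm]; exact hs0
  set φ := Real.arctan (1 / b)
  set S := √((b : ℝ) ^ 2 + 1)
  set Y := |(g * Complex.exp (-((φ / 4 : ℝ) * Complex.I))).im|
  set G := ‖g‖
  set z := ((b : ℂ) - Complex.I) / (b + Complex.I)
  have hG0 : 0 < G := hb0.trans_le hgb
  set J : ℕ → ℂ := fun m => g * padeSum (1 / 4) m z - (starRingEnd ℂ) g * padeSum (-(1 / 4)) m z
    with hJ
  have hJle : ∀ m, ‖J m‖ ≤ G * (φ / 2 * (φ ^ 2) ^ m) + 4 ^ m * (2 * Y) := by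
    intro m
    have h := norm_mul_padeSum_sub_le (ν := 1 / 4) (by norm_num) (by norm_num) m
      (τ := 2 * φ) (by positivity) g
    rw [← hω, show (1 / 4 * (2 * φ) / 2 : ℝ) = φ / 4 by ring,
      show (1 / 4 * (2 * φ) : ℝ) = φ / 2 by ring, show 2 * φ / 2 = φ by ring, pow_mul] at h
    exact h
  have hmem : ∀ m, (4 : ℂ) ^ m * (b + Complex.I) ^ m * J m ∈ GaussianInt.toComplex.range := by
    intro m
    have hgc : (starRingEnd ℂ) g ∈ GaussianInt.toComplex.range := by
      obtain ⟨w, rfl⟩ := hg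
      exact ⟨star w, GaussianInt.toComplex_star w⟩
    have h1 := mul_padeSum_mem_gaussianInt (ν := 1 / 4) (c := 1) (by norm_num) b m
    have h2 := mul_padeSum_mem_gaussianInt (ν := -(1 / 4)) (c := -1) (by norm_num) b m
    have h3 := sub_mem (mul_mem hg h1) (mul_mem hgc h2)
    refine (congrArg (· ∈ GaussianInt.toComplex.range) ?_).mp h3
    simp only [hJ]
    ring
  have hzero : ∀ m, (4 * S) ^ m * (G * (φ / 2 * (φ ^ 2) ^ m) + 4 ^ m * (2 * Y)) < 1 → J m = 0 := by
    intro m hm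
    by_contra hJ0
    have h1 := one_le_norm_of_mem_gaussianInt (hmem m)
      (mul_ne_zero (mul_ne_zero (pow_ne_zero _ (by norm_num)) (pow_ne_zero _ hne)) hJ0)
    rw [norm_mul, norm_mul, norm_pow, norm_pow, hnorm, ← mul_pow] at h1
    have h2 : ‖(4 : ℂ)‖ = 4 := by norm_num
    rw [h2] at h1
    have h3 := mul_le_mul_of_nonneg_left (hJle m) (by positivity : 0 ≤ (4 * S) ^ m)
    linarith
  have hb1 : 1 < (b : ℝ) / 4.05 := by
    rw [lt_div_iff₀ (by norm_num)]; linarith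
  obtain ⟨n, hn1, hn2⟩ := exists_nat_pow_near (x := G / b) ((one_le_div hb0).2 hgb) hb1
  have hfirst : ∀ m, (4 * S) ^ m * (G * (φ / 2 * (φ ^ 2) ^ m)) ≤ G / b / 2 * (4.05 / b) ^ m := by
    intro m
    have h1 : 4 * S * φ ^ 2 ≤ 4.05 / b := by
      calc 4 * S * φ ^ 2 ≤ 4 * (1.001 * (b : ℝ)) * (1 / (b : ℝ)) ^ 2 := by gcongr
        _ = 4.004 / (b : ℝ) := by field_simp; norm_num
        _ ≤ _ := by gcongr; norm_num
    calc (4 * S) ^ m * (G * (φ / 2 * (φ ^ 2) ^ m)) = G * φ / 2 * (4 * S * φ ^ 2) ^ m := by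
          rw [mul_pow (4 * S)]; ring
      _ ≤ G * (1 / b) / 2 * (4.05 / b) ^ m := by gcongr
      _ = _ := by ring
  have hq : (16 * S) ^ n / (G ^ 3) ≤ 1 / (b : ℝ) ^ 3 := by
    rw [div_le_div_iff₀ (by positivity) (by positivity), one_mul]
    have h1 : 16 * S ≤ ((b : ℝ) / 4.05) ^ 3 := by
      have : (44 : ℝ) ^ 2 * b ≤ b ^ 3 := by
        have := pow_le_pow_left₀ (by norm_num) hbR 2
        nlinarith
      rw [div_pow, le_div_iff₀ (by norm_num)]
      norm_num at hs ⊢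
      linarith
    calc (16 * S) ^ n * (b : ℝ) ^ 3 ≤ (((b : ℝ) / 4.05) ^ 3) ^ n * b ^ 3 := by gcongr
      _ = ((((b : ℝ) / 4.05) ^ n) * b) ^ 3 := by rw [mul_pow, ← pow_mul, ← pow_mul, mul_comm 3 n]
      _ ≤ G ^ 3 := by
        gcongr
        rwa [le_div_iff₀ hb0] at hn1
  have hY : Y ≤ 8 / 5 / (S * G ^ 3) := by
    rwa [le_div_iff₀ (by positivity)]
  have hsecond : ∀ k, (4 * S) ^ (n + k) * (4 ^ (n + k) * (2 * Y)) ≤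
      16 / 5 * (16 * S) ^ k / (S * b ^ 3) := by
    intro k
    calc (4 * S) ^ (n + k) * (4 ^ (n + k) * (2 * Y)) = 2 * (16 * S) ^ (n + k) * Y := by
          rw [show 16 * S = 4 * S * 4 by ring, mul_pow (4 * S) 4]; ring
      _ ≤ 2 * (16 * S) ^ (n + k) * (8 / 5 / (S * G ^ 3)) := by gcongr
      _ = 16 / 5 * (16 * S) ^ k / S * ((16 * S) ^ n / G ^ 3) := by
          rw [pow_add]; field_simp; norm_num
      _ ≤ 16 / 5 * (16 * S) ^ k / S * (1 / b ^ 3) := by gcongr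
      _ = _ := by field_simp
  have hpe : ((b : ℝ) / 4.05) ^ (n + 1) * (4.05 / b) ^ (n + 1) = 1 := by
    rw [← mul_pow, div_mul_div_comm, mul_comm (4.05 : ℝ), div_self (by positivity), one_pow]
  have hE0 : (0 : ℝ) < (4.05 / b) ^ (n + 1) := by positivity
  have hlt := mul_lt_mul_of_pos_right hn2 hE0
  rw [hpe] at hlt
  have hz1 : J (n + 1) = 0 := by
    apply hzero
    have h1 := hfirst (n + 1)
    have h2 := hsecond 1
    have h3 : 16 / 5 * (16 * S) ^ 1 / (S * (b : ℝ) ^ 3) ≤ 1 / 4 := by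
      rw [div_le_iff₀ (by positivity)]
      have : (44 : ℝ) ^ 3 ≤ b ^ 3 := pow_le_pow_left₀ (by norm_num) hbR 3
      have := mul_le_mul_of_nonneg_left this hs0.le
      linarith
    rw [mul_add]
    linarith
  have hz2 : J (n + 1 + 1) = 0 := by
    apply hzero
    have h1 := hfirst (n + 1 + 1)
    have h2 : (4 * S) ^ (n + 1 + 1) * (4 ^ (n + 1 + 1) * (2 * Y)) ≤ _ := hsecond 2
    rw [pow_succ (4.05 / (b : ℝ)) (n + 1), ← mul_assoc] at h1
    have h4 : (4.05 : ℝ) / b ≤ 1 / 10 := by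
      rw [div_le_iff₀ hb0]; linarith
    have h5 : G / b / 2 * (4.05 / b) ^ (n + 1) * (4.05 / b) ≤ 1 / 2 * (1 / 10) := by
      gcongr
      linarith
    have h3 : 16 / 5 * (16 * S) ^ 2 / (S * (b : ℝ) ^ 3) ≤ 1 / 2 := by
      rw [div_le_iff₀ (by positivity)]
      have h6 : (44 : ℝ) ^ 2 * b ≤ b ^ 3 := by
        have := pow_le_pow_left₀ (by norm_num) hbR 2
        nlinarith
      have h7 : 16 / 5 * 256 * S ≤ 1 / 2 * b ^ 3 := by
        norm_num at hs ⊢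
        linarith
      have := mul_le_mul_of_nonneg_left h7 hs0.le
      linarith
    rw [mul_add]
    linarith
  have hz : z ≠ 1 := by
    intro h
    rw [div_eq_one_iff_eq hne] at h
    have := congrArg Complex.im h
    norm_num at this
  refine padeSum_mul_padeSum_ne (ν := 1 / 4) (by norm_num) (by norm_num) (n + 1) hz ?_
  have hg0 : g ≠ 0 := norm_pos_iff.1 hG0
  apply mul_left_cancel₀ hg0
  simp only [hJ] at hz1 hz2
  linear_combination padeSum (-(1 / 4)) (n + 1 + 1) z * hz1 - padeSum (-(1 / 4)) (n + 1) z * hz2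

theorem im_pow_four (z : ℂ) : (z ^ 4).im = 4 * (z.re * z.im * (z.re ^ 2 - z.im ^ 2)) := by
  rw [show z ^ 4 = (z * z) * (z * z) by ring]
  simp only [Complex.mul_im, Complex.mul_re]
  ring

theorem abs_add_le_of_mul_nonpos {x y : ℝ} (h : x * y ≤ 0) (h1 : 0.42 * |x| ≤ |y|)
    (h2 : 0.42 * |y| ≤ |x|) : |x + y| ≤ 0.42 * |x - y| := by
  have hxy : |x| * |y| = -(x * y) := by rw [← abs_mul, abs_of_nonpos h]
  have hx := abs_nonneg x
  have hy := abs_nonneg y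
  have h3 := mul_nonneg (by linarith : 0 ≤ 1.42 * |y| - 0.58 * |x|)
    (by linarith : 0 ≤ 1.42 * |x| - 0.58 * |y|)
  refine abs_le_of_sq_le_sq' ?_ (by positivity) |> abs_le.2
  rw [mul_pow, sq_abs]
  nlinarith [sq_abs x, sq_abs y]

theorem exists_gaussianInt_mul_near_real (z : ℂ) :
    ∃ h : GaussianInt, 1 ≤ ‖GaussianInt.toComplex h‖ ∧
      |(GaussianInt.toComplex h * z).im| ≤ 0.42 * |(GaussianInt.toComplex h * z).re| ∧
      |((GaussianInt.toComplex h * z) ^ 4).im| ≤ 4 * |(z ^ 4).im| := by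
  have key : ∀ h : GaussianInt, h ≠ 0 →
      |(GaussianInt.toComplex h * z).im| ≤ 0.42 * |(GaussianInt.toComplex h * z).re| →
      |((GaussianInt.toComplex h * z) ^ 4).im| ≤ 4 * |(z ^ 4).im| →
      ∃ h : GaussianInt, 1 ≤ ‖GaussianInt.toComplex h‖ ∧
        |(GaussianInt.toComplex h * z).im| ≤ 0.42 * |(GaussianInt.toComplex h * z).re| ∧
        |((GaussianInt.toComplex h * z) ^ 4).im| ≤ 4 * |(z ^ 4).im| := fun h h0 h1 h2 =>
    ⟨h, one_le_norm_of_mem_gaussianInt ⟨h, rfl⟩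
      (by rwa [Ne, GaussianInt.toComplex_eq_zero]), h1, h2⟩
  have e1 : GaussianInt.toComplex ⟨1, 0⟩ = 1 := by simp [GaussianInt.toComplex_def']
  have e2 : GaussianInt.toComplex ⟨0, 1⟩ = Complex.I := by simp [GaussianInt.toComplex_def']
  have e3 : GaussianInt.toComplex ⟨1, 1⟩ = 1 + Complex.I := by simp [GaussianInt.toComplex_def']
  have e4 : GaussianInt.toComplex ⟨1, -1⟩ = 1 - Complex.I := by
    simp [GaussianInt.toComplex_def', sub_eq_add_neg]
  by_cases c1 : |z.im| ≤ 0.42 * |z.re|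
  · refine key ⟨1, 0⟩ (by decide) ?_ ?_
    · rwa [e1, one_mul]
    · rw [e1, one_mul]; linarith [abs_nonneg (z ^ 4).im]
  by_cases c2 : |z.re| ≤ 0.42 * |z.im|
  · refine key ⟨0, 1⟩ (by decide) ?_ ?_
    · rw [e2, Complex.I_mul_im, Complex.I_mul_re, abs_neg]; exact c2
    · rw [e2, mul_pow, Complex.I_pow_four, one_mul]; linarith [abs_nonneg (z ^ 4).im]
  rw [not_le] at c1 c2
  by_cases c3 : z.re * z.im ≤ 0
  · refine key ⟨1, 1⟩ (by decide) ?_ ?_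
    · rw [e3, add_mul, one_mul, Complex.add_im, Complex.add_re, Complex.I_mul_im, Complex.I_mul_re]
      rw [add_comm, ← sub_eq_add_neg]
      exact abs_add_le_of_mul_nonpos c3 c1.le c2.le
    · rw [e3, mul_pow, show (1 + Complex.I) ^ 4 = ((-4 : ℝ) : ℂ) by
        push_cast; linear_combination (Complex.I ^ 2 + 4 * Complex.I + 5) * Complex.I_sq,
        Complex.im_ofReal_mul, abs_mul]
      norm_num
  · refine key ⟨1, -1⟩ (by decide) ?_ ?_
    · rw [e4, sub_mul, one_mul, Complex.sub_im, Complex.sub_re, Complex.I_mul_im, Complex.I_mul_re]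
      have := abs_add_le_of_mul_nonpos (x := -z.re) (y := z.im) (by linarith)
        (by rw [abs_neg]; exact c1.le) (by rw [abs_neg]; exact c2.le)
      rwa [neg_add_eq_sub, ← neg_add', abs_neg, ← sub_neg_eq_add] at this
    · rw [e4, mul_pow, show (1 - Complex.I) ^ 4 = ((-4 : ℝ) : ℂ) by
        push_cast; linear_combination (Complex.I ^ 2 - 4 * Complex.I + 5) * Complex.I_sq,
        Complex.im_ofReal_mul, abs_mul]
      norm_num

theorem abs_im_mul_norm_pow_le {z : ℂ} {S : ℝ} (hS : 0 ≤ S) (h : |z.im| ≤ 0.42 * |z.re|)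
    (h4 : |(z ^ 4).im| * S ≤ 4) : |z.im| * (S * ‖z‖ ^ 3) ≤ 8 / 5 := by
  rw [im_pow_four] at h4
  have hsq := Complex.sq_norm z
  rw [Complex.normSq_apply] at hsq
  have hx := abs_nonneg z.re
  have hy := abs_nonneg z.im
  have h1 : |z.im| ^ 2 ≤ 0.1764 * |z.re| ^ 2 := by
    have := pow_le_pow_left₀ hy h 2
    rw [mul_pow] at this; norm_num at this ⊢; exact this
  have h2 : ‖z‖ ≤ 1.085 * |z.re| := by
    refine abs_le_of_sq_le_sq' ?_ (by positivity) |>.2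
    rw [hsq, mul_pow]
    rw [sq_abs, sq_abs] at h1
    rw [sq_abs]; nlinarith [sq_nonneg z.re]
  have h3 : |z.re * z.im * (z.re ^ 2 - z.im ^ 2)| =
      |z.re| * |z.im| * (|z.re| ^ 2 - |z.im| ^ 2) := by
    rw [sq_abs, sq_abs] at h1
    rw [abs_mul, abs_mul, sq_abs, sq_abs,
      abs_of_nonneg (by nlinarith [sq_nonneg z.re] : 0 ≤ z.re ^ 2 - z.im ^ 2)]
  rw [abs_mul, h3] at h4
  norm_num at h4
  have h5 : |z.re| * |z.im| * (0.8236 * |z.re| ^ 2) * S ≤ 1 := by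
    have : |z.re| * |z.im| * (0.8236 * |z.re| ^ 2) * S ≤
      |z.re| * |z.im| * (|z.re| ^ 2 - |z.im| ^ 2) * S := by
      gcongr
      linarith
    rw [sq_abs, sq_abs] at this
    rw [sq_abs]
    linarith
  calc |z.im| * (S * ‖z‖ ^ 3) ≤ |z.im| * (S * (1.085 * |z.re|) ^ 3) := by gcongr
    _ = |z.re| * |z.im| * (0.8236 * |z.re| ^ 2) * S * (1.085 ^ 3 / 0.8236) := by ring
    _ ≤ 1 * (1.085 ^ 3 / 0.8236) := by gcongr
    _ ≤ _ := by norm_num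

theorem le_norm_of_near {b : ℝ} (hb : 44 ≤ b) {p q : ℤ} {ψ : ℝ} (hψ0 : 0 ≤ ψ) (hψ : ψ ≤ 1 / (4 * b))
    (hsin : 1 ≤ 4 * √(b ^ 2 + 1) * Real.sin ψ) {G : ℝ} (hG : G ^ 2 = (p : ℝ) ^ 2 + (q : ℝ) ^ 2)
    (hG2 : 2 ≤ G ^ 2) (hG0 : 0 ≤ G)
    (hnear : |q * Real.cos ψ - p * Real.sin ψ| * (√(b ^ 2 + 1) * G ^ 3) ≤ 8 / 5) : b ≤ G := by
  have hb0 : 0 < b := by linarith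
  have hbS : b ≤ √(b ^ 2 + 1) := Real.le_sqrt_of_sq_le (by linarith)
  generalize √(b ^ 2 + 1) = S at *
  have hG1 : 1 ≤ G := by nlinarith
  have hpG : |(p : ℝ)| ≤ G := by
    rw [← abs_of_nonneg hG0]; exact sq_le_sq.1 (by nlinarith [sq_nonneg (q : ℝ)])
  by_cases hq : q = 0
  · subst hq
    exfalso
    norm_num at hnear hG
    have hsp : 0 < Real.sin ψ := by
      by_contra! h
      nlinarith
    rw [abs_of_pos hsp] at hnear
    have : |(p : ℝ)| = G := by
      rw [← abs_of_nonneg hG0, ← sq_eq_sq_iff_abs_eq_abs, hG]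
    rw [this] at hnear
    have : G ^ 4 ≤ 32 / 5 := by nlinarith [pow_nonneg hG0 4]
    have hp2 : (2 : ℤ) ≤ p ^ 2 := by
      have : (2 : ℝ) ≤ (p : ℝ) ^ 2 := by linarith
      exact_mod_cast this
    have hp3 : (4 : ℤ) ≤ p ^ 2 := by
      have : 2 ≤ |p| := by
        by_contra! h
        have : |p| ^ 2 ≤ 1 := by nlinarith [abs_nonneg p]
        rw [sq_abs] at this; omega
      nlinarith [sq_abs p]
    have : (4 : ℝ) ≤ (p : ℝ) ^ 2 := by exact_mod_cast hp3
    nlinarith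
  · have hq1 : (1 : ℝ) ≤ |(q : ℝ)| := by exact_mod_cast Int.one_le_abs hq
    have hcos := Real.one_sub_sq_div_two_le_cos (x := ψ)
    have hs1 : Real.sin ψ ≤ 1 / (4 * b) := (Real.sin_le hψ0).trans hψ
    have hb4 : 1 / (4 * b) ≤ 1 / 100 := by
      apply one_div_le_one_div_of_le <;> linarith
    have hcos2 : 0.99 ≤ Real.cos ψ := by nlinarith
    have hsp : 0 ≤ Real.sin ψ := Real.sin_nonneg_of_nonneg_of_le_pi hψ0
      (by linarith [Real.pi_gt_three])
    have h1 : |q * Real.cos ψ - p * Real.sin ψ| * b ≤ 8 / 5 := by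
      refine le_trans ?_ hnear
      gcongr
      calc b ≤ S * 1 := by linarith
        _ ≤ _ := by gcongr; exacts [hb0.le.trans hbS, one_le_pow₀ hG1]
    have h2 : |(q : ℝ)| * Real.cos ψ - |(p : ℝ)| * Real.sin ψ ≤
        |q * Real.cos ψ - p * Real.sin ψ| := by
      have := abs_sub_abs_le_abs_sub (q * Real.cos ψ) (p * Real.sin ψ)
      rwa [abs_mul, abs_mul, abs_of_nonneg hsp,
          abs_of_nonneg (by linarith : 0 ≤ Real.cos ψ)] at this
    have h3 : 0.99 ≤ |(q : ℝ)| * Real.cos ψ := by nlinarith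
    have h4 : |(p : ℝ)| * Real.sin ψ * b ≤ |(p : ℝ)| / 4 := by
      calc |(p : ℝ)| * Real.sin ψ * b ≤ |(p : ℝ)| * (1 / (4 * b)) * b := by gcongr
        _ = _ := by field_simp
    have h5 := mul_le_mul_of_nonneg_right h3 hb0.le
    have h6 := mul_le_mul_of_nonneg_right h2 hb0.le
    rw [sub_mul] at h6
    norm_num at h5
    linarith

theorem mul_eq_zero_of_forty_four_le {b : ℕ} (hb : 44 ≤ b) {r s : ℤ}
    (H : r ^ 4 - 4 * b * r ^ 3 * s - 6 * r ^ 2 * s ^ 2 + 4 * b * r * s ^ 3 + s ^ 4 = 1) :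
    r * s = 0 := by
  by_contra hrs
  have hr : r ≠ 0 := left_ne_zero_of_mul hrs
  have hs : s ≠ 0 := right_ne_zero_of_mul hrs
  have hbR : (44 : ℝ) ≤ b := by exact_mod_cast hb
  have hb0 : (0 : ℝ) < b := by linarith
  have hS0 : 0 < √((b : ℝ) ^ 2 + 1) := by positivity
  set φ := Real.arctan (1 / b) with hφ
  have hφ1 : φ ≤ 1 / b := arctan_inv_le hb0
  have hφ0 : 0 ≤ φ := Real.arctan_nonneg.2 (by positivity)
  have hbI := natCast_add_I_eq b (by omega)
  set S := √((b : ℝ) ^ 2 + 1) with hS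
  rw [← hφ] at hbI
  set e := Complex.exp (-((φ / 4 : ℝ) * Complex.I)) with he
  have he1 : ‖e‖ = 1 := by simp [he, Complex.norm_exp]
  have he4 : (b : ℂ) - Complex.I = S * e ^ 4 := by
    have h2 := congrArg (starRingEnd ℂ) hbI
    rw [map_add, map_mul, ← Complex.exp_conj, map_mul, Complex.conj_I, Complex.conj_ofReal,
      Complex.conj_ofReal, Complex.conj_natCast, ← sub_eq_add_neg] at h2
    rw [h2, he, ← Complex.exp_nat_mul]
    congr 2
    push_cast
    ring
  have h0 : |(((r + s * Complex.I : ℂ) * e) ^ 4).im| * S = 1 := by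
    have : ((r + s * Complex.I : ℂ) ^ 4 * (b - Complex.I)).im = -1 := by
      rw [show (r + s * Complex.I : ℂ) ^ 4 * (b - Complex.I) =
        (((b * (r ^ 4 - 6 * r ^ 2 * s ^ 2 + s ^ 4) + (4 * r ^ 3 * s - 4 * r * s ^ 3) : ℤ) : ℝ) : ℂ)
        + ((-(r ^ 4 - 4 * b * r ^ 3 * s - 6 * r ^ 2 * s ^ 2 + 4 * b * r * s ^ 3 + s ^ 4) : ℤ) : ℝ)
          * Complex.I by
        push_cast
        have := Complex.I_sq
        have h3 : Complex.I ^ 3 = -Complex.I := Complex.I_pow_three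
        have h4 : Complex.I ^ 4 = 1 := Complex.I_pow_four
        ring_nf
        rw [show Complex.I ^ 5 = Complex.I by rw [pow_succ, h4, one_mul], h4, h3, this]
        ring, H, Complex.add_im, Complex.ofReal_im, Complex.im_ofReal_mul, Complex.I_im]
      norm_num
    rw [he4, show (r + s * Complex.I : ℂ) ^ 4 * (S * e ^ 4) =
      (S : ℂ) * ((r + s * Complex.I : ℂ) * e) ^ 4 by ring, Complex.im_ofReal_mul] at this
    have h5 := congrArg abs this
    rw [abs_mul, abs_of_pos hS0, abs_neg, abs_one] at h5
    linarith
  obtain ⟨h, hh1, hh2, hh3⟩ := exists_gaussianInt_mul_near_real ((r + s * Complex.I : ℂ) * e)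
  rw [← mul_assoc] at hh2 hh3
  have hγ : (r + s * Complex.I : ℂ) = GaussianInt.toComplex ⟨r, s⟩ :=
    (GaussianInt.toComplex_def' r s).symm
  rw [hγ, ← map_mul] at hh2 hh3
  rw [hγ] at h0
  have hnorm : 2 ≤ ‖GaussianInt.toComplex (h * ⟨r, s⟩)‖ ^ 2 := by
    rw [map_mul, norm_mul, mul_pow]
    have h1 : 1 ≤ ‖GaussianInt.toComplex h‖ ^ 2 := one_le_pow₀ hh1
    have h2 : 2 ≤ ‖GaussianInt.toComplex ⟨r, s⟩‖ ^ 2 := by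
      rw [Complex.sq_norm, Complex.normSq_apply, GaussianInt.re_toComplex, GaussianInt.im_toComplex]
      have h3 : 2 ≤ r * r + s * s := by
        have := mul_self_pos.2 hr
        have := mul_self_pos.2 hs
        omega
      exact_mod_cast h3
    nlinarith
  generalize h * (⟨r, s⟩ : GaussianInt) = w at hh2 hh3 hnorm
  obtain ⟨p, q⟩ := w
  have hznorm : ‖GaussianInt.toComplex ⟨p, q⟩ * e‖ = ‖GaussianInt.toComplex ⟨p, q⟩‖ := by
    rw [norm_mul, he1, mul_one]
  have hnear := abs_im_mul_norm_pow_le hS0.le hh2 (by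
    calc _ ≤ 4 * |(((GaussianInt.toComplex ⟨r, s⟩) * e) ^ 4).im| * S := by gcongr
      _ = 4 := by rw [mul_assoc, h0, mul_one])
  rw [hznorm] at hnear
  refine not_gaussianInt_near hb ⟨⟨p, q⟩, rfl⟩ ?_ hnear
  have him : (GaussianInt.toComplex ⟨p, q⟩ * e).im =
      q * Real.cos (φ / 4) - p * Real.sin (φ / 4) := by
    rw [he, ← neg_mul, ← Complex.ofReal_neg, Complex.mul_im, Complex.exp_ofReal_mul_I_re,
      Complex.exp_ofReal_mul_I_im, Real.cos_neg, Real.sin_neg, GaussianInt.re_toComplex,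
      GaussianInt.im_toComplex]
    ring
  rw [him] at hnear
  refine le_norm_of_near hbR (ψ := φ / 4) (by positivity) ?_ ?_ ?_ hnorm (norm_nonneg _) hnear
  · rw [mul_comm, ← div_div]
    linarith
  · have h1 : Real.sin φ * S = 1 := by
      have := congrArg Complex.im hbI
      rw [Complex.im_ofReal_mul, Complex.exp_ofReal_mul_I_im] at this
      simp at this
      linarith
    have h2 : ∀ t, 0 ≤ Real.sin t → Real.sin (2 * t) ≤ 2 * Real.sin t := by
      intro t ht
      rw [Real.sin_two_mul]
      nlinarith [Real.cos_le_one t]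
    have h3 : φ ≤ 1 := hφ1.trans (by rw [div_le_one hb0]; linarith)
    have hpi := Real.pi_gt_three
    have h4 := h2 (φ / 4) (Real.sin_nonneg_of_nonneg_of_le_pi (by positivity) (by linarith))
    have h5 := h2 (φ / 2) (Real.sin_nonneg_of_nonneg_of_le_pi (by positivity) (by linarith))
    rw [show 2 * (φ / 4) = φ / 2 by ring] at h4
    rw [show 2 * (φ / 2) = φ by ring] at h5
    nlinarith
  · rw [Complex.sq_norm, Complex.normSq_apply, GaussianInt.re_toComplex, GaussianInt.im_toComplex]
    ring

/-- The Lucas sequence `0, 1, a, a ^ 2 + 1, …` with recurrence `Uₙ₊₂ = a Uₙ₊₁ + Uₙ`. -/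
def lucasU (a : ℤ) : ℕ → ℤ
  | 0 => 0
  | 1 => 1
  | n + 2 => a * lucasU a (n + 1) + lucasU a n

/-- The companion Lucas sequence `2, a, a ^ 2 + 2, …` of `lucasU`. -/
def lucasV (a : ℤ) (n : ℕ) : ℤ := 2 * lucasU a (n + 1) - a * lucasU a n

@[simp] theorem lucasU_zero (a : ℤ) : lucasU a 0 = 0 := rfl
@[simp] theorem lucasU_one (a : ℤ) : lucasU a 1 = 1 := rfl

theorem lucasU_add_two (a : ℤ) (n : ℕ) :
    lucasU a (n + 2) = a * lucasU a (n + 1) + lucasU a n := rfl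

@[simp] theorem lucasU_two (a : ℤ) : lucasU a 2 = a := by simp [lucasU_add_two]

theorem lucasU_add (a : ℤ) (m n : ℕ) : lucasU a (m + n + 1) =
    lucasU a (m + 1) * lucasU a (n + 1) + lucasU a m * lucasU a n := by
  induction n using Nat.twoStepInduction with
  | zero => simp
  | one => simp [lucasU_add_two]; ring
  | more n h1 h2 =>
    rw [show m + (n + 2) + 1 = (m + n + 1) + 2 by ring, lucasU_add_two, h1,
      show m + n + 1 + 1 = m + (n + 1) + 1 by ring, h2, lucasU_add_two a (n + 1),
          lucasU_add_two a n]
    ring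

theorem lucasU_cassini (a : ℤ) (n : ℕ) :
    lucasU a (n + 1) ^ 2 - a * lucasU a (n + 1) * lucasU a n - lucasU a n ^ 2 = (-1) ^ n := by
  induction n with
  | zero => simp
  | succ n ih =>
    rw [lucasU_add_two, pow_succ (-1 : ℤ), ← ih]
    ring

theorem isCoprime_lucasU (a : ℤ) (n : ℕ) : IsCoprime (lucasU a n) (lucasU a (n + 1)) := by
  induction n with
  | zero => simpa using isCoprime_one_right
  | succ n ih =>
    rw [lucasU_add_two, add_comm (a * _)]
    exact ih.symm.add_mul_right_right a

theorem lucasU_two_mul (a : ℤ) (n : ℕ) : lucasU a (2 * n) = lucasU a n * lucasV a n := by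
  cases n with
  | zero => simp
  | succ n =>
    rw [show 2 * (n + 1) = n + 1 + n + 1 by ring, lucasU_add, lucasV, lucasU_add_two]
    ring

theorem lucasU_two_mul_add_one (a : ℤ) (n : ℕ) :
    lucasU a (2 * n + 1) = lucasU a (n + 1) ^ 2 + lucasU a n ^ 2 := by
  rw [two_mul, lucasU_add]
  ring

theorem lucasU_two_mul_add_one' (a : ℤ) (n : ℕ) :
    lucasU a (2 * n + 1) = lucasU a (n + 1) * lucasV a n - (-1) ^ n := by
  rw [lucasU_two_mul_add_one, lucasV, ← lucasU_cassini a n]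
  ring

theorem lucasV_two_mul (a : ℤ) (n : ℕ) : lucasV a (2 * n) = lucasV a n ^ 2 - 2 * (-1) ^ n := by
  rw [lucasV, lucasU_two_mul_add_one, lucasU_two_mul, lucasV, ← lucasU_cassini a n]
  ring

theorem lucasU_pos {a : ℤ} (ha : 1 ≤ a) (n : ℕ) : 0 < lucasU a (n + 1) := by
  induction n using Nat.twoStepInduction with
  | zero => simp
  | one => simp; omega
  | more n h1 h2 => rw [lucasU_add_two]; positivity

theorem lucasU_nonneg {a : ℤ} (ha : 1 ≤ a) (n : ℕ) : 0 ≤ lucasU a n := by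
  cases n with
  | zero => simp
  | succ n => exact (lucasU_pos ha n).le

theorem lucasV_pos {a : ℤ} (ha : 1 ≤ a) (n : ℕ) : 0 < lucasV a n := by
  cases n with
  | zero => simp [lucasV]
  | succ n =>
    have h1 := lucasU_pos ha n
    have h2 := lucasU_nonneg ha n
    rw [lucasV, lucasU_add_two]
    nlinarith

theorem exists_lucasU_of_norm_eq {a : ℤ} (ha : 1 ≤ a) {u t : ℤ} (hu : 0 ≤ u) (ht : 1 ≤ t)
    (h : u ^ 2 + a * u * t - t ^ 2 = 1 ∨ u ^ 2 + a * u * t - t ^ 2 = -1) :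
    ∃ n, u = lucasU a n ∧ t = lucasU a (n + 1) := by
  induction hk : (u + t).toNat using Nat.strong_induction_on generalizing u t with
  | _ k ih =>
    subst hk
    rcases hu.eq_or_lt with rfl | hu
    · refine ⟨0, rfl, ?_⟩
      simp only [lucasU_one, zero_add]
      have : t ^ 2 = 1 := by rcases h with h | h <;> nlinarith
      nlinarith
    · have h1 : 0 ≤ t - a * u := by
        by_contra! h2
        rcases h with h | h <;> nlinarith
      have hau : u ≤ a * u := by nlinarith
      obtain ⟨n, hn1, hn2⟩ := ih (t - a * u + u).toNat (by omega) (u := t - a * u) (t := u) h1 hu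
        (by rcases h with h | h
            · right; linarith
            · left; linarith) rfl
      refine ⟨n + 1, hn2, ?_⟩
      rw [lucasU_add_two, ← hn2, ← hn1]
      ring

theorem lucasV_dvd_lucasU {a : ℤ} {k : ℕ} (hk : Even k) {l : ℕ} (hl : Odd l) :
    lucasV a k ∣ lucasU a (2 * k * l) ∧ lucasV a k ∣ lucasU a (2 * k * l + 1) + 1 := by
  have h0 : lucasV a k ∣ lucasU a (2 * k) := ⟨_, (lucasU_two_mul a k).trans (mul_comm _ _)⟩
  have h1 : lucasV a k ∣ lucasU a (2 * k + 1) + 1 := by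
    rw [lucasU_two_mul_add_one', hk.neg_one_pow, sub_add_cancel]
    exact dvd_mul_left _ _
  have h2 : ∀ l, lucasV a k ∣ lucasU a (2 * k * l) ∧
      lucasV a k ∣ lucasU a (2 * k * l + 1) - (-1) ^ l := by
    intro l
    induction l with
    | zero => simp
    | succ l ih =>
      rw [mul_add_one]
      constructor
      · rcases Nat.eq_zero_or_pos k with rfl | hk0
        · simp
        · obtain ⟨m, hm⟩ : ∃ m, 2 * k = m + 1 := ⟨2 * k - 1, by omega⟩
          rw [hm, ← add_assoc, lucasU_add, ← hm]
          exact dvd_add (dvd_mul_of_dvd_right h0 _) (dvd_mul_of_dvd_left ih.1 _)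
      · rw [lucasU_add]
        have e : lucasU a (2 * k * l + 1) * lucasU a (2 * k + 1) +
            lucasU a (2 * k * l) * lucasU a (2 * k) - (-1) ^ (l + 1) =
            (lucasU a (2 * k * l + 1) - (-1) ^ l) * lucasU a (2 * k + 1) +
            lucasU a (2 * k * l) * lucasU a (2 * k) + (-1) ^ l * (lucasU a (2 * k + 1) + 1) := by
          ring
        rw [e]
        exact dvd_add (dvd_add (dvd_mul_of_dvd_left ih.2 _) (dvd_mul_of_dvd_left ih.1 _))
          (dvd_mul_of_dvd_right h1 _)
  have h3 := h2 l
  rwa [hl.neg_one_pow, sub_neg_eq_add] at h3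

theorem lucasV_two (a : ℤ) : lucasV a 2 = a ^ 2 + 2 := by
  rw [lucasV, lucasU_add_two]; simp; ring

theorem lucasV_two_pow_emod_four {a : ℤ} (ha : Odd a) (s : ℕ) :
    lucasV a (2 ^ (s + 1)) % 4 = 3 := by
  induction s with
  | zero =>
    rw [zero_add, pow_one, lucasV_two]
    obtain ⟨c, rfl⟩ := ha
    ring_nf
    omega
  | succ s ih =>
    rw [pow_succ 2 (s + 1), mul_comm, lucasV_two_mul,
      (by simp [pow_succ] : Even (2 ^ (s + 1))).neg_one_pow]
    obtain ⟨c, hc⟩ : ∃ c, lucasV a (2 ^ (s + 1)) = 4 * c + 3 :=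
        ⟨lucasV a (2 ^ (s + 1)) / 4, by omega⟩
    rw [hc]
    ring_nf
    omega

theorem dvd_lucasV_two_pow_sub_two (a : ℤ) (s : ℕ) : a ∣ lucasV a (2 ^ (s + 1)) - 2 := by
  induction s with
  | zero =>
    rw [zero_add, pow_one, lucasV_two]
    exact ⟨a, by ring⟩
  | succ s ih =>
    rw [pow_succ 2 (s + 1), mul_comm, lucasV_two_mul,
      (by simp [pow_succ] : Even (2 ^ (s + 1))).neg_one_pow]
    obtain ⟨c, hc⟩ := ih
    rw [show lucasV a (2 ^ (s + 1)) = a * c + 2 by linarith]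
    exact ⟨a * c ^ 2 + 4 * c, by ring⟩

theorem jacobiSym_ne_neg_one_of_dvd_sq_sub {x c : ℤ} {N : ℕ} (h : (N : ℤ) ∣ x ^ 2 - c) :
    jacobiSym c N ≠ -1 := by
  have h1 : jacobiSym c N = jacobiSym (x ^ 2) N :=
    jacobiSym.mod_left' (Int.modEq_iff_dvd.2 h)
  rw [h1, jacobiSym.pow_left]
  nlinarith [sq_nonneg (jacobiSym x N)]

theorem exists_four_dvd_eq {n : ℕ} (hn : n ≠ 0) (h4 : 4 ∣ n) :
    ∃ s l, Odd l ∧ n = 2 * 2 ^ (s + 1) * l := by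
  obtain ⟨m, rfl⟩ := h4
  obtain ⟨s, l, hl, rfl⟩ := Nat.exists_eq_two_pow_mul_odd (n := m) (by omega)
  exact ⟨s, l, hl, by ring⟩


theorem jacobiSym_neg_one_lucasV {a : ℤ} (ha : Odd a) (ha1 : 1 ≤ a) (s : ℕ) :
    jacobiSym (-1) (lucasV a (2 ^ (s + 1))).natAbs = -1 := by
  have h1 := lucasV_two_pow_emod_four ha s
  have h2 := lucasV_pos ha1 (2 ^ (s + 1))
  have h3 : (lucasV a (2 ^ (s + 1))).natAbs % 4 = 3 := by omega
  rw [jacobiSym.at_neg_one (Nat.odd_iff.2 (by omega)), ZMod.χ₄_nat_three_mod_four h3]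

theorem jacobiSym_lucasV {a : ℤ} (ha : Odd a) (ha1 : 1 ≤ a) (s : ℕ) :
    jacobiSym a (lucasV a (2 ^ (s + 1))).natAbs = if a % 8 = 1 ∨ a % 8 = 3 then 1 else -1 := by
  have h1 := lucasV_two_pow_emod_four ha s
  have h2 := lucasV_pos ha1 (2 ^ (s + 1))
  have h4 := dvd_lucasV_two_pow_sub_two a s
  obtain ⟨N, hN⟩ := Int.eq_ofNat_of_zero_le h2.le
  rw [hN] at h1 h4 ⊢
  obtain ⟨c, rfl⟩ := Int.eq_ofNat_of_zero_le (by omega : 0 ≤ a)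
  rw [Int.natAbs_natCast]
  have hc : Odd c := by exact_mod_cast ha
  have hmod : jacobiSym (N : ℤ) c = jacobiSym 2 c :=
    jacobiSym.mod_left' (Int.modEq_iff_dvd.2 h4).symm
  have hc2 := Nat.odd_iff.1 hc
  have h3 : N % 4 = 3 := by omega
  have htwo := jacobiSym.at_two hc
  rw [ZMod.χ₈_nat_eq_if_mod_eight] at htwo
  rcases (by omega : c % 4 = 1 ∨ c % 4 = 3) with h | h
  · rw [jacobiSym.quadratic_reciprocity_one_mod_four h (Nat.odd_iff.2 (by omega)), hmod, htwo]
    split_ifs <;> omega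
  · rw [jacobiSym.quadratic_reciprocity_three_mod_four h h3, hmod, htwo]
    split_ifs <;> omega

theorem sq_ne_lucasU_of_odd {a : ℤ} (ha : Odd a) (ha1 : 1 ≤ a) {n : ℕ} (hn : Odd n) (hn1 : n ≠ 1)
    (y : ℤ) :
    y ^ 2 ≠ lucasU a n := by
  intro h
  have key : ∃ s, lucasV a (2 ^ (s + 1)) ∣ lucasU a n + 1 := by
    have hn2 := Nat.odd_iff.1 hn
    rcases (by omega : n % 4 = 1 ∨ n % 4 = 3) with h4 | h4
    · obtain ⟨s, l, hl, he⟩ := exists_four_dvd_eq (n := n - 1) (by omega) (by omega)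
      have h5 := (lucasV_dvd_lucasU (a := a) (k := 2 ^ (s + 1)) (by simp [pow_succ]) hl).2
      rw [← he, Nat.sub_add_cancel (by omega)] at h5
      exact ⟨s, h5⟩
    · obtain ⟨s, l, hl, he⟩ := exists_four_dvd_eq (n := n + 1) (by omega) (by omega)
      have h5 := lucasV_dvd_lucasU (a := a) (k := 2 ^ (s + 1)) (by simp [pow_succ]) hl
      rw [← he, lucasU_add_two] at h5
      refine ⟨s, (Int.dvd_add_right (dvd_mul_of_dvd_right h5.1 a)).1 ?_⟩
      rw [← add_assoc]
      exact h5.2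
  obtain ⟨s, hs⟩ := key
  refine jacobiSym_ne_neg_one_of_dvd_sq_sub (x := y) (c := -1) ?_
      (jacobiSym_neg_one_lucasV ha ha1 s)
  rwa [Int.natAbs_dvd, h, sub_neg_eq_add]

theorem sq_ne_lucasU_of_mod_four_eq_two {a : ℤ} (ha : Odd a) (ha1 : 1 ≤ a) {n : ℕ} (hn : n % 4 = 2)
    (hn2 : n ≠ 2) (y : ℤ) : y ^ 2 ≠ lucasU a n := by
  intro h
  have hmul : ∀ s, jacobiSym (-a) (lucasV a (2 ^ (s + 1))).natAbs =
      -jacobiSym a (lucasV a (2 ^ (s + 1))).natAbs := by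
    intro s
    rw [← neg_one_mul a, jacobiSym.mul_left, jacobiSym_neg_one_lucasV ha ha1, neg_one_mul]
  by_cases h8 : a % 8 = 1 ∨ a % 8 = 3
  · obtain ⟨s, l, hl, he⟩ := exists_four_dvd_eq (n := n - 2) (by omega) (by omega)
    have h5 := lucasV_dvd_lucasU (a := a) (k := 2 ^ (s + 1)) (by simp [pow_succ]) hl
    rw [← he] at h5
    refine jacobiSym_ne_neg_one_of_dvd_sq_sub (x := y) (c := -a) ?_
      ((hmul s).trans (by rw [jacobiSym_lucasV ha ha1, if_pos h8]))
    rw [Int.natAbs_dvd, h, sub_neg_eq_add, show n = n - 2 + 2 by omega, lucasU_add_two]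
    have := dvd_add (dvd_mul_of_dvd_right h5.2 a) h5.1
    rwa [show a * (lucasU a (n - 2 + 1) + 1) + lucasU a (n - 2) =
      a * lucasU a (n - 2 + 1) + lucasU a (n - 2) + a by ring] at this
  · obtain ⟨s, l, hl, he⟩ := exists_four_dvd_eq (n := n + 2) (by omega) (by omega)
    have h5 := lucasV_dvd_lucasU (a := a) (k := 2 ^ (s + 1)) (by simp [pow_succ]) hl
    rw [← he, lucasU_add_two (n := n + 1), lucasU_add_two] at h5
    refine jacobiSym_ne_neg_one_of_dvd_sq_sub (x := y) (c := a) ?_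
      ((jacobiSym_lucasV ha ha1 s).trans (if_neg h8))
    rw [Int.natAbs_dvd, h]
    have h6 := dvd_sub (dvd_mul_of_dvd_right h5.1 (a ^ 2 + 1)) (dvd_mul_of_dvd_right h5.2 a)
    rwa [show (a ^ 2 + 1) * (a * lucasU a (n + 1) + lucasU a n) -
      a * (a * (a * lucasU a (n + 1) + lucasU a n) + lucasU a (n + 1) + 1) =
      lucasU a n - a by ring] at h6

theorem lucasU_mod_four_add_six {a : ℤ} (ha : Odd a) (n : ℕ) :
    lucasU a (n + 6) % 4 = lucasU a n % 4 := by
  obtain ⟨c, rfl⟩ := ha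
  simp only [lucasU_add_two]
  generalize lucasU (2 * c + 1) (n + 1) = X
  generalize lucasU (2 * c + 1) n = Y
  rw [Int.emod_eq_emod_iff_emod_sub_eq_zero]
  rcases Int.even_or_odd' c with ⟨d, rfl | rfl⟩ <;> ring_nf <;> omega

theorem lucasU_add_mod_four {a : ℤ} (ha : Odd a) (n m : ℕ) :
    lucasU a (6 * m + n) % 4 = lucasU a n % 4 := by
  induction m with
  | zero => simp
  | succ m ih => rw [show 6 * (m + 1) + n = 6 * m + n + 6 by ring, lucasU_mod_four_add_six ha, ih]

theorem sq_ne_of_four_dvd {a : ℤ} (ha : Odd a) (ha1 : 1 ≤ a) {m : ℕ} (hm : 4 ∣ m + 1) (z : ℤ) :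
    z ^ 2 ≠ (a + 1) ^ 2 * lucasU a (m + 1) + 4 * lucasU a m := by
  intro h
  obtain ⟨s, l, hl, he⟩ := exists_four_dvd_eq (n := m + 1) (by omega) hm
  have h5 := lucasV_dvd_lucasU (a := a) (k := 2 ^ (s + 1)) (by simp [pow_succ]) hl
  rw [← he, lucasU_add_two] at h5
  have hJ : jacobiSym (4 * -1) (lucasV a (2 ^ (s + 1))).natAbs = -1 := by
    have h1 := lucasV_two_pow_emod_four ha s
    rw [jacobiSym.mul_left, jacobiSym_neg_one_lucasV ha ha1,
      jacobiSym.at_four (Nat.odd_iff.2 (by omega)), one_mul]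
  refine jacobiSym_ne_neg_one_of_dvd_sq_sub (x := z) (c := 4 * -1) ?_ hJ
  rw [Int.natAbs_dvd, h]
  have h6 := dvd_add (dvd_mul_of_dvd_right h5.1 ((a + 1) ^ 2 - 4 * a)) (dvd_mul_of_dvd_right h5.2 4)
  rwa [show ((a + 1) ^ 2 - 4 * a) * lucasU a (m + 1) +
    4 * (a * lucasU a (m + 1) + lucasU a m + 1) =
    (a + 1) ^ 2 * lucasU a (m + 1) + 4 * lucasU a m - 4 * -1 by ring] at h6

theorem sq_ne_of_six_dvd {a : ℤ} (ha : Odd a) {m : ℕ} (hm : 6 ∣ m + 1) (z : ℤ) :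
    z ^ 2 ≠ (a - 1) ^ 2 * lucasU a (m + 1) - 4 * lucasU a m := by
  intro h
  obtain ⟨k, hk⟩ := hm
  have h1 : lucasU a (m + 1) % 4 = 0 := by
    rw [hk]; simpa using lucasU_add_mod_four ha 0 k
  have h2 : lucasU a (m + 2) % 4 = 1 := by
    rw [show m + 2 = 6 * k + 1 by omega]; simpa using lucasU_add_mod_four ha 1 k
  rw [lucasU_add_two] at h2
  obtain ⟨e, he⟩ : ∃ e, lucasU a (m + 1) = 4 * e := ⟨_, (Int.mul_ediv_cancel' (by omega)).symm⟩
  obtain ⟨c, rfl⟩ := ha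
  have h3 : lucasU (2 * c + 1) m % 4 = 1 := by
    rw [he, show (2 * c + 1) * (4 * e) = 4 * ((2 * c + 1) * e) by ring] at h2
    omega
  obtain ⟨w, hw⟩ : ∃ w, z = 2 * w := by
    have : Even (z ^ 2) := ⟨(2 * c ^ 2) * lucasU (2 * c + 1) (m + 1) - 2 * lucasU (2 * c + 1) m, by
      rw [h]; ring⟩
    rw [Int.even_pow] at this
    exact this.1.two_dvd
  subst hw
  have h4 : w ^ 2 = 4 * (c ^ 2 * e) - lucasU (2 * c + 1) m := by
    rw [he] at h
    linarith
  generalize lucasU (2 * c + 1) m = X at h3 h4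
  rcases Int.even_or_odd' w with ⟨v, rfl | rfl⟩ <;> ring_nf at h4 <;> omega

theorem odd_lucasU_of_not_three_dvd {a : ℤ} (ha : Odd a) {n : ℕ} (h3 : ¬ 3 ∣ n) :
    Odd (lucasU a n) := by
  have key : ∀ n, lucasU a (n + 3) % 2 = lucasU a n % 2 := by
    intro n
    obtain ⟨c, rfl⟩ := ha
    simp only [lucasU_add_two]
    generalize lucasU (2 * c + 1) (n + 1) = X
    generalize lucasU (2 * c + 1) n = Y
    rw [Int.emod_eq_emod_iff_emod_sub_eq_zero]
    ring_nf
    omega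
  rw [Int.odd_iff] at ha ⊢
  induction n using Nat.strong_induction_on with
  | _ n ih =>
    match n with
    | 0 => omega
    | 1 => rfl
    | 2 => rwa [lucasU_two]
    | n + 3 => rw [key]; exact ih n (by omega) (by omega)

theorem isCoprime_lucasU_lucasV {a : ℤ} {n : ℕ} (hn : Odd (lucasU a n)) :
    IsCoprime (lucasU a n) (lucasV a n) := by
  have h2 : IsCoprime (lucasU a n) 2 := Int.isCoprime_two_right.2 hn
  have := (h2.mul_right (isCoprime_lucasU a n)).add_mul_left_right (-a)
  rwa [mul_neg, ← sub_eq_add_neg, mul_comm _ a] at this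

theorem exists_sq_of_isCoprime {x y z : ℤ} (h : IsCoprime x y) (hx : 0 < x) (hy : 0 < y)
    (hz : z ^ 2 = x * y) : ∃ s t, x = s ^ 2 ∧ y = t ^ 2 := by
  obtain ⟨s, hs | hs⟩ := Int.sq_of_isCoprime h hz.symm
  · obtain ⟨t, ht | ht⟩ := Int.sq_of_isCoprime h.symm ((mul_comm y x).trans hz.symm)
    · exact ⟨s, t, hs, ht⟩
    · nlinarith [sq_nonneg t]
  · nlinarith [sq_nonneg s]

theorem sq_add_two_mul_neg_one_pow_ne (v t : ℤ) (n : ℕ) : v ^ 2 - 2 * (-1) ^ n ≠ t ^ 2 := by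
  intro h
  rcases neg_one_pow_eq_or ℤ n with e | e <;> rw [e] at h <;>
    rcases Int.even_or_odd' v with ⟨c, rfl | rfl⟩ <;>
    rcases Int.even_or_odd' t with ⟨d, rfl | rfl⟩ <;> ring_nf at h <;> omega

theorem sq_ne_lucasU_of_not_three_dvd {a : ℤ} (ha : Odd a) (ha1 : 1 ≤ a) {n : ℕ} (h4 : 4 ∣ n)
    (h3 : ¬ 3 ∣ n) (y : ℤ) : y ^ 2 ≠ lucasU a n := by
  intro h
  obtain ⟨m, rfl⟩ := h4
  have hm : 2 * m - 1 + 1 = 2 * m := by omega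
  rw [show 4 * m = 2 * (2 * m) by ring, lucasU_two_mul] at h
  obtain ⟨s, t, -, ht⟩ := exists_sq_of_isCoprime (isCoprime_lucasU_lucasV
    (odd_lucasU_of_not_three_dvd ha (by omega))) (hm ▸ lucasU_pos ha1 (2 * m - 1))
    (lucasV_pos ha1 _) h
  rw [lucasV_two_mul] at ht
  exact sq_add_two_mul_neg_one_pow_ne _ _ _ ht

/-- The two possible values of the discriminant of the quadratic equation satisfied by `x`
when `y ^ 2 = Uₘ₊₁`. -/
def DiscrIsSq (a : ℤ) (m : ℕ) : Prop :=
  ∃ z, z ^ 2 = (a + 1) ^ 2 * lucasU a (m + 1) + 4 * lucasU a m ∨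
    z ^ 2 = (a - 1) ^ 2 * lucasU a (m + 1) - 4 * lucasU a m

theorem sq_ne_sq_mul_add_four {v z : ℤ} (hv : v ≠ 0) (h : z ^ 2 = v ^ 2 + 4) : False := by
  have h1 : |z| ^ 2 = |v| ^ 2 + 4 := by rwa [sq_abs, sq_abs]
  have h2 := Int.one_le_abs hv
  have h3 : |v| < |z| := by
    by_contra! h4
    nlinarith [abs_nonneg z]
  have h5 : |v| + 2 ≤ |z| ∨ |z| = |v| + 1 := by omega
  rcases h5 with h5 | h5
  · nlinarith
  · rw [h5] at h1
    ring_nf at h1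
    omega

theorem eq_two_contradiction {a y : ℤ} (ha : 1 ≤ a) (hy : y ^ 2 = lucasU a 2)
    (h : DiscrIsSq a 1) : False := by
  obtain ⟨z, h | h⟩ := h <;> rw [lucasU_two] at h hy <;> subst hy <;>
    rw [lucasU_one] at h
  · refine sq_ne_sq_mul_add_four (v := (y ^ 2 + 1) * y) (z := z) ?_ (by linarith)
    rintro h0
    nlinarith
  · rcases eq_or_ne z 0 with rfl | hz
    · have h1 : y ^ 2 * (y ^ 2 - 1) ^ 2 = 4 := by linarith
      generalize y ^ 2 = t at ha h1
      have h2 : t ≤ 3 := by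
        by_contra! h3
        nlinarith
      interval_cases t <;> omega
    · exact sq_ne_sq_mul_add_four (v := z) (z := (y ^ 2 - 1) * y) hz (by linarith)

theorem eq_zero_of_odd {a : ℤ} (ha : Odd a) (ha1 : 1 ≤ a) {m : ℕ} {y : ℤ}
    (hy : y ^ 2 = lucasU a (m + 1))
    (h : DiscrIsSq a m) : m = 0 := by
  by_contra hm
  rcases (by omega : (m + 1) % 2 = 1 ∨ (m + 1) % 4 = 2 ∨ (m + 1) % 4 = 0) with h1 | h1 | h1
  · exact sq_ne_lucasU_of_odd ha ha1 (Nat.odd_iff.2 h1) (by omega) y hy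
  · rcases eq_or_ne m 1 with rfl | hm1
    · exact eq_two_contradiction ha1 hy h
    · exact sq_ne_lucasU_of_mod_four_eq_two ha ha1 h1 (by omega) y hy
  · by_cases h3 : 3 ∣ m + 1
    · obtain ⟨z, h | h⟩ := h
      · exact sq_ne_of_four_dvd ha ha1 (by omega) z h
      · exact sq_ne_of_six_dvd ha (by omega) z h
    · exact sq_ne_lucasU_of_not_three_dvd ha ha1 (by omega) h3 y hy

section Sieve

/-- `f x`, written so that the kernel evaluates `x` before substituting it. -/
def forceNat {α : Type} (x : ℕ) (f : ℕ → α) : α :=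
  Nat.rec (f 0) (fun n _ => f (Nat.succ n)) x

@[simp] theorem forceNat_eq {α : Type} (x : ℕ) (f : ℕ → α) : forceNat x f = f x := by
  cases x <;> rfl

/-- Calls `k` on `Uₙ` and `Uₙ₊₁` modulo `p`, computed by doubling. -/
def withLucasMod (a p : ℕ) : ℕ → ℕ → (ℕ → ℕ → Bool) → Bool
  | 0, n, k => Nat.beq n 0 && k 0 1
  | i + 1, n, k =>
    forceNat (n / 2) fun h => withLucasMod a p i h fun x y =>
      forceNat (x * (2 * y + (p - a % p) * x) % p) fun x' =>
      forceNat ((x * x + y * y) % p) fun y' =>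
      bif Nat.beq (n % 2) 1 then forceNat ((a * y' + x') % p) fun z => k y' z else k x' y'

theorem cast_neg_residue (a p : ℕ) (hp : 0 < p) : ((p - a % p : ℕ) : ZMod p) = -(a : ZMod p) := by
  rw [Nat.cast_sub (Nat.mod_lt a hp).le, ZMod.natCast_mod, ZMod.natCast_self, zero_sub]

theorem withLucasMod_spec {a p : ℕ} (hp : 0 < p) (i : ℕ) {n : ℕ} {k : ℕ → ℕ → Bool}
    (h : withLucasMod a p i n k = true) :
    ∃ x y, k x y = true ∧ (lucasU a n : ZMod p) = x ∧ (lucasU a (n + 1) : ZMod p) = y := by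
  induction i generalizing n k with
  | zero =>
    simp only [withLucasMod, Bool.and_eq_true, Nat.beq_eq] at h
    obtain ⟨rfl, h⟩ := h
    exact ⟨0, 1, h, by simp, by simp⟩
  | succ i ih =>
    simp only [withLucasMod, forceNat_eq] at h
    obtain ⟨x, y, hk, hx, hy⟩ := ih h
    clear h
    generalize hm : n / 2 = m at hx hy
    have h1 : (lucasU a (2 * m) : ZMod p) =
        (x * (2 * y + (p - a % p) * x) % p : ℕ) := by
      rw [ZMod.natCast_mod, lucasU_two_mul, lucasV]
      push_cast [cast_neg_residue a p hp, hx, hy]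
      ring
    have h2 : (lucasU a (2 * m + 1) : ZMod p) = ((x * x + y * y) % p : ℕ) := by
      rw [ZMod.natCast_mod, lucasU_two_mul_add_one]
      push_cast [hx, hy]
      ring
    rcases Nat.mod_two_eq_zero_or_one n with hn | hn
    · have hnm : n = 2 * m := by omega
      rw [hn] at hk
      refine ⟨_, _, hk, ?_, ?_⟩
      · rw [hnm, h1]
      · rw [hnm, h2]
    · have hnm : n = 2 * m + 1 := by omega
      rw [hn] at hk
      refine ⟨_, _, hk, ?_, ?_⟩
      · rw [hnm, h2]
      · rw [hnm, lucasU_add_two]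
        push_cast [h1, h2, ZMod.natCast_mod]
        ring

/-- A sufficient criterion for `v` to be a quadratic nonresidue modulo the prime `p`. -/
def isNonresidue (p v : ℕ) : Bool := Nat.beq (v ^ ((p - 1) / 2) % p) (p - 1)

theorem not_isSquare_of_isNonresidue {p v : ℕ} [Fact p.Prime] (hp : p ≠ 2)
    (h : isNonresidue p v = true) : ¬ IsSquare (v : ZMod p) := by
  have hp1 := (Fact.out : p.Prime).two_le
  have h1 : (v : ZMod p) ^ (p / 2) = -1 := by
    have h2 := Nat.eq_of_beq_eq_true h
    have h3 : (p - 1) / 2 = p / 2 := by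
      have := (Fact.out : p.Prime).eq_two_or_odd
      omega
    rw [← h3, ← Nat.cast_pow, ← ZMod.natCast_mod, h2, Nat.cast_sub (by omega)]
    simp
  have h0 : (v : ZMod p) ≠ 0 := by
    intro h0
    rw [h0, zero_pow (by omega)] at h1
    exact one_ne_zero (α := ZMod p) (by rw [← neg_neg (1 : ZMod p), ← h1, neg_zero])
  rw [ZMod.euler_criterion p h0, h1]
  have : Fact (2 < p) := ⟨by omega⟩
  exact ZMod.neg_one_ne_one

/-- A primality test for odd numbers below `22201 = 149 ^ 2`. -/
def isSmallOddPrime (p : ℕ) : Bool :=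
  Nat.ble 3 p && Nat.ble p 22200 &&
    (Nat.beq (Nat.gcd p (Nat.factorial 148)) 1 ||
      (Nat.ble p 168 && Nat.beq (Nat.gcd p (Nat.factorial 12)) 1) ||
      Nat.beq p 3 || Nat.beq p 5 || Nat.beq p 7 || Nat.beq p 11)

theorem prime_of_gcd_factorial {p k : ℕ} (h1 : 2 ≤ p) (hk : p < (k + 1) ^ 2)
    (h : Nat.gcd p k.factorial = 1) : p.Prime := by
  by_contra hp
  have h2 := Nat.minFac_sq_le_self (by omega) hp
  have h3 : p.minFac ≤ k := by
    by_contra! h3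
    have := Nat.pow_le_pow_left (show k + 1 ≤ p.minFac by omega) 2
    omega
  have h4 := Nat.dvd_gcd p.minFac_dvd (Nat.dvd_factorial p.minFac_pos h3)
  rw [h, Nat.dvd_one, Nat.minFac_eq_one_iff] at h4
  omega

theorem prime_of_isSmallOddPrime {p : ℕ} (h : isSmallOddPrime p = true) : p.Prime ∧ p ≠ 2 := by
  simp only [isSmallOddPrime, Bool.and_eq_true, Bool.or_eq_true, Nat.ble_eq,
    Nat.beq_eq] at h
  obtain ⟨⟨h3, hlt⟩, ((((h | h) | h) | h) | h) | h⟩ := h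
  · exact ⟨prime_of_gcd_factorial (by omega) (by omega) h, by omega⟩
  · exact ⟨prime_of_gcd_factorial (by omega) (by omega) h.2, by omega⟩
  all_goals subst h; norm_num

/-- The property of `m` that is sieved: `m` is even, `Uₘ₊₁` is a square and, if `w` is set,
so is `9 Uₘ₊₁ + 4 Uₘ`. -/
def SieveSol (w : Bool) (a m : ℕ) : Prop :=
  Even m ∧ IsSquare (lucasU a (m + 1)) ∧
    (w = true → IsSquare (9 * lucasU a (m + 1) + 4 * lucasU a m))

/-- Walks through the indices `m` in an arithmetic progression with difference `s`, given
`Uₘ` and `Uₘ₊₁` modulo `p` at the start and `Uₛ`, `Uₛ₊₁`, `Uₛ₋₁`, and marks those that do not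
satisfy `SieveSol`. -/
def sieveRow (w : Bool) (p xs ys zs : ℕ) : List Bool → ℕ → ℕ → List Bool
  | [], _, _ => []
  | d :: l, x, y =>
    forceNat ((y * xs + x * zs) % p) fun u =>
    forceNat ((y * ys + x * xs) % p) fun v =>
      (d || isNonresidue p v || (w && isNonresidue p ((9 * v + 4 * u) % p))) ::
        sieveRow w p xs ys zs l u v

/-- The marked entries of `l`, at `c, c + M, c + 2 M, …`, all satisfy `P`. -/
def MarkedSatisfy (P : ℕ → Prop) (M : ℕ) : List Bool → ℕ → Prop
  | [], _ => True
  | d :: l, c => (d = true → P c) ∧ MarkedSatisfy P M l (c + M)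

theorem lucasU_add' (a : ℤ) (m s : ℕ) : lucasU a (m + s) =
    lucasU a (m + 1) * lucasU a s + lucasU a m * (lucasU a (s + 1) - a * lucasU a s) := by
  cases s with
  | zero => simp
  | succ s => rw [← add_assoc, lucasU_add, lucasU_add_two]; ring

theorem markedSatisfy_sieveRow {w : Bool} {a p t M N e xs ys zs : ℕ} (hp : p.Prime) (hp2 : p ≠ 2)
    (ht : t ∣ N) (h0 : (lucasU a t : ZMod p) = 0) (h1 : (lucasU a (t + 1) : ZMod p) = 1)
    (ht0 : 0 < t)
    (hx : (lucasU a (M % t) : ZMod p) = xs) (hy : (lucasU a (M % t + 1) : ZMod p) = ys)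
    (hz : (zs : ZMod p) = ys - a * xs) (l : List Bool) (c x y : ℕ)
    (hl : MarkedSatisfy (fun c => ∀ m, m + e ≡ c [MOD N] → ¬ SieveSol w a m) M l (c + M))
    (hs : ∀ m, m + e ≡ c [MOD t] → (lucasU a m : ZMod p) = x ∧ (lucasU a (m + 1) : ZMod p) = y) :
    MarkedSatisfy (fun c => ∀ m, m + e ≡ c [MOD N] → ¬ SieveSol w a m) M
      (sieveRow w p xs ys zs l x y) (c + M) := by
  have := Fact.mk hp
  induction l generalizing c x y with
  | nil => trivial
  | cons d l ih =>
    simp only [sieveRow, forceNat_eq]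
    obtain ⟨hd, hl⟩ := hl
    have hs' : ∀ m, m + e ≡ c + M [MOD t] →
        (lucasU a m : ZMod p) = ((y * xs + x * zs) % p : ℕ) ∧
        (lucasU a (m + 1) : ZMod p) = ((y * ys + x * xs) % p : ℕ) := by
      intro m hm
      have hlt := Nat.mod_lt M ht0
      obtain ⟨hmx, hmy⟩ := hs (m + (t - M % t)) (by
        refine Nat.ModEq.add_right_cancel' (M % t) ?_
        rw [show m + (t - M % t) + e + M % t = m + e + t by omega]
        refine (Nat.add_mod_right (m + e) t : _ ≡ _ [MOD t]).trans (hm.trans ?_)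
        exact (Nat.mod_modEq M t).symm.add_left c)
      have hper : m + (t - M % t) + M % t = m + t := by omega
      constructor
      · have e1 := lucasU_add' a (m + (t - M % t)) (M % t)
        rw [hper, lucasU_add'] at e1
        have e2 := congrArg (Int.cast : ℤ → ZMod p) e1
        push_cast [h0, h1, hmx, hmy, hx, hy] at e2
        push_cast [ZMod.natCast_mod, hz]
        linear_combination e2
      · have e1 := lucasU_add a (m + (t - M % t)) (M % t)
        rw [hper, lucasU_add] at e1
        have e2 := congrArg (Int.cast : ℤ → ZMod p) e1
        push_cast [h0, h1, hmx, hmy, hx, hy] at e2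
        push_cast [ZMod.natCast_mod]
        linear_combination e2
    refine ⟨fun h m hm hsol => ?_, ih _ _ _ hl hs'⟩
    obtain ⟨hmx, hmy⟩ := hs' m (hm.of_dvd ht)
    simp only [Bool.or_eq_true, Bool.and_eq_true] at h
    obtain ⟨hev, hsq, hw⟩ := hsol
    have hmap : ∀ z : ℤ, IsSquare z → IsSquare (z : ZMod p) := fun z hz =>
      hz.map (Int.castRingHom (ZMod p))
    rcases h with (h | h) | ⟨hw', h⟩
    · exact hd h m hm ⟨hev, hsq, hw⟩
    · exact not_isSquare_of_isNonresidue hp2 h (hmy ▸ hmap _ hsq)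
    · refine not_isSquare_of_isNonresidue hp2 h ?_
      have := hmap _ (hw hw')
      push_cast [hmx, hmy] at this
      rw [ZMod.natCast_mod]
      push_cast
      exact this

/-- Marks the nonzero multiples of `M` modulo `N`, shifted by `0` and by `-2`, using the pairs
`(p, t)` of a prime and a period of the sequence modulo that prime, and tests that all are
marked. -/
def sieveStep (w : Bool) (a M N : ℕ) : List (ℕ × ℕ) → List Bool → List Bool → Bool
  | [], l, l' => l.all id && l'.all id
  | (p, t) :: ps, l, l' =>
    forceNat p fun p => forceNat t fun t =>
    isSmallOddPrime p && Nat.ble 1 t && Nat.beq (N % t) 0 &&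
    withLucasMod a p 17 t (fun x y => Nat.beq x 0 && Nat.beq y 1) &&
    forceNat (M % t) fun s => withLucasMod a p 17 s fun x y =>
    forceNat ((y + (p - a % p) * x) % p) fun z =>
    sieveStep w a M N ps (sieveRow w p x y z l 0 1) (sieveRow w p x y z l' (p - a % p) 1)

theorem sieveStep_spec {w : Bool} {a M N : ℕ} {ps : List (ℕ × ℕ)} {l l' : List Bool}
    (h : sieveStep w a M N ps l l' = true)
    (hl : MarkedSatisfy (fun c => ∀ m, m + 0 ≡ c [MOD N] → ¬ SieveSol w a m) M l M)
    (hl' : MarkedSatisfy (fun c => ∀ m, m + 2 ≡ c [MOD N] → ¬ SieveSol w a m) M l' M) :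
    ∃ r r' : List Bool, r.length = l.length ∧ r'.length = l'.length ∧ (∀ d ∈ r, d = true) ∧
      (∀ d ∈ r', d = true) ∧
      MarkedSatisfy (fun c => ∀ m, m + 0 ≡ c [MOD N] → ¬ SieveSol w a m) M r M ∧
      MarkedSatisfy (fun c => ∀ m, m + 2 ≡ c [MOD N] → ¬ SieveSol w a m) M r' M := by
  have hlen : ∀ p x y z l u v, (sieveRow w p x y z l u v).length = l.length := by
    intro p x y z l
    induction l with
    | nil => intros; rfl
    | cons d l ih => intros; simp [sieveRow, ih]
  induction ps generalizing l l' with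
  | nil =>
    simp only [sieveStep, Bool.and_eq_true, List.all_eq_true, id] at h
    exact ⟨l, l', rfl, rfl, h.1, h.2, hl, hl'⟩
  | cons q ps ih =>
    obtain ⟨p, t⟩ := q
    simp only [sieveStep, forceNat_eq, Bool.and_eq_true, Nat.ble_eq, Nat.beq_eq] at h
    obtain ⟨⟨⟨⟨hp, ht0⟩, htN⟩, hper⟩, h⟩ := h
    obtain ⟨hp, hp2⟩ := prime_of_isSmallOddPrime hp
    obtain ⟨x0, y0, he, h0, h1⟩ := withLucasMod_spec hp.pos _ hper
    simp only [Bool.and_eq_true, Nat.beq_eq] at he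
    obtain ⟨rfl, rfl⟩ := he
    rw [Nat.cast_zero] at h0
    rw [Nat.cast_one] at h1
    obtain ⟨x, y, h, hx, hy⟩ := withLucasMod_spec hp.pos _ h
    have hz : (((y + (p - a % p) * x) % p : ℕ) : ZMod p) = y - a * x := by
      push_cast [ZMod.natCast_mod, cast_neg_residue a p hp.pos]
      ring
    have htN := Nat.dvd_of_mod_eq_zero htN
    have hbase : ∀ m, m ≡ 0 [MOD t] →
        (lucasU a m : ZMod p) = 0 ∧ (lucasU a (m + 1) : ZMod p) = 1 := by
      intro m hm
      obtain ⟨k, rfl⟩ := (Nat.modEq_zero_iff_dvd).1 hm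
      induction k with
      | zero => simp
      | succ k ihk =>
        obtain ⟨i1, i2⟩ := ihk (by simp [Nat.modEq_zero_iff_dvd])
        rw [mul_add_one, lucasU_add', lucasU_add]
        push_cast [i1, i2, h0, h1]
        simp
    obtain ⟨r, r', hr⟩ := ih h
      (by
        have := markedSatisfy_sieveRow hp hp2 htN h0 h1 ht0 hx hy hz l 0 0 1 (e := 0) (w := w)
            (by simpa using hl)
          (fun m hm => by simpa using hbase m hm)
        simpa using this)
      (by
        have := markedSatisfy_sieveRow hp hp2 htN h0 h1 ht0 hx hy hz l' 0 (p - a % p) 1 (e := 2)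
            (w := w)
          (by simpa using hl')
          (fun m hm => by
            obtain ⟨i1, i2⟩ := hbase _ hm
            rw [lucasU_add_two] at i1 i2
            rw [lucasU_add_two] at i2
            push_cast at i1 i2
            rw [cast_neg_residue a p hp.pos, Nat.cast_one]
            have i3 : (lucasU a (m + 1) : ZMod p) = 1 := by linear_combination i2 - a * i1
            exact ⟨by linear_combination i1 - a * i3, i3⟩)
        simpa using this)
    refine ⟨r, r', ?_⟩
    rwa [hlen, hlen] at hr

theorem MarkedSatisfy.of_forall {P : ℕ → Prop} {M : ℕ} {r : List Bool} (hr : ∀ d ∈ r, d = true)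
    {c : ℕ} (h : MarkedSatisfy P M r c) {j : ℕ} (hj : j < r.length) : P (c + M * j) := by
  induction r generalizing c j with
  | nil => simp at hj
  | cons d r ih =>
    obtain ⟨h1, h2⟩ := h
    cases j with
    | zero => simpa using h1 (hr d (by simp))
    | succ j =>
      have := ih (fun d hd => hr d (by simp [hd])) h2 (j := j) (by simpa using hj)
      rwa [add_assoc, ← mul_one_add, add_comm 1 j] at this

theorem markedSatisfy_replicate (P : ℕ → Prop) (M n c : ℕ) :
    MarkedSatisfy P M (List.replicate n false) c := by
  induction n generalizing c with
  | zero => trivial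
  | succ n ih => exact ⟨by simp, ih _⟩

/-- Repeatedly multiplies the modulus `M` by the first entries of the list, up to a modulus that
exceeds `2 * 10 ^ 20`. -/
def sieveChain (w : Bool) (a : ℕ) : ℕ → List (ℕ × List (ℕ × ℕ)) → Bool
  | M, [] => Nat.ble (2 * 10 ^ 20 + 2) M
  | M, (q, ps) :: L => forceNat (M * q) fun N =>
    Nat.ble 1 q && sieveStep w a M N ps (List.replicate (q - 1) false)
      (List.replicate (q - 1) false) && sieveChain w a N L

theorem eq_zero_of_sieveChain {w : Bool} {a M : ℕ} {L : List (ℕ × List (ℕ × ℕ))} (hM : 0 < M)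
    (h : sieveChain w a M L = true)
    (hdvd : ∀ m, SieveSol w a m → M ∣ m ∨ M ∣ m + 2) {m : ℕ} (hm : SieveSol w a m)
    (hlt : m < 2 * 10 ^ 20) : m = 0 := by
  induction L generalizing M with
  | nil =>
    have h1 := Nat.le_of_ble_eq_true h
    rcases hdvd m hm with h2 | h2
    · by_contra h3
      have := Nat.le_of_dvd (by omega) h2
      omega
    · have := Nat.le_of_dvd (Nat.succ_pos _) h2
      omega
  | cons q L ih =>
    obtain ⟨q, ps⟩ := q
    simp only [sieveChain, forceNat_eq, Bool.and_eq_true, Nat.ble_eq] at h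
    obtain ⟨⟨hq, h⟩, h'⟩ := h
    obtain ⟨r, r', hr1, hr2, hr3, hr4, hr5, hr6⟩ := sieveStep_spec h
      (markedSatisfy_replicate _ _ _ _) (markedSatisfy_replicate _ _ _ _)
    rw [List.length_replicate] at hr1 hr2
    refine ih (Nat.mul_pos hM hq) h' fun m hm => ?_
    have key : ∀ e, ∀ r : List Bool, r.length = q - 1 → (∀ d ∈ r, d = true) →
        MarkedSatisfy (fun c => ∀ m, m + e ≡ c [MOD M * q] → ¬ SieveSol w a m) M r M →
        M ∣ m + e → M * q ∣ m + e := by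
      intro e r hr hr' hP ⟨k, hk⟩
      rw [hk]
      refine mul_dvd_mul_left M (Nat.dvd_of_mod_eq_zero ?_)
      by_contra hne
      have hkq := Nat.mod_lt k hq
      refine hP.of_forall hr' (j := k % q - 1) (by omega) m ?_ hm
      rw [hk, ← mul_one_add, show 1 + (k % q - 1) = k % q by omega]
      exact (Nat.mod_modEq k q).symm.mul_left' M
    rcases hdvd m hm with h2 | h2
    · exact Or.inl (key 0 r hr1 hr3 hr5 h2)
    · exact Or.inr (key 2 r' hr2 hr4 hr6 h2)

end Sieve

section SieveData

/-- For `b = 1, 2, …, 43`, a list of factors, whose product with `4` exceeds `2 * 10 ^ 20`, each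
with pairs of a prime and a period of `lucasU (2 * b)` modulo that prime. -/
def sieveData : List (List (ℕ × List (ℕ × ℕ))) := [
  [(2, [(3, 8)]), (3, [(5, 12), (11, 24)]), (5, [(19, 40), (29, 20), (31, 30)]), (3, [(73, 72),
    (199, 18), (6481, 180)]), (3, [(53, 108)]), (3, [(487, 162), (1619, 3240)]), (3, [(971, 1944)]),
    (3, [(4373, 2916), (20411, 5832)]), (5, [(149, 300), (151, 150)]), (5, [(499, 1000),
    (13499, 27000)]), (7, [(13, 28), (71, 70), (83, 168)]), (7, [(293, 196), (587, 1176),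
    (1471, 98)]), (7, [(6173, 4116), (8233, 8232), (12347, 8232), (13721, 3430)]), (11, [(23, 22),
    (43, 88), (89, 88)]), (11, [(727, 726), (1451, 968), (1693, 3388)]), (11, [(2663, 2662),
    (5323, 10648)]), (13, [(79, 26), (181, 364)]), (13, [(1013, 676), (2027, 1352), (3719, 3718),
    (4057, 4056)]), (17, [(67, 136), (101, 204), (409, 102)]), (17, [(1733, 1156), (3467, 2312)]),
    (19, [(37, 76), (191, 190), (227, 152), (379, 152), (647, 646)]), (23, [(47, 46), (229, 92),
    (643, 184), (827, 552)]), (29, [(173, 348), (233, 232), (347, 696), (1567, 1566)])],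
  [(2, [(3, 8)]), (2, [(7, 16)]), (2, [(47, 32)]), (2, [(2207, 64)]), (2, [(1087, 128)]), (2,
    [(127, 256)]), (5, [(5, 20), (11, 10), (41, 40)]), (3, [(181, 30), (19583, 768)]), (3,
    [(53, 36), (271, 90)]), (3, [(647, 432), (1621, 270)]), (3, [(3889, 1296)]), (5, [(101, 50),
    (1801, 600)]), (5, [(251, 250), (751, 250), (2251, 250)]), (7, [(13, 28), (29, 14), (71, 70)]),
    (2, [(16127, 10752)]), (2, [(3583, 7168)]), (2, [(21503, 2048)]), (2, [(6143, 4096)]), (7,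
    [(97, 196), (293, 196), (587, 392), (1471, 490)]), (11, [(43, 88), (89, 44), (197, 132),
    (263, 176)]), (11, [(1693, 3388), (2903, 1936), (3389, 1694), (3631, 1210)]), (13, [(79, 26),
    (103, 208), (131, 130)]), (13, [(337, 676), (1013, 676), (2027, 1352), (3719, 3718)]), (17,
    [(67, 136), (239, 238), (373, 748), (409, 136)]), (17, [(577, 1156), (1733, 1156), (3467, 2312),
    (16183, 32368)]), (19, [(37, 76), (113, 76), (191, 190), (227, 152)]), (19, [(2887, 5776),
    (8663, 5776), (10831, 3610), (17327, 11552), (21661, 3610)]), (23, [(137, 92), (139, 46),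
    (367, 736), (599, 598), (691, 46)]), (29, [(59, 58), (173, 116), (347, 232), (349, 58),
    (463, 928)])],
  [(2, [(19, 8)]), (2, [(7, 16)]), (3, [(11, 24), (23, 48)]), (2, [(47, 96)]), (2, [(1823, 192)]),
    (2, [(7103, 384)]), (2, [(127, 256)]), (3, [(17, 36)]), (5, [(5, 20), (29, 60), (41, 40)]), (3,
    [(269, 540), (863, 1728)]), (3, [(163, 162), (1619, 3240)]), (3, [(971, 1944), (2917, 486)]),
    (5, [(149, 300), (151, 150)]), (5, [(751, 750), (1499, 1000), (3001, 1500)]), (7, [(43, 42),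
    (71, 70), (349, 700)]), (2, [(16127, 32256)]), (2, [(3583, 7168)]), (2, [(21503, 43008)]), (2,
    [(6143, 12288)]), (7, [(97, 196), (197, 98)]), (7, [(1373, 686), (7547, 686)]), (11, [(67, 22),
    (89, 88), (109, 220), (263, 176), (397, 198)]), (11, [(967, 1936), (1451, 2904)]), (13,
    [(53, 26), (79, 78)]), (13, [(337, 676), (3719, 3718), (4733, 676)]), (17, [(101, 204),
    (239, 238), (307, 306), (409, 408)]), (17, [(577, 1156), (5779, 11560), (6359, 6358),
    (8669, 17340)]), (19, [(113, 228), (191, 38), (379, 760), (607, 1216)]), (19, [(2887, 5776),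
    (7219, 14440), (8663, 5776), (10831, 2166), (18773, 18772)]), (23, [(137, 92), (229, 460),
    (277, 92), (367, 736)])],
  [(2, [(3, 8)]), (2, [(7, 16)]), (2, [(79, 32)]), (2, [(31, 64)]), (3, [(479, 192)]), (3,
    [(19, 18), (71, 144)]), (3, [(107, 216)]), (5, [(29, 60), (269, 180)]), (2, [(2239, 640)]), (2,
    [(1151, 2304)]), (2, [(11519, 2560)]), (3, [(809, 1620), (2591, 5184)]), (5, [(101, 100)]), (5,
    [(251, 250), (499, 1000), (3499, 1000)]), (7, [(41, 84), (43, 42), (127, 14), (139, 280)]), (7,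
    [(97, 196), (491, 490), (881, 1764)]), (11, [(89, 88), (109, 220), (131, 264), (331, 330)]), (3,
    [(3889, 486), (5347, 5346)]), (7, [(1373, 1372), (8231, 16464), (15091, 30184)]), (11,
    [(241, 484), (727, 726), (1453, 242), (1693, 3388)]), (13, [(53, 26), (157, 26), (181, 364),
    (859, 286)]), (13, [(337, 676), (1013, 2028), (3719, 3718), (9463, 18928), (10139, 20280),
    (18251, 12168)]), (17, [(17, 68), (103, 102), (137, 136), (307, 306)]), (17, [(3469, 1156),
    (6359, 6358), (8093, 4046), (13873, 13872)]), (19, [(37, 76), (113, 76), (191, 190),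
    (227, 456)]), (19, [(2887, 5776), (7219, 2888), (8663, 5776), (10831, 2166)]), (23, [(47, 46),
    (367, 736), (461, 230), (827, 1656)])],
  [(2, [(3, 8)]), (2, [(7, 16)]), (7, [(113, 112), (197, 28)]), (3, [(41, 84)]), (2, [(47, 96)]),
    (2, [(31, 64)]), (2, [(2111, 384)]), (2, [(383, 256)]), (3, [(19, 18)]), (2, [(16127, 32256)]),
    (2, [(3583, 7168)]), (3, [(107, 216), (431, 864)]), (3, [(163, 162), (18143, 36288)]), (5,
    [(11, 10), (29, 60), (179, 360)]), (2, [(15359, 30720)]), (2, [(6143, 12288)]), (3,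
    [(6803, 13608), (9721, 4860)]), (5, [(449, 300), (1051, 1050)]), (5, [(751, 250), (11251, 750),
    (13999, 28000)]), (7, [(97, 196), (1567, 3136)]), (11, [(23, 22), (43, 88), (67, 22)]), (11,
    [(241, 484), (727, 242), (967, 1936), (2179, 2178), (3631, 3630)]), (13, [(13, 52), (79, 78),
    (181, 364), (313, 312), (701, 468)]), (13, [(1013, 2028), (2027, 4056), (4057, 4056)]), (17,
    [(271, 544), (307, 306), (373, 748), (613, 612)]), (17, [(577, 1156), (1733, 3468),
    (3469, 1156), (8093, 8092)]), (19, [(151, 304), (229, 38), (647, 646), (797, 1596)]), (19,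
    [(7219, 14440), (8663, 17328), (11551, 23104), (17327, 11552)]), (23, [(137, 276), (461, 460),
    (599, 598), (691, 230)])],
  [(10, [(11, 10), (19, 40), (41, 40)]), (3, [(7, 6), (89, 60)]), (2, [(23, 48)]), (2,
    [(79, 160)]), (2, [(31, 64)]), (2, [(191, 128)]), (2, [(383, 768)]), (3, [(17, 36),
    (179, 360)]), (2, [(6911, 4608)]), (3, [(271, 54), (2971, 270)]), (3, [(811, 810)]), (5,
    [(101, 100), (199, 400)]), (5, [(499, 1000), (2999, 6000)]), (7, [(13, 28), (71, 14),
    (211, 42)]), (2, [(3583, 7168)]), (2, [(5119, 10240)]), (7, [(97, 196), (197, 98),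
    (4409, 1764)]), (7, [(1373, 686), (6173, 12348), (8231, 16464)]), (11, [(43, 88), (67, 66),
    (109, 220), (131, 88)]), (3, [(10691, 21384)]), (11, [(241, 484), (967, 1936), (2179, 2178)]),
    (13, [(53, 52), (103, 208), (157, 78), (311, 208)]), (13, [(677, 338), (2027, 1352),
    (5407, 10816), (10141, 3380), (11831, 11830)]), (17, [(137, 136), (307, 306), (443, 442)]), (17,
    [(577, 1156), (1733, 3468), (2311, 4624), (3469, 3468), (14449, 28900), (15607, 5202)]), (19,
    [(113, 228), (227, 456), (229, 114)]), (23, [(47, 46), (139, 46), (599, 598), (643, 184)]), (29,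
    [(233, 232), (347, 696), (349, 348), (463, 928), (929, 928), (1103, 58)])],
  [(2, [(3, 8)]), (5, [(5, 20), (19, 40)]), (5, [(151, 50), (751, 50)]), (7, [(13, 28), (83, 56),
    (113, 56)]), (3, [(73, 24), (8191, 210)]), (3, [(53, 36), (107, 72)]), (3, [(1619, 1080),
    (2267, 216)]), (5, [(499, 1000), (1499, 1000), (3001, 500), (3499, 7000)]), (7, [(293, 196),
    (587, 392)]), (7, [(6173, 1372), (8233, 2744), (13721, 3430)]), (11, [(23, 22), (43, 88),
    (89, 88), (109, 220)]), (11, [(727, 242), (1451, 968), (1693, 3388), (3631, 1210),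
    (10163, 6776)]), (11, [(2663, 2662), (5323, 10648)]), (13, [(79, 26), (181, 364), (313, 26),
    (467, 312)]), (13, [(1013, 676), (2027, 1352), (3719, 3718)]), (9, [(4373, 972), (6803, 4536),
    (17497, 1944)]), (3, [(21871, 7290)]), (17, [(67, 136), (101, 68), (103, 34), (409, 34)]), (17,
    [(1733, 1156), (3467, 2312), (5779, 11560), (6359, 6358), (8669, 5780), (20231, 20230)]), (19,
    [(37, 76), (191, 190), (227, 152), (379, 152), (647, 646)]), (23, [(47, 46), (229, 92),
    (643, 184), (827, 184)]), (19, [(7219, 14440), (10831, 3610), (16607, 16606)]), (29,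
    [(173, 116), (233, 232), (347, 232), (811, 1624)])],
  [(2, [(3, 8)]), (2, [(23, 16)]), (2, [(431, 32)]), (2, [(31, 64)]), (3, [(7, 6), (263, 48)]),
    (3, [(17, 36), (71, 144)]), (2, [(2879, 1152)]), (2, [(127, 256)]), (3, [(53, 108)]), (2,
    [(6911, 13824)]), (3, [(163, 162), (10691, 648)]), (5, [(5, 20), (19, 40), (59, 120)]), (3,
    [(487, 486), (9719, 19440)]), (3, [(1459, 1458), (2917, 2916)]), (5, [(101, 50), (1951, 50),
    (2399, 1600)]), (2, [(12799, 25600)]), (2, [(15359, 6144)]), (5, [(499, 1000), (4001, 4000)]),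
    (7, [(29, 28), (41, 84), (211, 42), (349, 140)]), (7, [(197, 196), (491, 98)]), (7,
    [(1373, 1372), (8231, 16464)]), (11, [(67, 66), (109, 220), (199, 198), (353, 44)]), (5,
    [(4999, 10000), (7499, 5000), (13751, 13750)]), (11, [(241, 484), (1451, 968), (1693, 484),
    (2903, 5808), (3631, 242)]), (13, [(13, 52), (79, 78), (103, 208), (131, 130), (521, 520)]),
    (13, [(337, 676), (1013, 2028), (2027, 1352), (2029, 1014)]), (17, [(137, 136), (271, 544),
    (307, 102), (373, 748)]), (17, [(1733, 1156), (3467, 6936), (5779, 11560)]), (19, [(113, 228),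
    (151, 304), (191, 190), (379, 760)]), (23, [(47, 46), (139, 138), (229, 460), (967, 322),
    (1381, 1380)])],
  [(2, [(163, 8)]), (2, [(7, 16)]), (2, [(47, 32)]), (5, [(11, 10), (199, 80)]), (3, [(31, 30),
    (59, 120)]), (2, [(479, 960)]), (2, [(191, 128)]), (2, [(383, 768)]), (3, [(17, 36), (19, 18)]),
    (3, [(107, 216), (269, 540)]), (3, [(809, 1620), (2593, 1296)]), (3, [(487, 486), (1459, 486)]),
    (5, [(401, 50), (1601, 800)]), (5, [(2999, 6000), (3001, 3000), (21001, 1500)]), (7, [(29, 14),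
    (83, 168), (113, 112), (127, 126)]), (2, [(16127, 32256)]), (2, [(12799, 25600)]), (2,
    [(5119, 2048)]), (2, [(6143, 12288)]), (7, [(97, 196), (2647, 294)]), (11, [(23, 22), (43, 88),
    (67, 66)]), (11, [(967, 1936), (1451, 2904), (2179, 242)]), (13, [(53, 26), (233, 468),
    (311, 624), (389, 780), (547, 546), (701, 156)]), (13, [(2027, 4056), (3041, 6084), (4057, 338),
    (8111, 16224)]), (17, [(103, 102), (373, 748), (409, 408), (953, 952)]), (17, [(577, 1156),
    (2311, 4624), (3467, 2312), (8669, 3468), (14449, 5780), (16183, 32368)]), (19, [(37, 76),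
    (151, 304), (229, 38), (379, 760)]), (23, [(137, 92), (599, 46), (919, 1840)]), (29,
    [(173, 116), (463, 928), (521, 1044), (811, 1624)])],
  [(2, [(3, 8)]), (2, [(7, 16)]), (7, [(43, 14), (449, 112)]), (3, [(11, 24), (167, 336)]), (3,
    [(19, 18), (37, 36)]), (2, [(431, 288)]), (3, [(971, 216), (2699, 216)]), (2, [(863, 1728)]),
    (2, [(191, 384)]), (2, [(127, 256)]), (2, [(1279, 512)]), (2, [(3583, 7168)]), (2,
    [(5119, 2048)]), (2, [(6143, 12288)]), (3, [(2269, 2268), (2593, 2592)]), (5, [(29, 60),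
    (71, 70)]), (3, [(6317, 972), (9721, 9720)]), (5, [(149, 300), (349, 700), (601, 50)]), (5,
    [(251, 250), (13499, 27000)]), (7, [(197, 196), (293, 588), (881, 1764)]), (11, [(23, 22),
    (109, 220), (769, 1540)]), (11, [(241, 484), (727, 726), (2179, 2178)]), (13, [(79, 78),
    (103, 208), (131, 130), (157, 78)]), (13, [(677, 676), (1013, 2028), (2027, 4056), (2029, 338),
    (10139, 4056)]), (17, [(137, 136), (239, 238), (409, 102)]), (17, [(577, 1156), (2311, 4624),
    (6359, 6358), (8093, 4046), (13873, 3468), (17341, 17340)]), (19, [(113, 228), (151, 304),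
    (761, 380), (797, 532), (911, 1824), (1217, 1216)]), (19, [(2887, 5776), (7219, 14440),
    (10831, 3610), (18773, 9386)]), (23, [(47, 46), (229, 92), (691, 690), (829, 828),
    (919, 1840)])],
  [(2, [(3, 8)]), (2, [(7, 16)]), (3, [(23, 48), (487, 6)]), (3, [(17, 36), (37, 18)]), (3,
    [(107, 216), (541, 108)]), (3, [(647, 1296)]), (3, [(971, 1944), (3889, 1944)]), (5, [(19, 40),
    (41, 20), (179, 360)]), (2, [(79, 160)]), (2, [(31, 64)]), (2, [(191, 128)]), (2, [(383, 256)]),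
    (2, [(1279, 512)]), (2, [(12799, 5120)]), (5, [(101, 100), (149, 100), (3299, 600)]), (5,
    [(251, 250), (751, 750), (3001, 1500)]), (7, [(13, 28), (29, 28), (43, 42), (83, 168)]), (2,
    [(21503, 14336)]), (2, [(6143, 4096)]), (2, [(20479, 8192)]), (2, [(8191, 16384)]), (7,
    [(2351, 4704), (3527, 7056)]), (7, [(1373, 686), (6173, 12348), (18521, 12348), (19207, 5488)]),
    (7, [(4801, 9604)]), (11, [(67, 22), (109, 220), (197, 44)]), (11, [(727, 242), (1451, 2904),
    (1453, 726), (4357, 2178)]), (13, [(53, 26), (157, 52), (233, 156), (311, 208)]), (13,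
    [(337, 676), (677, 676), (2027, 1352), (8111, 16224)]), (17, [(103, 102), (137, 136),
    (239, 238), (307, 306), (1087, 2176)]), (17, [(577, 1156), (1733, 3468), (2311, 4624),
    (3469, 578), (5779, 2312)]), (19, [(151, 304), (379, 760), (419, 38)]), (23, [(47, 46),
    (139, 138), (229, 460)])],
  [(12, [(7, 16), (11, 24), (23, 48)]), (2, [(79, 32)]), (2, [(31, 64)]), (2, [(191, 384)]), (2,
    [(383, 768)]), (2, [(1279, 512)]), (2, [(12799, 1024)]), (2, [(5119, 2048)]), (2,
    [(6143, 12288)]), (3, [(37, 18), (1061, 36)]), (3, [(53, 108), (433, 54)]), (3, [(163, 162)]),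
    (3, [(971, 1944)]), (5, [(5, 20), (19, 40)]), (5, [(151, 150), (401, 100), (1601, 1600)]), (5,
    [(1999, 4000), (2999, 6000)]), (7, [(13, 28), (41, 28), (71, 70), (83, 168)]), (7, [(587, 1176),
    (881, 1764), (2351, 4704)]), (7, [(1373, 1372), (6173, 12348), (18523, 18522)]), (11,
    [(131, 264), (197, 132), (199, 198), (659, 440)]), (5, [(1249, 2500), (13751, 13750)]), (11,
    [(727, 726), (1453, 242), (2179, 2178)]), (13, [(103, 208), (157, 156), (1091, 2184)]), (13,
    [(677, 676), (2029, 2028), (3719, 3718), (4057, 1352)]), (17, [(67, 136), (101, 204), (137, 34),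
    (239, 34)]), (17, [(1733, 3468), (3467, 6936), (5779, 11560), (8093, 4046), (8669, 5780),
    (13873, 13872)]), (19, [(227, 152), (379, 760), (419, 38), (571, 570)]), (23, [(47, 46),
    (139, 138), (229, 460)])],
  [(2, [(3, 8)]), (5, [(5, 20), (11, 10), (1801, 40)]), (2, [(199, 80)]), (2, [(79, 160)]), (2,
    [(31, 64)]), (3, [(7, 6), (47, 96)]), (3, [(181, 18), (271, 90)]), (2, [(2879, 5760)]), (2,
    [(127, 256)]), (2, [(11519, 4608)]), (2, [(3583, 1024)]), (2, [(21503, 2048)]), (3, [(107, 216),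
    (109, 108)]), (3, [(647, 1296)]), (3, [(487, 486), (3889, 1944)]), (5, [(149, 300), (151, 150),
    (1999, 800)]), (5, [(3001, 3000), (8999, 18000)]), (5, [(7499, 5000), (11251, 3750),
    (13751, 1250)]), (5, [(18749, 37500)]), (7, [(29, 28), (41, 84), (223, 448), (281, 140)]), (7,
    [(881, 1764), (883, 294), (1471, 294), (2351, 1568)]), (7, [(1373, 686), (4801, 1372)]), (11,
    [(23, 22), (67, 66), (197, 132), (263, 528)]), (11, [(241, 484), (967, 1936), (1453, 484)]),
    (13, [(53, 52), (103, 208), (131, 130), (157, 78)]), (17, [(17, 68), (101, 204), (239, 238),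
    (509, 1020)]), (13, [(2029, 676), (3719, 3718), (4057, 676), (17239, 17238)]), (17,
    [(577, 1156), (5779, 2312), (6359, 6358), (8093, 1156), (8669, 5780)]), (19, [(37, 76),
    (191, 38), (227, 456), (419, 418), (571, 190), (761, 760)]), (19, [(10831, 3610),
    (15161, 10108), (17327, 34656), (18049, 36100), (21661, 3610)])],
  [(2, [(3, 8)]), (2, [(103, 16)]), (3, [(11, 24), (19031, 48)]), (3, [(17, 36)]), (3,
    [(3889, 432)]), (5, [(41, 20), (61, 60)]), (2, [(79, 160)]), (2, [(31, 64)]), (2,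
    [(2111, 128)]), (2, [(383, 256)]), (3, [(809, 1620)]), (3, [(487, 486), (971, 1944)]), (3,
    [(17497, 5832)]), (5, [(199, 400), (1601, 1600)]), (5, [(251, 250), (751, 750), (1499, 3000)]),
    (5, [(7499, 15000), (11251, 3750)]), (7, [(13, 28), (43, 42), (127, 14), (139, 280)]), (2,
    [(16127, 32256)]), (7, [(491, 490), (2351, 4704), (3919, 7840)]), (7, [(1373, 686),
    (6173, 12348), (8233, 686)]), (11, [(23, 22), (241, 44), (263, 176)]), (11, [(727, 242),
    (967, 1936), (1451, 2904), (1693, 3388)]), (13, [(53, 52), (313, 156), (389, 780), (467, 936)]),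
    (13, [(2027, 4056), (2029, 2028)]), (4, [(5119, 10240), (21503, 43008)]), (17, [(67, 136),
    (137, 136), (239, 238)]), (17, [(577, 1156), (3467, 2312), (5779, 11560), (6359, 6358),
    (8093, 8092)]), (19, [(113, 228), (151, 304), (191, 190), (227, 456)]), (23, [(47, 46),
    (229, 460), (367, 736), (643, 1288), (691, 138)])],
  [(2, [(11, 8)]), (2, [(23, 16)]), (7, [(13, 28), (29, 14), (167, 112)]), (3, [(7, 6),
    (2267, 168)]), (2, [(47, 96)]), (2, [(223, 448)]), (2, [(191, 384)]), (3, [(19, 18), (37, 36)]),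
    (2, [(1151, 2304)]), (3, [(379, 378)]), (5, [(31, 30), (79, 160)]), (5, [(101, 100), (401, 100),
    (599, 400)]), (3, [(811, 810), (8101, 8100)]), (3, [(15551, 31104)]), (3, [(1459, 1458),
    (17497, 5832)]), (7, [(197, 196), (491, 490), (587, 1176)]), (11, [(67, 66), (109, 220),
    (131, 88), (353, 352)]), (7, [(1373, 686), (7547, 7546)]), (11, [(727, 726), (1693, 3388),
    (2903, 5808)]), (13, [(103, 208), (313, 104), (467, 936), (521, 260), (1093, 546)]), (5,
    [(3001, 3000), (3499, 7000), (9749, 6500), (16249, 6500)]), (5, [(1249, 2500), (4999, 10000)]),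
    (13, [(1013, 676), (2027, 4056), (2029, 338), (3041, 2028), (5407, 10816)]), (4, [(3583, 7168),
    (15361, 5120)]), (2, [(5119, 10240)]), (17, [(239, 34), (271, 544), (509, 1020), (613, 306)]),
    (17, [(577, 1156), (3467, 6936), (3469, 1734), (5779, 11560), (6359, 6358)]), (19, [(151, 304),
    (227, 152), (229, 114), (419, 418), (571, 190), (761, 152)]), (23, [(137, 276), (827, 1656),
    (829, 414), (967, 966), (1103, 736)])],
  [(2, [(3, 8)]), (2, [(7, 16)]), (3, [(13, 6), (71, 48)]), (2, [(47, 96)]), (2, [(10847, 64)]),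
    (2, [(191, 128)]), (2, [(127, 256)]), (3, [(73, 72)]), (3, [(107, 216), (19009, 1728)]), (2,
    [(6911, 13824)]), (3, [(1621, 162), (2593, 2592)]), (5, [(11, 10), (31, 30), (179, 360)]), (3,
    [(3889, 3888), (9719, 19440)]), (5, [(149, 300), (401, 50), (449, 300)]), (2, [(12799, 25600)]),
    (5, [(2251, 2250), (16001, 16000)]), (7, [(29, 28), (83, 56), (113, 14)]), (2,
    [(21503, 43008)]), (7, [(197, 98), (491, 490), (881, 588), (2351, 1568)]), (7, [(1373, 1372),
    (6173, 12348), (13721, 2744)]), (11, [(23, 22), (43, 88), (89, 22), (131, 264)]), (11,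
    [(727, 726), (1451, 968), (1693, 3388), (2903, 1936), (20327, 40656)]), (11, [(5323, 10648),
    (13309, 26620), (15971, 31944)]), (13, [(103, 208), (157, 156), (389, 780)]), (13, [(337, 676),
    (3041, 676), (3719, 3718), (5407, 10816), (11831, 2366)]), (17, [(101, 68), (137, 136),
    (239, 238), (307, 306), (509, 1020)]), (17, [(577, 1156), (1733, 1156), (3467, 6936),
    (3469, 1734), (5779, 11560)]), (19, [(37, 76), (151, 304), (419, 418), (457, 456),
    (569, 1140)]), (23, [(139, 138), (229, 460), (367, 736), (827, 1656), (829, 414)])],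
  [(2, [(3, 8)]), (2, [(7, 16)]), (11, [(43, 88), (67, 22), (109, 44), (397, 22)]), (3, [(61, 6),
    (859, 66)]), (3, [(73, 72), (359, 144)]), (3, [(433, 54), (593, 1188)]), (2, [(12527, 864)]),
    (2, [(31, 64)]), (2, [(191, 384)]), (2, [(383, 256)]), (3, [(647, 1296)]), (5, [(5, 20),
    (79, 160), (151, 30)]), (2, [(1279, 2560)]), (3, [(9721, 9720)]), (5, [(101, 50), (149, 300)]),
    (2, [(12799, 25600)]), (2, [(5119, 10240)]), (2, [(6143, 12288)]), (5, [(499, 1000),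
    (2251, 250), (2999, 2000)]), (7, [(41, 84), (139, 56)]), (7, [(197, 98), (293, 588), (491, 490),
    (881, 588), (883, 882)]), (7, [(7547, 7546), (8233, 686), (18521, 37044)]), (11, [(727, 726),
    (1451, 2904)]), (13, [(53, 52), (103, 208), (181, 364), (233, 52)]), (13, [(1013, 2028),
    (2027, 4056), (3719, 3718), (4057, 1352), (4733, 2366)]), (17, [(137, 136), (239, 34),
    (271, 544), (509, 1020), (919, 918)]), (19, [(37, 76), (229, 114), (569, 380), (761, 760)]),
    (19, [(2887, 5776), (18049, 36100), (21661, 7220)]), (23, [(47, 46), (277, 138), (461, 230),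
    (829, 138), (967, 966)]), (29, [(29, 116), (463, 928), (523, 174), (811, 232), (1217, 116)])],
  [(2, [(11, 8)]), (2, [(7, 16)]), (2, [(47, 32)]), (2, [(31, 64)]), (3, [(71, 48), (8641, 192)]),
    (2, [(2879, 384)]), (2, [(383, 256)]), (2, [(6911, 512)]), (3, [(431, 288), (919, 18)]), (5,
    [(5, 20), (89, 60)]), (2, [(12799, 5120)]), (2, [(15359, 10240)]), (2, [(6143, 4096)]), (3,
    [(1619, 1080), (1621, 540)]), (3, [(4861, 1620), (9719, 6480)]), (3, [(1459, 486)]), (5,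
    [(101, 50), (449, 300)]), (5, [(251, 250), (499, 1000)]), (7, [(29, 28), (43, 14), (83, 56)]),
    (7, [(97, 196), (293, 196), (491, 490), (587, 392)]), (7, [(6173, 4116), (8233, 2744),
    (10289, 6860)]), (11, [(23, 22), (197, 132), (307, 616), (461, 308)]), (11, [(241, 484),
    (1451, 968)]), (13, [(13, 52), (53, 26), (79, 26), (157, 52), (521, 520)]), (13, [(677, 338),
    (2029, 338), (4057, 338), (4733, 4732)]), (17, [(67, 136), (103, 34), (271, 544), (953, 476)]),
    (17, [(577, 1156), (5779, 11560), (8669, 1156), (14449, 28900), (16183, 32368)]), (19,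
    [(37, 76), (151, 304), (191, 190), (227, 152)]), (23, [(137, 92), (139, 46), (229, 460),
    (277, 46), (827, 184)]), (23, [(4231, 8464), (9521, 6348), (12697, 4232)])],
  [(2, [(3, 8)]), (2, [(7, 16)]), (5, [(139, 40), (1459, 40)]), (2, [(239, 160)]), (2,
    [(31, 64)]), (2, [(191, 128)]), (2, [(127, 256)]), (3, [(11, 24), (29, 60)]), (3, [(71, 144),
    (73, 18)]), (3, [(109, 54)]), (3, [(809, 1620), (2591, 5184)]), (5, [(199, 400), (499, 200),
    (1949, 300)]), (5, [(751, 250), (2999, 2000), (8999, 2000)]), (7, [(13, 28), (211, 210),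
    (307, 56)]), (2, [(16127, 32256)]), (3, [(487, 486), (6803, 13608)]), (7, [(97, 196),
    (587, 1176), (2351, 4704), (2939, 1960)]), (7, [(8231, 16464), (10289, 4116), (19207, 5488)]),
    (7, [(4801, 9604), (14407, 4802)]), (11, [(43, 88), (197, 396), (331, 66), (353, 22)]), (5,
    [(1249, 2500), (13751, 13750)]), (11, [(727, 726), (1451, 2904), (1693, 3388), (2179, 2178)]),
    (13, [(53, 52), (79, 78), (103, 208)]), (13, [(677, 338), (2027, 4056), (3719, 3718)]), (4,
    [(5119, 2048), (18433, 2048)]), (9, [(2917, 2916), (4373, 8748), (17497, 8748)]), (17,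
    [(67, 136), (101, 204), (137, 34), (271, 544), (509, 1020)]), (19, [(37, 76), (113, 228),
    (151, 304)]), (23, [(229, 92), (277, 276), (599, 598), (643, 1288), (829, 414), (967, 322)])],
  [(2, [(3, 8)]), (5, [(11, 10), (41, 40)]), (3, [(7, 6), (59, 120)]), (2, [(23, 48)]), (2,
    [(79, 160)]), (2, [(31, 64)]), (2, [(191, 128)]), (2, [(127, 256)]), (2, [(1279, 2560)]), (3,
    [(17, 36)]), (3, [(53, 108), (647, 432)]), (5, [(151, 150), (199, 400)]), (2, [(12799, 25600)]),
    (3, [(4051, 4050)]), (3, [(1459, 486), (9719, 3888)]), (5, [(751, 750), (1499, 3000),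
    (9001, 750), (13499, 9000)]), (5, [(1249, 2500), (4999, 10000)]), (7, [(13, 28), (43, 42)]), (7,
    [(97, 196), (197, 196), (293, 588)]), (7, [(6173, 4116), (8231, 5488), (8233, 2058),
    (18523, 18522)]), (11, [(131, 264), (331, 22), (397, 396), (461, 924)]), (11, [(967, 1936),
    (1453, 726), (2903, 1936), (3389, 3388)]), (13, [(233, 468), (313, 104), (389, 780),
    (467, 936)]), (13, [(677, 676), (3041, 6084), (3719, 3718), (4057, 1014), (5407, 10816)]), (9,
    [(4373, 8748), (8747, 17496)]), (17, [(67, 136), (101, 68), (239, 238), (271, 544),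
    (509, 340)]), (17, [(1733, 3468), (2311, 4624), (3467, 2312), (3469, 3468)]), (19, [(37, 76),
    (227, 152), (419, 418)]), (23, [(47, 46), (137, 92), (367, 736), (599, 598), (691, 690)])],
  [(2, [(883, 8)]), (2, [(23, 16)]), (3, [(11, 24), (97, 48)]), (2, [(47, 96)]), (5, [(41, 40),
    (61, 30)]), (2, [(2719, 320)]), (2, [(2239, 640)]), (2, [(383, 256)]), (2, [(1279, 2560)]), (2,
    [(12799, 5120)]), (2, [(15359, 6144)]), (3, [(73, 36), (179, 360)]), (3, [(53, 108),
    (433, 216)]), (3, [(487, 162)]), (5, [(199, 400), (401, 200), (1601, 800)]), (5, [(1999, 4000),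
    (8999, 18000), (10501, 750)]), (7, [(29, 28), (127, 126), (223, 448)]), (7, [(881, 588),
    (2939, 5880)]), (11, [(43, 88), (67, 22), (109, 220), (197, 396)]), (11, [(967, 1936),
    (1451, 968), (3389, 1694), (5807, 11616), (10889, 4356)]), (13, [(13, 52), (131, 130),
    (233, 468), (311, 624)]), (3, [(12637, 6318)]), (3, [(1459, 1458)]), (13, [(337, 676),
    (677, 338)]), (17, [(17, 68), (103, 102), (271, 544), (373, 748), (613, 306)]), (17,
    [(577, 1156), (1733, 1156), (3467, 6936), (8093, 4046), (14449, 28900)]), (19, [(37, 76),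
    (113, 228), (191, 190)]), (23, [(137, 276), (139, 138), (277, 276), (367, 736), (461, 230)]),
    (23, [(4231, 8464), (9521, 19044), (12697, 6348), (16927, 33856), (17987, 17986)])],
  [(2, [(3, 8)]), (11, [(23, 22), (43, 88), (89, 88), (5281, 22)]), (3, [(7, 6), (67, 66)]), (2,
    [(16103, 528)]), (2, [(47, 96)]), (2, [(607, 64)]), (2, [(2111, 4224)]), (2, [(9343, 256)]), (2,
    [(8447, 16896)]), (3, [(37, 36), (251, 72)]), (3, [(53, 108), (4969, 216)]), (3, [(1783, 1782),
    (2591, 5184)]), (3, [(10691, 21384)]), (3, [(2917, 1458), (4373, 2916)]), (3, [(13121, 8748),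
    (17497, 4374)]), (5, [(5, 20), (31, 30)]), (5, [(101, 50), (151, 150), (599, 1200)]), (2,
    [(12799, 25600)]), (5, [(499, 1000), (751, 250), (1999, 4000)]), (7, [(41, 28), (127, 42),
    (167, 112)]), (2, [(21503, 43008)]), (2, [(6143, 12288)]), (7, [(293, 588), (491, 98),
    (883, 882), (3527, 7056)]), (7, [(1373, 686), (6173, 12348), (8231, 16464)]), (7,
    [(14407, 14406), (19207, 38416)]), (11, [(967, 1936), (1693, 3388), (3389, 3388), (5081, 10164),
    (8713, 726)]), (11, [(5323, 10648), (13309, 26620), (15971, 31944)]), (13, [(79, 78),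
    (103, 208), (157, 78)]), (13, [(1013, 676), (2029, 1014), (3041, 6084)]), (17, [(137, 34),
    (271, 544), (443, 442), (953, 476), (1361, 1360)]), (17, [(2311, 4624), (3467, 2312),
    (5779, 11560), (6359, 6358), (8093, 4046), (16183, 32368)]), (19, [(113, 76), (191, 190),
    (227, 456), (229, 228)])],
  [(2, [(3, 8)]), (2, [(7, 16)]), (2, [(47, 32)]), (2, [(31, 64)]), (5, [(5, 20), (59, 40),
    (79, 160)]), (2, [(10559, 640)]), (3, [(11, 24), (191, 384)]), (3, [(17, 36), (19, 18)]), (3,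
    [(271, 270)]), (3, [(647, 1296)]), (3, [(9719, 3888)]), (5, [(101, 100), (1601, 1600)]), (5,
    [(751, 250), (1499, 3000)]), (7, [(41, 28), (43, 42), (83, 168), (701, 140)]), (2,
    [(2687, 5376)]), (2, [(6911, 13824)]), (2, [(12799, 25600)]), (2, [(5119, 10240)]), (7,
    [(97, 196), (197, 196), (491, 490)]), (7, [(8233, 2744), (12347, 24696)]), (11, [(89, 22),
    (131, 264), (199, 198), (461, 924)]), (11, [(967, 1936), (1693, 3388), (8713, 8712)]), (13,
    [(313, 78), (521, 130), (727, 1456), (857, 156), (1559, 3120)]), (13, [(3719, 3718),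
    (4733, 4732), (8111, 5408), (9463, 18928)]), (17, [(67, 136), (103, 102), (137, 68), (307, 306),
    (409, 204)]), (17, [(577, 1156), (2311, 4624), (3467, 2312), (6359, 6358), (14449, 5780),
    (19073, 38148)]), (19, [(113, 228), (151, 304), (419, 418), (457, 456)]), (19, [(2887, 5776),
    (7219, 14440), (8663, 17328), (18773, 18772)]), (23, [(139, 138), (229, 460), (367, 736),
    (827, 1656), (1013, 506)])],
  [(4, [(7, 16), (17, 16)]), (2, [(47, 32)]), (5, [(11, 10), (79, 160)]), (3, [(29, 60)]), (2,
    [(1439, 960)]), (2, [(4799, 1920)]), (2, [(383, 256)]), (2, [(1279, 512)]), (3, [(19, 18)]), (3,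
    [(271, 270), (431, 864)]), (3, [(163, 162), (1619, 3240)]), (3, [(3889, 3888), (15551, 31104)]),
    (5, [(151, 50), (1601, 400)]), (5, [(251, 250), (1499, 3000), (1999, 4000)]), (5, [(1249, 2500),
    (4999, 10000), (11251, 3750)]), (7, [(13, 28), (41, 84), (71, 70)]), (7, [(97, 196), (883, 882),
    (1471, 1470)]), (7, [(6173, 12348), (12347, 24696), (13721, 3430)]), (7, [(19207, 38416)]), (11,
    [(23, 22), (43, 88), (197, 132)]), (11, [(241, 484), (727, 726), (3631, 1210)]), (13, [(53, 52),
    (103, 208), (131, 130), (233, 468)]), (13, [(337, 676), (677, 338), (1013, 2028),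
    (2029, 1014)]), (4, [(5119, 2048), (15359, 30720)]), (17, [(67, 136), (101, 68), (239, 238),
    (613, 306)]), (19, [(37, 76), (113, 228), (191, 190), (227, 456), (571, 190), (607, 1216),
    (797, 1596)]), (23, [(137, 276), (229, 460), (277, 92), (599, 598)]), (29, [(59, 58),
    (173, 348), (347, 232), (349, 174), (521, 348)])],
  [(2, [(3, 8)]), (2, [(7, 16)]), (2, [(5231, 32)]), (2, [(31, 64)]), (3, [(11, 24), (97, 48)]),
    (2, [(191, 384)]), (2, [(127, 256)]), (2, [(14591, 1536)]), (3, [(17, 36), (109, 18)]), (5,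
    [(19, 40), (29, 60)]), (5, [(151, 150), (401, 200)]), (2, [(12799, 25600)]), (2,
    [(5119, 10240)]), (5, [(251, 250), (2251, 2250)]), (7, [(13, 28), (43, 14), (71, 70)]), (3,
    [(107, 216), (757, 756)]), (3, [(647, 1296)]), (7, [(491, 490), (587, 1176), (883, 98)]), (11,
    [(67, 66), (197, 396), (199, 198)]), (11, [(967, 1936), (1451, 968), (1453, 1452), (2903, 5808),
    (5081, 10164), (10163, 6776)]), (11, [(5323, 10648), (13309, 26620), (15971, 10648),
    (15973, 7986)]), (13, [(53, 26), (79, 78), (181, 52), (233, 156), (389, 780)]), (3,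
    [(6317, 12636)]), (13, [(677, 676), (3041, 6084), (4057, 4056), (9463, 2704), (10141, 5070)]),
    (17, [(103, 102), (137, 136), (271, 544)]), (17, [(2311, 4624), (3467, 6936), (6359, 6358),
    (8093, 4046)]), (19, [(229, 228), (379, 760), (457, 228)]), (23, [(461, 460), (599, 598),
    (691, 230), (829, 828), (1013, 506)]), (29, [(59, 58), (173, 348), (811, 1624), (1567, 1566),
    (1973, 986)])],
  [(2, [(3, 8)]), (2, [(7, 16)]), (3, [(23, 48)]), (2, [(47, 96)]), (2, [(31, 64)]), (3,
    [(17, 36), (37, 18)]), (3, [(163, 54)]), (3, [(647, 1296), (1297, 1296)]), (3, [(3889, 972)]),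
    (2, [(15551, 31104)]), (5, [(19, 40)]), (5, [(101, 100), (401, 400)]), (5, [(251, 250),
    (1249, 500), (2251, 2250)]), (7, [(83, 168), (113, 56), (127, 126)]), (7, [(1471, 1470),
    (1567, 3136)]), (11, [(43, 88), (109, 44), (131, 264)]), (2, [(7039, 14080)]), (2,
    [(1279, 2560)]), (11, [(241, 484), (967, 1936), (1693, 3388)]), (13, [(79, 78), (157, 78),
    (311, 624)]), (7, [(6173, 4116), (7547, 7546), (17837, 8918)]), (17, [(67, 136), (103, 102),
    (137, 68), (307, 102)]), (17, [(1733, 1156), (2311, 4624), (3467, 6936), (3469, 3468)]), (19,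
    [(151, 304), (191, 190), (227, 152), (379, 760)]), (13, [(4733, 2366), (6421, 12844),
    (10141, 5070), (11491, 22984), (16901, 8450)]), (23, [(139, 138), (229, 460), (277, 276),
    (367, 736), (461, 460)]), (29, [(59, 58), (463, 928), (521, 1044), (1103, 1102), (1451, 290)])],
  [(2, [(1459, 8)]), (5, [(5, 20), (19, 40), (1931, 10)]), (2, [(199, 80)]), (2, [(719, 32)]), (2,
    [(31, 64)]), (2, [(1087, 128)]), (2, [(127, 256)]), (3, [(7, 6), (191, 384)]), (2,
    [(11519, 7680)]), (2, [(3583, 1024)]), (2, [(15359, 30720)]), (3, [(37, 36), (467, 72)]), (3,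
    [(107, 216)]), (3, [(1297, 162), (6481, 6480)]), (5, [(101, 100), (449, 900)]), (5,
    [(499, 1000), (3251, 250)]), (7, [(13, 28), (29, 14), (113, 112)]), (7, [(97, 196), (881, 588),
    (2351, 1568)]), (11, [(43, 88), (67, 66), (109, 220), (307, 616)]), (3, [(5347, 5346)]), (11,
    [(241, 484), (967, 1936), (1451, 2904)]), (13, [(79, 78), (131, 26), (181, 364), (313, 156),
    (547, 546)]), (7, [(12347, 8232), (13721, 13720), (17837, 8918)]), (13, [(2027, 4056),
    (2029, 1014), (3719, 3718), (4057, 676), (9463, 18928)]), (17, [(103, 34), (271, 544),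
    (509, 1020), (1327, 1326)]), (17, [(5779, 11560), (6359, 578), (8669, 17340), (14449, 28900)]),
    (19, [(151, 304), (229, 76), (569, 1140)]), (19, [(7219, 14440), (8663, 17328), (11551, 23104),
    (18773, 18772)]), (23, [(47, 46), (137, 276), (367, 736), (643, 1288), (691, 690),
    (1747, 3496)])],
  [(2, [(3, 8)]), (6, [(97, 48), (8999, 48)]), (2, [(47, 96)]), (2, [(479, 192)]), (2,
    [(191, 128)]), (2, [(127, 256)]), (3, [(17, 36), (109, 36)]), (3, [(433, 432)]), (3,
    [(1297, 162), (9719, 1296)]), (3, [(971, 1944)]), (3, [(1459, 1458), (2917, 2916)]), (5,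
    [(5, 20), (31, 30), (269, 540)]), (2, [(1279, 2560)]), (5, [(101, 50), (599, 1200)]), (7,
    [(13, 28), (41, 84), (71, 14), (167, 336)]), (5, [(3499, 7000), (9001, 750)]), (7, [(881, 1764),
    (883, 98), (1471, 1470), (5879, 2352)]), (7, [(8233, 2744), (12347, 8232)]), (11, [(23, 22),
    (89, 88), (131, 264), (397, 396)]), (11, [(241, 484), (967, 1936), (1451, 2904), (2179, 2178),
    (9679, 19360)]), (11, [(2663, 2662), (15973, 15972)]), (13, [(53, 26), (181, 364), (233, 468),
    (701, 1404)]), (13, [(1013, 676), (2027, 1352), (4733, 4732)]), (17, [(67, 136), (103, 102),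
    (137, 34)]), (17, [(577, 1156), (3467, 6936), (8669, 17340)]), (19, [(37, 76), (113, 228),
    (151, 304), (379, 760), (419, 418), (571, 114)]), (23, [(229, 460), (461, 460), (827, 1656),
    (919, 368)])],
  [(2, [(3, 8)]), (5, [(31, 10), (139, 40)]), (7, [(41, 28), (281, 280), (491, 70)]), (2,
    [(727, 112)]), (2, [(47, 32)]), (2, [(223, 448)]), (2, [(2239, 4480)]), (2, [(127, 256)]), (3,
    [(7, 6), (43, 42)]), (3, [(19, 18), (71, 144)]), (2, [(16127, 4608)]), (2, [(3583, 7168)]), (2,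
    [(15359, 6144)]), (2, [(6143, 12288)]), (2, [(20479, 40960)]), (3, [(107, 216), (431, 864)]),
    (3, [(2269, 162), (2591, 5184)]), (3, [(3889, 486), (9721, 9720)]), (3, [(4373, 2916)]), (3,
    [(8747, 17496)]), (5, [(149, 300), (601, 300)]), (5, [(251, 250), (499, 1000), (1249, 500)]),
    (7, [(197, 196), (883, 294), (2647, 98)]), (7, [(1373, 1372), (6173, 1372), (10289, 20580)]),
    (7, [(4801, 9604), (14407, 4802)]), (11, [(109, 220), (131, 264)]), (11, [(1693, 3388),
    (5081, 10164), (5807, 11616)]), (13, [(53, 52), (79, 26), (157, 156)]), (5, [(4999, 10000),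
    (7499, 15000), (16249, 32500)]), (17, [(67, 136), (101, 204), (103, 102), (239, 238),
    (271, 544)]), (17, [(577, 1156), (1733, 3468), (3467, 6936)]), (19, [(151, 304), (191, 190),
    (457, 456), (569, 380)])],
  [(10, [(19, 40), (41, 20), (1019, 40), (15161, 40)]), (2, [(7, 16)]), (2, [(1039, 32)]), (3,
    [(11, 24), (31, 30)]), (3, [(73, 36)]), (3, [(107, 216)]), (2, [(2591, 1728)]), (2,
    [(191, 128)]), (2, [(127, 256)]), (2, [(6911, 4608)]), (3, [(1621, 1620)]), (3, [(4861, 2430),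
    (15551, 31104)]), (3, [(2917, 1458), (17497, 5832)]), (5, [(401, 50), (601, 600),
    (4051, 4050)]), (2, [(12799, 25600)]), (2, [(5119, 10240)]), (5, [(1499, 1000), (1999, 4000),
    (4001, 4000)]), (7, [(43, 42), (71, 14), (83, 168), (281, 280)]), (7, [(97, 196), (1471, 294)]),
    (7, [(8231, 5488), (8233, 2744)]), (11, [(23, 22), (89, 44), (131, 264), (331, 330)]), (11,
    [(241, 484), (2903, 5808), (3389, 484), (3631, 1210), (10163, 6776)]), (13, [(79, 78),
    (103, 208), (311, 624), (313, 312), (389, 780)]), (13, [(677, 676), (1013, 2028), (3041, 2028),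
    (3719, 3718), (6761, 676), (9463, 18928)]), (17, [(17, 68), (67, 136), (101, 204), (307, 306)]),
    (17, [(2311, 4624), (3467, 6936), (3469, 1734), (5779, 11560), (6359, 6358), (8669, 5780),
    (15607, 15606)]), (19, [(37, 76), (113, 228), (151, 304), (227, 456), (229, 114)]), (19,
    [(2887, 5776), (7219, 14440), (8663, 17328), (11551, 23104), (18049, 36100)]), (23, [(47, 46),
    (137, 276), (139, 46), (367, 736), (461, 46), (691, 690)])],
  [(2, [(3, 8)]), (2, [(7, 16)]), (2, [(79, 32)]), (3, [(97, 48)]), (3, [(17, 36)]), (3,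
    [(53, 108), (107, 216)]), (2, [(863, 1728)]), (2, [(191, 384)]), (2, [(1151, 2304)]), (2,
    [(1279, 512)]), (2, [(12799, 1024)]), (5, [(11, 10), (19, 40)]), (2, [(5119, 10240)]), (2,
    [(6143, 12288)]), (2, [(20479, 40960)]), (2, [(8191, 16384)]), (3, [(811, 810), (15391, 810)]),
    (3, [(487, 486), (971, 1944)]), (5, [(199, 400), (401, 200), (1201, 100)]), (5, [(251, 250)]),
    (7, [(29, 14), (281, 280)]), (7, [(197, 98), (587, 392), (883, 882)]), (7, [(1373, 686),
    (10289, 20580), (13721, 13720)]), (11, [(67, 66), (89, 88), (109, 220), (353, 176)]), (11,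
    [(1451, 2904), (2179, 2178), (2903, 5808), (5081, 1452)]), (13, [(13, 52), (103, 208),
    (131, 130), (181, 52), (547, 78)]), (13, [(2029, 676), (5407, 10816), (6761, 1690)]), (17,
    [(101, 68), (239, 238), (307, 306), (613, 612)]), (17, [(2311, 4624), (3467, 6936),
    (3469, 1156)]), (19, [(113, 228), (151, 304), (227, 152), (229, 228), (569, 1140)]), (19,
    [(7219, 14440), (11551, 23104), (17327, 34656)])],
  [(2, [(3, 8)]), (2, [(7, 16)]), (3, [(11, 24), (71, 48)]), (2, [(47, 96)]), (2, [(479, 192)]),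
    (2, [(191, 128)]), (2, [(383, 768)]), (3, [(37, 36)]), (5, [(5, 20), (29, 60), (31, 30)]), (3,
    [(53, 108), (541, 540)]), (3, [(163, 162)]), (3, [(4861, 2430)]), (5, [(1601, 400),
    (4051, 1350), (14401, 4800)]), (5, [(251, 250), (499, 1000), (2251, 2250)]), (7, [(13, 28),
    (43, 42), (127, 126)]), (2, [(16127, 10752)]), (2, [(12799, 25600)]), (2, [(5119, 10240)]), (2,
    [(6143, 12288)]), (7, [(97, 196), (293, 588), (587, 392), (1471, 294)]), (7, [(1373, 1372),
    (8233, 8232)]), (11, [(23, 22), (353, 352), (439, 880), (617, 154), (881, 440)]), (11,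
    [(967, 1936), (1453, 1452), (1693, 3388), (3631, 3630), (5081, 10164)]), (13, [(131, 130),
    (181, 364), (233, 468), (311, 624)]), (13, [(677, 676), (1013, 676), (2029, 2028),
    (3041, 6084)]), (9, [(4373, 8748), (8747, 17496)]), (17, [(67, 136), (101, 204), (103, 102),
    (307, 34), (409, 136)]), (17, [(577, 1156), (1733, 3468), (2311, 4624), (6359, 578)]), (19,
    [(151, 304), (227, 456), (647, 646), (761, 760), (1063, 2128)]), (23, [(137, 276), (139, 138),
    (277, 92), (461, 460)])],
  [(2, [(2179, 8)]), (2, [(7, 16)]), (2, [(79, 32)]), (11, [(23, 22), (89, 22), (13553, 176)]),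
    (3, [(131, 264), (659, 264)]), (3, [(19, 18)]), (5, [(5, 20), (29, 60)]), (2, [(5279, 10560)]),
    (2, [(2111, 4224)]), (5, [(101, 100), (599, 400), (751, 150), (2999, 400)]), (3, [(53, 108),
    (2699, 5400)]), (3, [(647, 1296)]), (3, [(3889, 1944), (4861, 4860)]), (5, [(251, 250),
    (499, 1000)]), (5, [(1249, 2500), (7499, 15000)]), (7, [(13, 28), (41, 84), (223, 448)]), (2,
    [(2687, 5376)]), (2, [(6911, 4608)]), (7, [(97, 196), (491, 490)]), (7, [(6173, 12348),
    (7547, 7546), (8231, 16464)]), (11, [(241, 484), (1451, 2904), (1693, 3388), (12101, 6050)]),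
    (13, [(157, 78), (233, 468), (313, 52), (571, 1144), (727, 1456), (857, 156)]), (13,
    [(1013, 2028), (2027, 4056), (3041, 6084), (4057, 4056), (5407, 10816), (9463, 18928)]), (17,
    [(67, 136), (103, 34), (271, 544), (409, 408)]), (17, [(1733, 3468), (3469, 3468), (8093, 4046),
    (17341, 8670), (20231, 20230)]), (19, [(37, 76), (113, 228), (151, 304), (419, 418)]), (19,
    [(7219, 14440), (15161, 30324), (17327, 11552), (18773, 9386)]), (23, [(47, 46), (137, 92),
    (139, 138), (643, 1288), (691, 690), (919, 1840), (1151, 1150), (1471, 2944)])],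
  [(2, [(3, 8)]), (2, [(599, 16)]), (2, [(1039, 32)]), (2, [(11423, 64)]), (3, [(7, 6),
    (23, 48)]), (2, [(191, 384)]), (2, [(127, 256)]), (3, [(19, 18), (71, 144)]), (2,
    [(11519, 4608)]), (5, [(29, 60), (31, 30), (41, 10)]), (3, [(541, 270), (8641, 8640)]), (3,
    [(647, 1296), (1619, 3240)]), (3, [(4861, 4860), (9721, 2430)]), (5, [(151, 50), (449, 100)]),
    (2, [(12799, 25600)]), (2, [(5119, 10240)]), (2, [(6143, 4096)]), (5, [(251, 250), (1249, 500),
    (1499, 3000)]), (7, [(97, 28), (167, 336), (197, 14), (419, 280)]), (7, [(587, 392),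
    (3137, 3136), (3527, 7056)]), (11, [(43, 88), (109, 220), (307, 616), (397, 396)]), (7,
    [(1373, 686), (15091, 30184)]), (11, [(2179, 2178), (5081, 3388), (8713, 242), (9679, 3872)]),
    (11, [(2663, 2662), (5323, 10648)]), (13, [(13, 52), (53, 52), (79, 78)]), (5, [(11251, 11250),
    (16249, 32500)]), (13, [(337, 676), (2029, 676), (3041, 6084)]), (17, [(67, 136), (101, 204),
    (137, 136), (271, 544)]), (19, [(113, 76), (227, 456), (229, 38), (1367, 2736)]), (23,
    [(139, 138), (277, 46), (643, 1288), (919, 1840), (1151, 46), (1289, 1288)])],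
  [(2, [(3, 8)]), (5, [(11, 10), (41, 40)]), (3, [(1993, 24), (15331, 30)]), (2, [(23, 48)]), (2,
    [(79, 160)]), (2, [(31, 64)]), (5, [(101, 100), (149, 100), (1201, 600)]), (2, [(4799, 9600)]),
    (2, [(127, 256)]), (2, [(1279, 2560)]), (2, [(3583, 1024)]), (2, [(5119, 10240)]), (2,
    [(6143, 4096)]), (3, [(577, 288), (8101, 900)]), (3, [(163, 54), (541, 270)]), (3, [(1297, 648),
    (1619, 3240)]), (3, [(9721, 9720)]), (5, [(751, 750), (4001, 4000), (18749, 1500)]), (5,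
    [(1249, 2500), (4999, 10000), (7499, 15000)]), (7, [(71, 70), (139, 56), (223, 448)]), (7,
    [(491, 490), (2351, 4704)]), (7, [(6173, 12348), (8231, 16464), (8233, 2058)]), (11, [(89, 22),
    (131, 88), (199, 198)]), (11, [(241, 484), (1451, 2904), (1693, 3388), (2179, 2178)]), (13,
    [(53, 26), (157, 26), (181, 364), (233, 156), (311, 624), (313, 312)]), (13, [(337, 676),
    (1013, 676), (2027, 4056)]), (17, [(67, 136), (103, 102), (137, 68), (307, 306)]), (17,
    [(1733, 3468), (3469, 1734), (8093, 8092), (16183, 32368)]), (19, [(37, 76), (113, 228),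
    (191, 190), (227, 456), (419, 418)]), (23, [(47, 46), (367, 736), (461, 230)])],
  [(18, [(7, 6), (11, 24), (251, 72), (1873, 36)]), (3, [(433, 216)]), (5, [(59, 40), (89, 180),
    (179, 120)]), (3, [(811, 810)]), (3, [(3889, 486)]), (2, [(9719, 3888)]), (2, [(79, 160)]), (2,
    [(31, 64)]), (2, [(191, 384)]), (2, [(127, 256)]), (2, [(11519, 7680)]), (3, [(1459, 1458),
    (17497, 5832)]), (5, [(101, 50), (401, 50), (599, 1200)]), (5, [(2251, 2250), (2999, 6000),
    (9001, 9000)]), (7, [(41, 84), (71, 70), (83, 168), (223, 448)]), (2, [(3583, 7168)]), (7,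
    [(293, 588), (587, 1176), (1567, 3136)]), (7, [(1373, 1372), (10289, 4116)]), (11, [(23, 22),
    (43, 88), (67, 66)]), (11, [(241, 484), (1451, 2904), (1453, 484)]), (11, [(2663, 2662),
    (5323, 10648), (13309, 26620)]), (13, [(53, 52), (181, 364), (389, 780), (521, 130),
    (701, 1404)]), (13, [(337, 676), (677, 676), (9127, 9126)]), (17, [(103, 102), (137, 68),
    (239, 238), (307, 306), (443, 442)]), (17, [(577, 1156), (1733, 3468), (5779, 11560),
    (8093, 4046)]), (19, [(37, 76), (113, 228), (151, 304)]), (19, [(2887, 5776), (15161, 10108),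
    (18049, 7220), (21661, 1444)])],
  [(2, [(3, 8)]), (2, [(7, 16)]), (3, [(1499, 24), (2711, 48)]), (3, [(17, 36)]), (5, [(5, 20),
    (89, 180)]), (2, [(79, 160)]), (2, [(31, 64)]), (2, [(191, 384)]), (2, [(383, 256)]), (2,
    [(1279, 2560)]), (3, [(431, 864), (1889, 540)]), (3, [(647, 1296), (1619, 648)]), (5,
    [(199, 400), (599, 400)]), (2, [(12799, 25600)]), (3, [(4861, 2430), (12149, 24300)]), (5,
    [(499, 1000), (5501, 250), (7499, 3000)]), (7, [(13, 28), (41, 84), (113, 56), (167, 336)]), (7,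
    [(197, 196), (883, 882), (1471, 1470)]), (11, [(23, 22), (43, 88), (263, 528)]), (11,
    [(241, 484), (727, 726), (967, 1936), (1451, 2904)]), (13, [(103, 208), (131, 130), (389, 780),
    (547, 546)]), (5, [(4999, 10000), (16249, 32500)]), (13, [(337, 676), (677, 338)]), (17,
    [(67, 136), (101, 204), (271, 544), (409, 34), (443, 34), (613, 306)]), (17, [(1733, 3468),
    (3467, 6936), (5779, 11560), (8669, 17340), (16183, 32368), (19073, 12716)]), (19, [(227, 456),
    (229, 76), (457, 228), (569, 380)]), (19, [(8663, 17328), (10831, 10830), (11551, 23104)]), (23,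
    [(47, 46), (367, 736), (643, 1288), (827, 1656), (1289, 322)])],
  [(2, [(3, 8)]), (2, [(7, 16)]), (2, [(47, 32)]), (2, [(2207, 64)]), (2, [(1087, 128)]), (2,
    [(127, 256)]), (3, [(863, 192), (19009, 96)]), (3, [(647, 144), (3079, 18)]), (5, [(5, 20),
    (41, 40)]), (3, [(3889, 432), (9721, 1080)]), (5, [(101, 50), (151, 50), (601, 200)]), (5,
    [(251, 250), (2251, 250)]), (7, [(13, 28), (29, 14), (71, 70), (167, 112)]), (2,
    [(16127, 3584)]), (2, [(3583, 7168)]), (2, [(21503, 2048)]), (2, [(6143, 4096)]), (7,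
    [(97, 196), (293, 196), (491, 490)]), (7, [(6173, 1372), (12347, 2744)]), (11, [(43, 88),
    (89, 44), (197, 44), (199, 22)]), (5, [(11251, 1250), (13751, 13750)]), (11, [(1693, 3388),
    (2903, 1936), (5807, 3872)]), (13, [(79, 26), (103, 208), (131, 130), (233, 52)]), (13,
    [(337, 676), (1013, 676), (2027, 1352), (2029, 338), (3719, 3718)]), (9, [(1459, 162),
    (8747, 1944)]), (17, [(17, 68), (67, 136), (239, 238), (409, 136)]), (17, [(577, 1156),
    (1733, 1156), (6359, 6358)]), (19, [(37, 76), (113, 76), (191, 190), (227, 152)]), (19,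
    [(2887, 5776), (8663, 5776), (10831, 3610), (17327, 11552)])],
  [(2, [(179, 8)]), (2, [(7, 16)]), (3, [(71, 48), (2029, 6)]), (3, [(109, 18), (8243, 72)]), (5,
    [(11, 10), (29, 60)]), (3, [(433, 216), (541, 270)]), (3, [(163, 162)]), (3, [(971, 1944),
    (6803, 1944)]), (3, [(1459, 1458)]), (5, [(149, 300), (601, 200), (751, 150)]), (5,
    [(1499, 3000), (8501, 250), (8999, 18000)]), (2, [(1999, 4000)]), (2, [(31, 64)]), (2,
    [(191, 384)]), (2, [(127, 256)]), (2, [(1279, 512)]), (2, [(12799, 1024)]), (2,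
    [(5119, 10240)]), (2, [(6143, 12288)]), (7, [(43, 42), (97, 28)]), (7, [(197, 196),
    (881, 196)]), (7, [(6173, 12348), (8231, 16464), (12347, 24696), (13721, 6860)]), (11,
    [(23, 22), (89, 44), (617, 616), (967, 176)]), (11, [(241, 484), (727, 242), (1453, 1452)]),
    (13, [(53, 52), (79, 78), (103, 208), (131, 130), (157, 156)]), (13, [(337, 676), (2027, 4056),
    (3041, 6084), (9127, 9126)]), (17, [(67, 136), (101, 204), (137, 34), (307, 102)]), (17,
    [(2311, 4624), (3467, 2312), (5779, 11560), (6359, 6358)]), (19, [(37, 76), (229, 76),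
    (569, 1140), (683, 1368), (797, 1596), (911, 1824), (2089, 4180)]), (19, [(2887, 5776),
    (7219, 14440), (17327, 11552)])],
  [(2, [(3, 8)]), (2, [(7, 16)]), (4, [(5023, 64), (7873, 64)]), (2, [(12479, 128)]), (2,
    [(127, 256)]), (3, [(191, 384), (3527, 48)]), (3, [(17, 36), (2591, 576)]), (3, [(109, 108),
    (1187, 216)]), (2, [(6911, 13824)]), (3, [(163, 162), (1297, 162)]), (3, [(971, 1944),
    (3889, 1944)]), (5, [(31, 30), (61, 30)]), (5, [(149, 300), (151, 150)]), (7, [(13, 28),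
    (29, 28), (43, 42), (419, 840)]), (7, [(197, 196), (293, 588), (587, 1176)]), (11, [(67, 66),
    (89, 88), (131, 264)]), (5, [(2749, 5500), (2999, 6000), (8501, 250)]), (11, [(1451, 2904),
    (1453, 726), (2179, 2178), (3389, 3388), (8713, 1452)]), (13, [(53, 52), (79, 78), (181, 364)]),
    (5, [(1249, 2500), (16249, 32500)]), (17, [(101, 68), (103, 102), (271, 544), (307, 102)]), (13,
    [(1013, 676), (10139, 20280), (11491, 22984)]), (17, [(2311, 4624), (6359, 578), (13873, 6936),
    (16183, 32368)]), (19, [(113, 228), (379, 760), (457, 456), (569, 76), (571, 190)]), (23,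
    [(47, 46), (137, 276), (229, 460), (367, 736), (643, 184)]), (29, [(233, 116), (349, 174),
    (463, 928), (521, 1044), (929, 464)])],
  [(2, [(3, 8)]), (7, [(13, 28), (71, 14), (113, 56)]), (3, [(7, 6), (83, 168)]), (3, [(73, 72)]),
    (3, [(53, 108), (271, 54)]), (3, [(487, 162)]), (3, [(971, 1944), (9721, 1944)]), (3,
    [(17497, 5832), (20411, 5832)]), (3, [(8747, 17496)]), (5, [(149, 60), (151, 30), (349, 140)]),
    (5, [(499, 200), (1499, 600)]), (7, [(293, 196), (587, 1176)]), (7, [(6173, 4116), (8233, 8232),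
    (12347, 8232)]), (11, [(23, 22), (43, 88), (89, 88)]), (11, [(727, 726), (1451, 968),
    (1693, 3388)]), (11, [(2663, 2662), (5323, 10648), (13309, 5324), (15971, 31944)]), (13,
    [(79, 26), (181, 364), (313, 78), (389, 156)]), (13, [(1013, 676), (2027, 1352), (3719, 3718)]),
    (17, [(67, 136), (101, 204), (103, 34), (373, 748)]), (17, [(1733, 1156), (3467, 2312),
    (5779, 2312), (6359, 6358)]), (19, [(37, 76), (191, 38), (227, 152), (379, 152), (647, 646),
    (683, 456)]), (23, [(47, 46), (229, 92), (643, 184), (827, 552), (967, 966)]), (29, [(29, 116),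
    (173, 348), (233, 232), (347, 696)]), (31, [(61, 124), (311, 62), (557, 1116), (619, 248),
    (1301, 124), (2729, 1364)])],
  [(10, [(5, 20), (11, 10), (281, 40), (379, 40)]), (2, [(199, 80)]), (2, [(79, 160)]), (2,
    [(31, 64)]), (2, [(3391, 128)]), (2, [(127, 256)]), (2, [(1279, 2560)]), (3, [(13, 6),
    (47, 96)]), (3, [(17, 36), (37, 36)]), (3, [(109, 108)]), (3, [(163, 162), (487, 162)]), (3,
    [(4861, 2430)]), (5, [(149, 100), (449, 900)]), (5, [(1499, 3000), (1999, 4000), (3001, 500),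
    (4751, 250)]), (5, [(1249, 2500), (4999, 10000)]), (7, [(29, 28), (83, 168), (139, 280)]), (3,
    [(1459, 1458), (20411, 40824)]), (7, [(97, 196), (293, 588)]), (7, [(8231, 5488), (8233, 8232),
    (13721, 6860)]), (11, [(43, 88), (67, 66), (307, 88)]), (11, [(241, 484), (1693, 484),
    (2179, 726)]), (13, [(53, 26), (131, 26), (233, 156), (313, 312)]), (13, [(337, 676),
    (1013, 2028), (2027, 4056), (3719, 3718), (4057, 4056)]), (4, [(15359, 6144), (18433, 18432)]),
    (17, [(101, 204), (103, 102), (137, 136), (883, 1768)]), (17, [(1733, 3468), (2311, 4624),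
    (3469, 3468), (13873, 1156), (14449, 28900)]), (19, [(113, 76), (151, 304), (191, 190),
    (457, 228), (569, 1140)]), (23, [(229, 460), (691, 690), (827, 552)])],
  [(2, [(3, 8)]), (2, [(311, 16)]), (3, [(7, 6), (23, 48)]), (3, [(17, 36), (19, 18)]), (3,
    [(107, 216), (433, 108)]), (2, [(431, 864)]), (2, [(31, 64)]), (2, [(191, 384)]), (2,
    [(383, 768)]), (2, [(6911, 13824)]), (3, [(163, 162)]), (5, [(5, 20), (41, 40), (79, 160)]), (5,
    [(199, 400), (449, 300), (601, 600)]), (5, [(251, 250), (751, 250), (3001, 3000)]), (7,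
    [(29, 14), (71, 14), (139, 280)]), (2, [(3583, 7168)]), (2, [(5119, 10240)]), (7, [(97, 196),
    (293, 588)]), (11, [(197, 396), (307, 616), (439, 880), (571, 88)]), (3, [(5347, 5346)]), (11,
    [(241, 484), (967, 1936), (3389, 1694)]), (13, [(103, 208), (131, 26), (181, 364), (521, 520),
    (727, 1456)]), (13, [(2029, 338), (5407, 10816), (8111, 16224)]), (17, [(67, 136), (101, 68),
    (373, 748), (953, 238), (1021, 170)]), (17, [(577, 1156), (3467, 6936), (5779, 11560),
    (8669, 5780), (15607, 15606)]), (19, [(113, 76), (379, 760), (607, 1216)]), (23, [(47, 46),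
    (229, 460), (277, 138), (599, 598), (829, 828)]), (29, [(59, 58), (173, 348), (233, 58),
    (463, 928), (523, 58), (811, 232)])]]

/-- Runs `sieveChain` for the data of `b`, `b + 1`, …. -/
def sieveChainFrom : ℕ → List (List (ℕ × List (ℕ × ℕ))) → Bool
  | _, [] => true
  | b, L :: Ls =>
    forceNat b fun b => forceNat (2 * b) fun a =>
      sieveChain (Nat.beq b 1) a 4 L && sieveChainFrom (b + 1) Ls

theorem sieveChainFrom_sieveData : sieveChainFrom 1 sieveData = true := by decide +kernel

theorem sieveChain_of_sieveChainFrom {b : ℕ} {Ls : List (List (ℕ × List (ℕ × ℕ)))}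
    (h : sieveChainFrom b Ls = true) {i : ℕ} (hi : i < Ls.length) :
    ∃ L, sieveChain (Nat.beq (b + i) 1) (2 * (b + i)) 4 L = true := by
  induction Ls generalizing b i with
  | nil => simp at hi
  | cons L Ls ih =>
    simp only [sieveChainFrom, forceNat_eq, Bool.and_eq_true] at h
    cases i with
    | zero => exact ⟨L, h.1⟩
    | succ i =>
      have := ih h.2 (i := i) (by simpa using hi)
      rwa [add_assoc, add_comm 1 i] at this

theorem eq_zero_of_le_forty_three {b : ℕ} (hb : 1 ≤ b) (hb' : b ≤ 43) {m : ℕ} (hm : Even m)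
    (hlt : m < 2 * 10 ^ 20) (hy : IsSquare (lucasU (2 * b) (m + 1)))
    (hz : b = 1 → IsSquare (9 * lucasU (2 * b) (m + 1) + 4 * lucasU (2 * b) m)) : m = 0 := by
  obtain ⟨L, hL⟩ := sieveChain_of_sieveChainFrom sieveChainFrom_sieveData (i := b - 1)
    (show b - 1 < 43 by omega)
  rw [Nat.add_sub_cancel' hb] at hL
  refine eq_zero_of_sieveChain (by norm_num) hL (fun n ⟨hn, _⟩ => ?_)
    (m := m) ⟨hm, by push_cast; exact hy, fun hw => by
      push_cast; exact hz (Nat.eq_of_beq_eq_true hw)⟩ hlt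
  obtain ⟨k, rfl⟩ := hn
  omega

end SieveData

theorem two_pow_le_lucasU {a : ℤ} (ha : 2 ≤ a) (n : ℕ) : 2 ^ n ≤ lucasU a (n + 1) := by
  induction n with
  | zero => simp
  | succ n ih =>
    have h := lucasU_nonneg (by omega : 1 ≤ a) n
    rw [lucasU_add_two, pow_succ]
    nlinarith [mul_le_mul_of_nonneg_right ha (lucasU_pos (by omega : 1 ≤ a) n).le]

theorem lucasU_two_mul_emod_two (b : ℤ) (n : ℕ) : lucasU (2 * b) n % 2 = n % 2 := by
  induction n using Nat.twoStepInduction with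
  | zero => rfl
  | one => rfl
  | more n h1 _ =>
    rw [lucasU_add_two, mul_assoc]
    push_cast
    omega

/-- A square term of odd index yields a solution of a quartic Thue equation. -/
theorem exists_quartic_eq_one {b : ℤ} (hb : 1 ≤ b) {k : ℕ} {y : ℤ}
    (hy : y ^ 2 = lucasU (2 * b) (2 * k + 1)) :
    ∃ r s : ℤ, r ^ 4 - 4 * b * r ^ 3 * s - 6 * r ^ 2 * s ^ 2 + 4 * b * r * s ^ 3 + s ^ 4 = 1 ∧
      y ^ 2 = (r ^ 2 + s ^ 2) ^ 2 ∧ (r * s = 0 → k = 0) := by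
  have ha : 1 ≤ 2 * b := by omega
  have hC := lucasU_cassini (2 * b) k
  have hgcd := Int.isCoprime_iff_gcd_eq_one.1 (isCoprime_lucasU (2 * b) k)
  have hp1 := lucasU_two_mul_emod_two b k
  have hp2 := lucasU_two_mul_emod_two b (k + 1)
  have hpos := lucasU_pos ha k
  have hy' := hy
  rw [lucasU_two_mul_add_one] at hy'
  have habs : 0 < |y| := by
    rw [abs_pos]
    rintro rfl
    nlinarith [sq_nonneg (lucasU (2 * b) k)]
  rcases Nat.even_or_odd k with hk | hk
  · rw [hk.neg_one_pow] at hC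
    have hT : PythagoreanTriple (lucasU (2 * b) (k + 1)) (lucasU (2 * b) k) |y| := by
      rw [PythagoreanTriple, abs_mul_abs_self]
      linarith
    obtain ⟨r, s, h1, h2, h3, -⟩ := hT.coprime_classification' (by rwa [Int.gcd_comm])
      (by have := Nat.even_iff.1 hk; omega) habs
    refine ⟨r, s, ?_, by rw [← h3, sq_abs], fun h0 => ?_⟩
    · rw [h1, h2] at hC
      linarith
    · rw [mul_assoc, h0] at h2
      cases k with
      | zero => rfl
      | succ k => exact absurd h2 (lucasU_pos ha k).ne'
  · rw [hk.neg_one_pow] at hC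
    have hT : PythagoreanTriple (lucasU (2 * b) k) (lucasU (2 * b) (k + 1)) |y| := by
      rw [PythagoreanTriple, abs_mul_abs_self]
      linarith
    obtain ⟨r, s, h1, h2, h3, -⟩ := hT.coprime_classification' hgcd
      (by have := Nat.odd_iff.1 hk; omega) habs
    refine ⟨r, -s, ?_, by rw [neg_sq, ← h3, sq_abs], fun h0 => ?_⟩
    · rw [h1, h2] at hC
      linarith
    · rw [mul_assoc, show r * s = 0 by linarith] at h2
      exact absurd h2 hpos.ne'

theorem eq_zero_of_sq_eq_lucasU_odd {b : ℕ} (hb : 1 ≤ b) {m : ℕ} (hm : Even m)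
    (hy : IsSquare (lucasU (2 * b) (m + 1)))
    (hz : b = 1 → IsSquare (9 * lucasU (2 * b) (m + 1) + 4 * lucasU (2 * b) m)) : m = 0 := by
  obtain ⟨k, rfl⟩ := even_iff_exists_two_mul.1 hm
  obtain ⟨y, hy'⟩ := hy
  rw [← sq] at hy'
  obtain ⟨r, s, hrs, hyrs, h0⟩ := exists_quartic_eq_one (by exact_mod_cast hb) hy'.symm
  rcases le_or_gt 44 b with h44 | h44
  · rw [h0 (mul_eq_zero_of_forty_four_le h44 hrs), mul_zero]
  · refine eq_zero_of_le_forty_three hb (by omega) hm ?_ ⟨y, by rw [hy', sq]⟩ hz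
    have h1 := log_sq_add_sq_lt hb (by omega) hrs
    have h2 := two_pow_le_lucasU (a := 2 * b) (by omega) (2 * k)
    rw [hy', hyrs] at h2
    have h3 : (2 : ℝ) ^ (2 * k) ≤ ((r : ℝ) ^ 2 + (s : ℝ) ^ 2) ^ 2 := by exact_mod_cast h2
    have h4 := Real.log_le_log (by positivity) h3
    rw [Real.log_pow, Real.log_pow] at h4
    have h5 := Real.log_two_gt_d9
    have h6 : ((2 * k : ℕ) : ℝ) < 2 * 10 ^ 20 := by
      have : (0 : ℝ) ≤ ((2 * k : ℕ) : ℝ) := by positivity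
      have h7 : ((2 * k : ℕ) : ℝ) * 0.5 ≤ ((2 * k : ℕ) : ℝ) * Real.log 2 := by gcongr; linarith
      push_cast at h4 h7 ⊢
      linarith
    exact_mod_cast h6

theorem exists_pow_four_of_isCoprime {x y z : ℤ} (h : IsCoprime x y) (hx : 0 < x) (hy : 0 < y)
    (hz : z ^ 4 = x * y) : ∃ s t, x = s ^ 4 ∧ y = t ^ 4 := by
  obtain ⟨s, t, rfl, rfl⟩ := exists_sq_of_isCoprime (z := z ^ 2) h hx hy (by rw [← hz]; ring)
  have hst : IsCoprime |s| |t| := by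
    rw [IsCoprime.pow_iff two_pos two_pos] at h
    rwa [Int.isCoprime_iff_gcd_eq_one, Int.gcd_eq_natAbs, Int.natAbs_abs, Int.natAbs_abs,
      ← Int.gcd_eq_natAbs, ← Int.isCoprime_iff_gcd_eq_one]
  have hz2 : z ^ 2 = |s| * |t| := by
    rw [← abs_mul, ← abs_of_nonneg (sq_nonneg z), ← sq_eq_sq_iff_abs_eq_abs, mul_pow, ← hz]
    ring
  obtain ⟨u, v, hu, hv⟩ := exists_sq_of_isCoprime hst (abs_pos.2 (by rintro rfl; simp at hx))
    (abs_pos.2 (by rintro rfl; simp at hy)) hz2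
  exact ⟨u, v, by rw [← sq_abs, hu]; ring, by rw [← sq_abs, hv]; ring⟩

theorem eq_zero_of_two_mul_pow_four_add_one_eq_sq {q t : ℤ} (h : 2 * q ^ 4 + 1 = t ^ 2) :
    q = 0 := by
  by_contra hq
  have hq4 : 0 < q ^ 4 := by positivity
  rw [← sq_abs] at h
  have ht : 1 < |t| := by
    by_contra! ht
    nlinarith [abs_nonneg t]
  obtain ⟨u, hu⟩ : ∃ u, |t| = 2 * u + 1 := by
    have : Odd (|t| ^ 2) := ⟨q ^ 4, h.symm⟩
    exact (Int.odd_pow.1 this).resolve_right two_ne_zero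
  rw [hu] at h
  obtain ⟨r, rfl⟩ : Even q := by
    have : Even (q ^ 4) := ⟨u * (u + 1), by linarith⟩
    exact (Int.even_pow.1 this).1
  have hr : 0 < r ^ 4 := by
    have : r ≠ 0 := by rintro rfl; simp at hq
    positivity
  have h1 : 8 * r ^ 4 = u * (u + 1) := by linarith
  rcases Int.even_or_odd u with hu2 | hu2
  · have hc : IsCoprime (8 : ℤ) (u + 1) := by
      rw [show (8 : ℤ) = 2 ^ 3 by norm_num]
      exact IsCoprime.pow_left (Int.isCoprime_two_left.2 hu2.add_one)
    obtain ⟨A, rfl⟩ := hc.dvd_of_dvd_mul_right ⟨_, h1.symm⟩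
    obtain ⟨γ, α, hγ, hα⟩ := exists_pow_four_of_isCoprime (x := A) (y := 8 * A + 1) (z := r)
      ⟨-8, 1, by ring⟩ (by omega) (by omega) (by linarith)
    obtain ⟨β, hβ⟩ : Odd (α ^ 2) := by
      have : Odd (α ^ 4) := ⟨4 * A, by linarith⟩
      rw [Int.odd_pow' (by norm_num)] at this ⊢
      exact this
    obtain ⟨C, rfl⟩ : ∃ C, β = 4 * C := by
      have : Odd α := by
        have : Odd (α ^ 2) := ⟨β, hβ⟩
        exact (Int.odd_pow' (by norm_num)).1 this
      obtain ⟨c, rfl⟩ := this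
      obtain ⟨e, he⟩ := Int.even_mul_succ_self c
      exact ⟨e, by linarith⟩
    have h2 : γ ^ 4 = 2 * C * (4 * C + 1) := by
      have : 8 * A + 1 = (2 * (4 * C) + 1) ^ 2 := by rw [hα, ← hβ]; ring
      linarith
    have hC : 0 < C := by
      have h3 : 0 ≤ C := by nlinarith [sq_nonneg α]
      rcases h3.eq_or_lt with rfl | h3
      · nlinarith
      · exact h3
    obtain ⟨e, -, he, -⟩ := exists_pow_four_of_isCoprime (x := 2 * C) (y := 4 * C + 1)
      ⟨-2, 1, by ring⟩ (by omega) (by omega) h2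
    refine sq_ne_sq_mul_add_four (v := 4 * e ^ 2) (z := 2 * α) (fun h0 => ?_) (by linarith)
    rw [show e ^ 4 = (e ^ 2) ^ 2 by ring, show e ^ 2 = 0 by linarith] at he
    omega
  · have hc : IsCoprime (8 : ℤ) u := by
      rw [show (8 : ℤ) = 2 ^ 3 by norm_num]
      exact IsCoprime.pow_left (Int.isCoprime_two_left.2 hu2)
    obtain ⟨A, hA⟩ := hc.dvd_of_dvd_mul_left ⟨_, h1.symm⟩
    obtain rfl : u = 8 * A - 1 := by omega
    obtain ⟨γ, α, -, hα⟩ := exists_pow_four_of_isCoprime (x := A) (y := 8 * A - 1) (z := r)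
      ⟨8, -1, by ring⟩ (by omega) (by omega) (by linarith)
    rw [show α ^ 4 = (α ^ 2) ^ 2 by ring] at hα
    have := Int.emod_two_eq (α ^ 2)
    generalize α ^ 2 = β at hα this
    rcases Int.even_or_odd' β with ⟨c, rfl | rfl⟩ <;> ring_nf at hα <;> omega

theorem gcd_eq_one_of_isCoprime {x y : ℤ} (h : IsCoprime x y) : Int.gcd x y = 1 :=
  Int.isCoprime_iff_gcd_eq_one.1 h

theorem exists_smaller_sub_pow_four {x y E O : ℤ} (hE : Even E) (hO : Odd O) (hc : IsCoprime E O)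
    (hE0 : 0 < E) (hO0 : 0 < O) (hy : y ^ 2 = 2 * (E * O)) (hx : x ^ 2 = E ^ 2 + O ^ 2) :
    ∃ X Y Z : ℤ, X.natAbs < x.natAbs ∧ IsCoprime X Y ∧ Even Y ∧ X ^ 4 - Y ^ 4 = Z ^ 2 ∧ Y ≠ 0 := by
  obtain ⟨F, rfl⟩ := even_iff_exists_two_mul.1 hE
  obtain ⟨w, rfl⟩ : Even y := by
    have : Even (y ^ 2) := ⟨2 * F * O, by linarith⟩
    exact (Int.even_pow.1 this).1
  obtain ⟨r, s, rfl, rfl⟩ := exists_sq_of_isCoprime (x := F) (y := O) (z := w)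
    hc.of_mul_left_right (by omega) hO0 (by linarith)
  have hT : PythagoreanTriple (s ^ 2) (2 * r ^ 2) |x| := by
    rw [PythagoreanTriple, abs_mul_abs_self]
    linarith
  have hx0 : 0 < |x| := by
    rw [abs_pos]
    rintro rfl
    nlinarith
  obtain ⟨d, e, h1, h2, h3, h4, h5, h6⟩ :=
    hT.coprime_classification' (gcd_eq_one_of_isCoprime hc.symm) (Int.odd_iff.1 hO) hx0
  have hde : r ^ 2 = d * e := by linarith
  have hr : 0 < d * e := by linarith
  have hd : 0 < d := by
    rcases h6.eq_or_lt with rfl | h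
    · simp at hr
    · exact h
  have he : 0 < e := by
    by_contra! h
    nlinarith
  obtain ⟨X, Y, rfl, rfl⟩ :=
    exists_sq_of_isCoprime (Int.isCoprime_iff_gcd_eq_one.2 h4) hd he hde
  have hYe : Y ^ 2 % 2 = 0 := by
    rcases h5 with ⟨h5, h5'⟩ | ⟨-, h5⟩
    · obtain ⟨g, hg⟩ : ∃ g, X ^ 2 = 2 * g := ⟨X ^ 2 / 2, by omega⟩
      obtain ⟨k, hk⟩ : ∃ k, Y ^ 2 = 2 * k + 1 := ⟨Y ^ 2 / 2, by omega⟩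
      rw [hg, hk] at h1
      obtain ⟨c, hc⟩ := Int.odd_pow' two_ne_zero |>.1 hO
      rw [hc] at h1
      ring_nf at h1
      omega
    · exact h5
  refine ⟨X, Y, s, ?_, ?_, ?_, by rw [h1]; ring, by rintro rfl; simp at he⟩
  · zify
    have : |X| ≤ X ^ 2 := by
      rw [← sq_abs]
      nlinarith [Int.one_le_abs (z := X) (by rintro rfl; simp at hd)]
    nlinarith
  · exact (IsCoprime.pow_iff two_pos two_pos).1 (Int.isCoprime_iff_gcd_eq_one.2 h4)
  · exact (Int.even_pow.1 (Int.even_iff.2 hYe)).1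

/-- Fermat's theorem on differences of fourth powers, for coprime bases of different parity. -/
theorem eq_zero_of_pow_four_sub_pow_four_eq_sq {x y z : ℤ} (hc : IsCoprime x y) (hy : Even y)
    (h : x ^ 4 - y ^ 4 = z ^ 2) : y = 0 := by
  induction hn : x.natAbs using Nat.strong_induction_on generalizing x y z with
  | _ n ih =>
    subst hn
    by_contra hy0
    have hx : Odd x := Int.isCoprime_two_right.1 (hc.of_isCoprime_of_dvd_right hy.two_dvd)
    have hz : Odd (z ^ 2) := by
      rw [← h]
      exact hx.pow.sub_even (hy.pow_of_ne_zero (by norm_num))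
    have hT : PythagoreanTriple z (y ^ 2) (x ^ 2) := by
      rw [PythagoreanTriple]
      linarith
    have hzy : IsCoprime z (y ^ 2) := by
      have h1 : IsCoprime (z ^ 2) (y ^ 4) := by
        rw [← h]
        have := (hc.pow (m := 4) (n := 4)).add_mul_left_left (-1)
        rwa [mul_neg_one, ← sub_eq_add_neg] at this
      exact ((IsCoprime.pow_iff two_pos four_pos).1 h1).pow_right
    have hx2 : 0 < x ^ 2 := by
      have : x ≠ 0 := by rintro rfl; simp at hx
      positivity
    obtain ⟨m, n, h1, h2, h3, h4, h5, h6⟩ := hT.coprime_classification'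
      (gcd_eq_one_of_isCoprime hzy) (Int.odd_iff.1 ((Int.odd_pow' two_ne_zero).1 hz)) hx2
    have h4 := Int.isCoprime_iff_gcd_eq_one.2 h4
    have hmn : 0 < m * n := by
      have : 0 < y ^ 2 := by positivity
      linarith
    have hm : 0 < m := by
      rcases h6.eq_or_lt with rfl | h
      · simp at hmn
      · exact h
    have hn : 0 < n := by
      by_contra! h
      nlinarith
    obtain ⟨X, Y, Z, i1, i2, i3, i4, i5⟩ : ∃ X Y Z : ℤ, X.natAbs < x.natAbs ∧ IsCoprime X Y ∧
        Even Y ∧ X ^ 4 - Y ^ 4 = Z ^ 2 ∧ Y ≠ 0 := by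
      rcases h5 with ⟨h5, h5'⟩ | ⟨h5, h5'⟩
      · exact exists_smaller_sub_pow_four (y := y) (Int.even_iff.2 h5) (Int.odd_iff.2 h5') h4 hm hn
          (by linarith) h3
      · exact exists_smaller_sub_pow_four (y := y) (Int.even_iff.2 h5')
          (Int.odd_iff.2 h5) h4.symm hn hm
          (by linarith) (by linarith)
    exact i5 (ih _ i1 i2 i3 i4 rfl)

theorem sq_eq_one_of_pow_four_add_one_eq {w v : ℤ} (h : w ^ 4 + 1 = 2 * v ^ 4) : w ^ 2 = 1 := by
  have hw : Odd (w ^ 4) := ⟨v ^ 4 - 1, by linarith⟩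
  have hw' : Odd (w ^ 2) := ((Int.odd_pow' (by norm_num)).1 hw).pow
  obtain ⟨z, hz⟩ := hw
  have hv : v ^ 4 = z + 1 := by linarith
  have hT : PythagoreanTriple (w ^ 2) z (v ^ 4) := by
    rw [PythagoreanTriple, hv]
    linarith
  have hv0 : 0 < v ^ 4 := by
    have : 0 < 2 * v ^ 4 := by rw [← h]; positivity
    linarith
  obtain ⟨m, n, h1, h2, h3, h4, h5, h6⟩ := hT.coprime_classification'
    (gcd_eq_one_of_isCoprime ⟨w ^ 2, -2, by linarith⟩) (Int.odd_iff.1 hw') hv0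
  have hn : Even n := by
    rw [Int.even_iff]
    rcases h5 with ⟨h5, h5'⟩ | ⟨-, h5⟩
    · obtain ⟨g, rfl⟩ : ∃ g, m = 2 * g := ⟨m / 2, by omega⟩
      obtain ⟨k, rfl⟩ : ∃ k, n = 2 * k + 1 := ⟨n / 2, by omega⟩
      obtain ⟨c, rfl⟩ := (Int.odd_pow' two_ne_zero).1 hw'
      ring_nf at h1
      omega
    · exact h5
  have hn0 := eq_zero_of_pow_four_sub_pow_four_eq_sq (x := m) (y := n) (z := w * v ^ 2)
    (Int.isCoprime_iff_gcd_eq_one.2 h4) hn (by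
      rw [mul_pow, h1, show (v ^ 2) ^ 2 = v ^ 4 by ring, h3]
      ring)
  rw [hn0, mul_zero] at h2
  have : (w ^ 2) ^ 2 = 1 ^ 2 := by rw [h2] at hz; linarith
  nlinarith [sq_nonneg w]

/-- Half of the companion Lucas sequence `lucasV (2 * b)`. -/
def lucasQ (b : ℤ) (n : ℕ) : ℤ := lucasU (2 * b) (n + 1) - b * lucasU (2 * b) n

theorem lucasV_two_mul_eq (b : ℤ) (n : ℕ) : lucasV (2 * b) n = 2 * lucasQ b n := by
  rw [lucasV, lucasQ]
  ring

theorem lucasU_two_mul_eq (b : ℤ) (n : ℕ) :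
    lucasU (2 * b) (2 * n) = 2 * (lucasU (2 * b) n * lucasQ b n) := by
  rw [lucasU_two_mul, lucasV_two_mul_eq]
  ring

theorem lucasQ_two_mul (b : ℤ) (n : ℕ) : lucasQ b (2 * n) = 2 * lucasQ b n ^ 2 - (-1) ^ n := by
  have h := lucasV_two_mul (2 * b) n
  rw [lucasV_two_mul_eq, lucasV_two_mul_eq] at h
  linarith

theorem isCoprime_lucasU_lucasQ (b : ℤ) (n : ℕ) : IsCoprime (lucasU (2 * b) n) (lucasQ b n) := by
  have := (isCoprime_lucasU (2 * b) n).add_mul_left_right (-b)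
  rwa [mul_neg, ← sub_eq_add_neg, mul_comm (lucasU _ n) b] at this

theorem lucasQ_pos {b : ℤ} (hb : 1 ≤ b) (n : ℕ) : 0 < lucasQ b n := by
  have := lucasV_pos (by omega : 1 ≤ 2 * b) n
  rw [lucasV_two_mul_eq] at this
  omega

theorem odd_lucasQ_of_even (b : ℤ) {n : ℕ} (hn : Even n) : Odd (lucasQ b n) := by
  obtain ⟨m, rfl⟩ := even_iff_exists_two_mul.1 hn
  rw [lucasQ_two_mul]
  exact (even_two_mul _).sub_odd (odd_one.neg.pow)

theorem lucasQ_emod_two_of_odd (b : ℤ) {n : ℕ} (hn : Odd n) : lucasQ b n % 2 = b % 2 := by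
  have h1 := lucasU_two_mul_emod_two b n
  have h2 := lucasU_two_mul_emod_two b (n + 1)
  have h3 := Nat.odd_iff.1 hn
  obtain ⟨c, hc⟩ : ∃ c, lucasU (2 * b) n = 2 * c + 1 := ⟨lucasU (2 * b) n / 2, by omega⟩
  rw [lucasQ, hc, mul_add, mul_left_comm, mul_one]
  omega

/-- If `Uₙ` is a square with `4 ∣ n`, then so are `Uⱼ`, `Qⱼ` and `Q₂ⱼ` for `j = n / 4`. -/
theorem exists_sq_of_sq_eq_lucasU_four_mul {b y : ℤ} (hb : 1 ≤ b) {j : ℕ} (hj : j ≠ 0)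
    (hy : y ^ 2 = lucasU (2 * b) (2 * (2 * j))) :
    ∃ p q t, lucasU (2 * b) j = p ^ 2 ∧ lucasQ b j = q ^ 2 ∧ lucasQ b (2 * j) = t ^ 2 := by
  have ha : 1 ≤ 2 * b := by omega
  obtain ⟨i, rfl⟩ := Nat.exists_eq_succ_of_ne_zero hj
  have hodd := odd_lucasQ_of_even b (even_two_mul (i + 1))
  have hpos := lucasU_pos ha (2 * i + 1)
  rw [lucasU_two_mul_eq, ← mul_assoc] at hy
  obtain ⟨s, t, hs, ht⟩ := exists_sq_of_isCoprime
    ((Int.isCoprime_two_left.2 hodd).mul_left (isCoprime_lucasU_lucasQ b (2 * (i + 1))))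
    (mul_pos two_pos hpos) (lucasQ_pos hb _) hy
  obtain ⟨r, rfl⟩ : Even s := by
    have : Even (s ^ 2) := hs ▸ even_two_mul _
    exact (Int.even_pow.1 this).1
  rw [lucasU_two_mul_eq] at hs
  obtain ⟨p, q, hp, hq⟩ := exists_sq_of_isCoprime (z := r) (isCoprime_lucasU_lucasQ b (i + 1))
    (lucasU_pos ha i) (lucasQ_pos hb _) (by linarith)
  exact ⟨p, q, t, hp, hq, ht⟩

theorem eq_two_of_sq_eq_lucasU_even {b : ℕ} (hb : 1 ≤ b) {n : ℕ} (hn : Even n) (hn0 : n ≠ 0)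
    {y : ℤ} (hy : y ^ 2 = lucasU (2 * b) n) : n = 2 := by
  have hb' : (1 : ℤ) ≤ b := by exact_mod_cast hb
  have ha : (1 : ℤ) ≤ 2 * b := by omega
  induction n using Nat.strong_induction_on generalizing y with
  | _ n ih =>
    obtain ⟨m, rfl⟩ := even_iff_exists_two_mul.1 hn
    rcases Nat.even_or_odd m with hm | hm
    · exfalso
      obtain ⟨j, rfl⟩ := even_iff_exists_two_mul.1 hm
      obtain ⟨p, q, t, hp, hq, ht⟩ := exists_sq_of_sq_eq_lucasU_four_mul hb' (by omega) hy
      rcases Nat.even_or_odd j with hj | hj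
      · obtain rfl := ih j (by omega) hj (by omega) hp.symm
        have h1 := lucasQ_two_mul (b : ℤ) 2
        rw [ht, hq] at h1
        have h2 := lucasQ_two_mul (b : ℤ) 1
        rw [mul_one, hq] at h2
        simp only [lucasQ, lucasU_one, one_add_one_eq_two, lucasU_two, pow_one] at h2
        rw [lucasU_two] at hp
        obtain ⟨s, rfl⟩ : Even p := by
          have : Even (p ^ 2) := hp ▸ even_two_mul _
          exact (Int.even_pow.1 this).1
        have hbs : (b : ℤ) = 2 * s ^ 2 := by linarith
        have hs : s ≠ 0 := by rintro rfl; simp at hbs; omega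
        rw [hbs] at h2
        rw [← sq_abs] at h2
        obtain ⟨u, hu⟩ : Odd |q| := by
          have : Odd (|q| ^ 2) := ⟨4 * s ^ 4, by linarith⟩
          exact (Int.odd_pow' two_ne_zero).1 this
        have hu0 : 0 ≤ u := by have := abs_nonneg q; omega
        rw [hu] at h2
        have h3 : 2 * s ^ 4 = u * (u + 1) := by linarith
        have hs4 : 0 < s ^ 4 := by positivity
        have hu1 : 0 < u := by
          rcases hu0.eq_or_lt with rfl | h
          · simp at h3; exact absurd h3 hs
          · exact h
        rcases Int.even_or_odd' u with ⟨c, rfl | rfl⟩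
        · obtain ⟨v, w, rfl, hw⟩ := exists_pow_four_of_isCoprime (x := c) (y := 2 * c + 1)
            (z := s) ⟨-2, 1, by ring⟩ (by omega) (by omega) (by linarith)
          rw [eq_zero_of_two_mul_pow_four_add_one_eq_sq (q := v) (t := w ^ 2)
            (by rw [hw]; ring)] at hu1
          simp at hu1
        · obtain ⟨w, v, hw, hv⟩ := exists_pow_four_of_isCoprime (x := 2 * c + 1) (y := c + 1)
            (z := s) ⟨-1, 2, by ring⟩ (by omega) (by omega) (by linarith)
          have h4 := sq_eq_one_of_pow_four_add_one_eq (w := w) (v := v)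
            (by rw [← hw, ← hv]; ring)
          have h5 : c = 0 := by
            rw [show w ^ 4 = (w ^ 2) ^ 2 by ring, h4] at hw
            omega
          subst h5
          have h6 : |t| ^ 2 = 161 := by
            rw [sq_abs, h1, ← sq_abs q, hu]
            norm_num
          have h7 : |t| < 13 := by nlinarith [abs_nonneg t]
          have h8 := abs_nonneg t
          interval_cases |t| <;> omega
      · have h1 := lucasQ_two_mul (b : ℤ) j
        rw [hj.neg_one_pow, ht, hq] at h1
        have h2 := eq_zero_of_two_mul_pow_four_add_one_eq_sq (q := q) (t := t) (by linarith)
        have h3 := lucasQ_pos hb' j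
        rw [hq, h2] at h3
        simp at h3
    · obtain ⟨k, rfl⟩ := hm
      have hodd : Odd (lucasU (2 * b) (2 * k + 1)) := by
        rw [Int.odd_iff, lucasU_two_mul_emod_two]
        omega
      rw [lucasU_two_mul_eq, mul_left_comm] at hy
      obtain ⟨s, t, hs, ht⟩ := exists_sq_of_isCoprime
        ((Int.isCoprime_two_right.2 hodd).mul_right (isCoprime_lucasU_lucasQ (b : ℤ) (2 * k + 1)))
        (lucasU_pos ha _) (mul_pos two_pos (lucasQ_pos hb' _)) hy
      have hQ : Even (lucasQ b (2 * k + 1)) := by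
        obtain ⟨r, rfl⟩ : Even t := by
          have : Even (t ^ 2) := ht ▸ even_two_mul _
          exact (Int.even_pow.1 this).1
        exact ⟨r ^ 2, by linarith⟩
      rw [Int.even_iff, lucasQ_emod_two_of_odd (b : ℤ) (odd_two_mul_add_one k)] at hQ
      have := eq_zero_of_sq_eq_lucasU_odd hb (even_two_mul k) ⟨s, by rw [hs, sq]⟩
        (fun h => by omega)
      omega

theorem eq_zero_of_even {a : ℤ} (ha : Even a) (ha1 : 1 ≤ a) {m : ℕ} {y : ℤ}
    (hy : y ^ 2 = lucasU a (m + 1)) (h : DiscrIsSq a m) : m = 0 := by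
  obtain ⟨c, rfl⟩ := even_iff_exists_two_mul.1 ha
  obtain ⟨b, rfl⟩ := Int.eq_ofNat_of_zero_le (by omega : 0 ≤ c)
  have hb : 1 ≤ b := by omega
  rcases Nat.even_or_odd m with hm | hm
  · by_contra hm0
    refine hm0 (eq_zero_of_sq_eq_lucasU_odd hb hm ⟨y, by rw [← hy, sq]⟩ ?_)
    rintro rfl
    obtain ⟨z, h | h⟩ := h
    · refine ⟨z, ?_⟩
      rw [← sq, h]
      push_cast
      ring
    · exfalso
      obtain ⟨k, rfl⟩ : ∃ k, m = k + 2 := ⟨m - 2, by obtain ⟨j, rfl⟩ := hm; omega⟩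
      rw [lucasU_add_two _ (k + 1), lucasU_add_two _ k] at h
      push_cast at h
      have := lucasU_pos ha1 k
      have := lucasU_nonneg ha1 k
      push_cast at *
      nlinarith [sq_nonneg z]
  · have h2 := eq_two_of_sq_eq_lucasU_even hb hm.add_one (by omega) hy
    obtain rfl : m = 1 := by omega
    exact (eq_two_contradiction ha1 hy h).elim

theorem eq_zero_of_sq_eq_lucasU {a : ℤ} (ha1 : 1 ≤ a) {m : ℕ} {y : ℤ}
    (hy : y ^ 2 = lucasU a (m + 1)) (h : DiscrIsSq a m) : m = 0 :=
  (Int.even_or_odd a).elim (fun ha => eq_zero_of_even ha ha1 hy h)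
    fun ha => eq_zero_of_odd ha ha1 hy h

theorem quartic_eq_norm (a x y : ℤ) :
    x * (x - y) * (x - a * y) * (x - (a + 1) * y) - y ^ 4 =
      (x ^ 2 - (a + 1) * x * y) ^ 2 + a * (x ^ 2 - (a + 1) * x * y) * y ^ 2 - (y ^ 2) ^ 2 := by
  ring

theorem quartic_solution_of_pos {a x y : ℤ} (ha : 1 ≤ a)
    (h : x * (x - y) * (x - a * y) * (x - (a + 1) * y) - y ^ 4 = 1 ∨
      x * (x - y) * (x - a * y) * (x - (a + 1) * y) - y ^ 4 = -1) :
    y = 0 ∨ y ^ 2 = 1 ∧ x * (x - y) * (x - a * y) * (x - (a + 1) * y) = 0 := by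
  rw [quartic_eq_norm] at h
  rcases eq_or_ne y 0 with hy | hy
  · exact .inl hy
  right
  have hy1 : 0 < y ^ 2 := by positivity
  set u := x ^ 2 - (a + 1) * x * y with hu
  rcases le_or_gt 0 u with hu0 | hu0
  · obtain ⟨m, hm, hm'⟩ := exists_lucasU_of_norm_eq ha hu0 hy1 h
    obtain rfl := eq_zero_of_sq_eq_lucasU ha hm'
      ⟨2 * x - (a + 1) * y, .inl (by rw [← hm, ← hm', hu]; ring)⟩
    refine ⟨by rw [hm', zero_add, lucasU_one], ?_⟩
    rw [lucasU_zero] at hm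
    linear_combination (u + a * y ^ 2) * hm
  · obtain ⟨n, hn, hn'⟩ := exists_lucasU_of_norm_eq (u := y ^ 2) (t := -u) ha (by omega) (by omega)
      (by rcases h with h | h
          · exact .inr (by linarith)
          · exact .inl (by linarith))
    obtain _ | m := n
    · rw [lucasU_zero] at hn
      omega
    rw [lucasU_add_two, ← hn] at hn'
    obtain rfl := eq_zero_of_sq_eq_lucasU ha hn
      ⟨2 * x - (a + 1) * y, .inr (by rw [← hn]; linear_combination (-4) * hn' + 4 * hu)⟩
    rw [zero_add, lucasU_one] at hn
    refine ⟨hn, ?_⟩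
    rw [lucasU_zero] at hn'
    linear_combination (-u) * hn'

theorem quartic_solution {a x y : ℤ}
    (h : x * (x - y) * (x - a * y) * (x - (a + 1) * y) - y ^ 4 = 1 ∨
      x * (x - y) * (x - a * y) * (x - (a + 1) * y) - y ^ 4 = -1) :
    y = 0 ∨ y ^ 2 = 1 ∧ x * (x - y) * (x - a * y) * (x - (a + 1) * y) = 0 := by
  rcases lt_trichotomy a 0 with ha | rfl | ha
  · have e : (y - x) * (y - x - y) * (y - x - -a * y) * (y - x - (-a + 1) * y) =
        x * (x - y) * (x - a * y) * (x - (a + 1) * y) := by ring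
    rw [← e] at h ⊢
    exact quartic_solution_of_pos (by omega) h
  · have e : x * (x - y) * (x - 0 * y) * (x - (0 + 1) * y) - y ^ 4 =
        (x * (x - y) - y ^ 2) * (x * (x - y) + y ^ 2) := by ring
    have h1 : x * (x - y) - y ^ 2 = x * (x - y) + y ^ 2 ∨
        x * (x - y) - y ^ 2 = -(x * (x - y) + y ^ 2) := by
      rw [e] at h
      rcases h with h | h
      · exact .inl (Int.eq_of_mul_eq_one h)
      · exact .inr (Int.eq_of_mul_eq_one (by linarith))
    rcases h1 with h1 | h1
    · left
      have : y ^ 2 = 0 := by linarith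
      exact pow_eq_zero_iff two_ne_zero |>.1 this
    · have h2 : x * (x - y) = 0 := by linarith
      rw [h2] at h
      right
      refine ⟨?_, by rw [h2]; ring⟩
      have h3 : y ^ 2 * y ^ 2 = 1 := by
        rcases h with h | h
        · nlinarith [sq_nonneg (y ^ 2)]
        · linarith
      nlinarith [sq_nonneg y]
  · exact quartic_solution_of_pos ha h

/-- Heuberger–Pethő–Tichy (1998): complete solution of the family of quartic
Thue equations `x(x-y)(x-ay)(x-(a+1)y) - y⁴ = ±1`. -/
theorem heuberger_petho_tichy_quartic_family (a : ℤ) :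
    {p : ℤ × ℤ |
        p.1 * (p.1 - p.2) * (p.1 - a * p.2) * (p.1 - (a + 1) * p.2) - p.2 ^ 4 = 1 ∨
        p.1 * (p.1 - p.2) * (p.1 - a * p.2) * (p.1 - (a + 1) * p.2) - p.2 ^ 4 = -1} =
      {(1, 0), (-1, 0), (0, 1), (0, -1), (1, 1), (-1, -1),
        (a, 1), (-a, -1), (a + 1, 1), (-(a + 1), -1)} := by
  ext ⟨x, y⟩
  simp only [Set.mem_ofPred_eq, Set.mem_insert_iff, Set.mem_singleton_iff, Prod.mk.injEq]
  constructor
  · intro h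
    rcases quartic_solution h with rfl | ⟨hy, hx⟩
    · have : x ^ 2 * x ^ 2 = 1 := by
        rcases h with h | h
        · linarith
        · nlinarith [sq_nonneg (x ^ 2)]
      have hx : x ^ 2 = 1 := by nlinarith [sq_nonneg x]
      rcases sq_eq_one_iff.1 hx with rfl | rfl <;> simp
    · simp only [mul_eq_zero] at hx
      rcases sq_eq_one_iff.1 hy with rfl | rfl <;> omega
  · rintro (⟨rfl, rfl⟩ | ⟨rfl, rfl⟩ | ⟨rfl, rfl⟩ | ⟨rfl, rfl⟩ | ⟨rfl, rfl⟩ | ⟨rfl, rfl⟩ |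
      ⟨rfl, rfl⟩ | ⟨rfl, rfl⟩ | ⟨rfl, rfl⟩ | ⟨rfl, rfl⟩) <;> first | (left; ring1) | (right; ring1)
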